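/- Let 2 < c < 37/18, set δ = c/2 − 1 + η, and let x be a real number with τ ≤ |x| ≤ K. Let M, N ≥ 1 with MN ≍ X (that is, MN is of exact order X) and X^{72δ/7} ≪ M ≪ X^{1/2}, and let (a_m), (b_n) be complex numbers with |a_m| ≪ 1 and |b_n| ≪ 1. Then |Σ_{M < m ≤ 2M} Σ_{N < n ≤ 2N} a_m b_n e(x m^c n^c)| ≪ X^{1−δ}, where the implied constant depends only on c and η. -/

import Mathlib

set_option linter.all false

noncomputable def e (t : ℝ) : ℂ := Complex.exp (2 * Real.pi * Complex.I * t)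

lemma e_norm (t : ℝ) : ‖e t‖ = 1 := by
  unfold e
  rw [Complex.norm_exp]; simp
lemma e_add (s t : ℝ) : e (s + t) = e s * e t := by
  unfold e; rw [← Complex.exp_add]; congr 1; push_cast; ring
lemma e_zero : e 0 = 1 := by simp [e]
lemma e_conj (t : ℝ) : (starRingEnd ℂ) (e t) = e (-t) := by
  unfold e; rw [← Complex.exp_conj]; congr 1; simp; left; exact Complex.conj_ofNat 2
lemma e_int (n : ℤ) : e n = 1 := by
  unfold e; rw [Complex.exp_eq_one_iff]; exact ⟨n, by push_cast; ring⟩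

open Finset
lemma wsum_shift (f : ℤ → ℂ) (a b A B h : ℤ) (hf : ∀ n, n ∉ Ioc a b → f n = 0)
    (h1 : A + h ≤ a) (h2 : b ≤ B + h) :
    ∑ m ∈ Ioc A B, f (m + h) = ∑ n ∈ Ioc a b, f n := by
  have : ∑ m ∈ Ioc A B, f (m + h) = ∑ n ∈ Ioc (A + h) (B + h), f n := by
    rw [← Finset.image_add_right_Ioc, Finset.sum_image]
    intro x _ y _ hxy; simpa using hxy
  rw [this]
  symm
  apply Finset.sum_subset
  · exact Finset.Ioc_subset_Ioc h1 h2
  · intro x _ hx; exact hf x hx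

lemma tri_sum (G : ℕ → ℝ) (H : ℕ) :
    ∑ h ∈ range H, ∑ h' ∈ range h, G (h - h') = ∑ d ∈ Ico 1 H, ((H:ℝ) - d) * G d := by
  induction H with
  | zero => simp
  | succ H ih =>
    rw [Finset.sum_range_succ, ih]
    have h1 : ∑ h' ∈ range H, G (H - h') = ∑ d ∈ Ico 1 (H+1), G d := by
      rw [Finset.sum_Ico_eq_sum_range, ← Finset.sum_range_reflect]
      apply Finset.sum_congr (by simp)
      intro j hj; simp at hj; congr 1; omega
    rw [h1]
    rcases Nat.eq_zero_or_pos H with rfl | hH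
    · simp
    rw [Finset.sum_Ico_succ_top hH, Finset.sum_Ico_succ_top hH, ← add_assoc, ← Finset.sum_add_distrib]
    push_cast
    rw [show ((H:ℝ)+1-H) * G H = G H by ring]
    congr 1
    apply Finset.sum_congr rfl; intros; ring

lemma sym_sum (c : ℤ → ℂ) (hc : ∀ d, c (-d) = (starRingEnd ℂ) (c d)) (H : ℕ) :
    (∑ h ∈ range H, ∑ h' ∈ range H, c ((h:ℤ) - h')).re
      = H * (c 0).re + 2 * ∑ d ∈ Ico 1 H, ((H:ℝ) - d) * (c d).re := by
  rw [← tri_sum (fun d => (c d).re)]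
  induction H with
  | zero => simp
  | succ H ih =>
    simp only [Finset.sum_range_succ, Finset.sum_add_distrib, Complex.add_re]
    rw [ih]
    have e1 : (∑ x ∈ range H, c ((x:ℤ) - H)).re = ∑ x ∈ range H, (c ((H - x : ℕ) : ℤ)).re := by
      rw [Complex.re_sum]; apply Finset.sum_congr rfl; intro x hx; simp at hx
      rw [show ((x:ℤ) - H) = -((H - x : ℕ) : ℤ) by omega, hc]; simp
    have e2 : (∑ x ∈ range H, c ((H:ℤ) - x)).re = ∑ x ∈ range H, (c ((H - x : ℕ) : ℤ)).re := by
      rw [Complex.re_sum]; apply Finset.sum_congr rfl; intro x hx; simp at hx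
      rw [show ((H:ℤ) - x) = ((H - x : ℕ) : ℤ) by omega]
    rw [e1, e2, sub_self]
    push_cast
    ring

lemma weylZ (z : ℤ → ℂ) (a b : ℤ) (hab : a ≤ b) (hz : ∀ n, n ∉ Ioc a b → z n = 0) (H : ℕ) (hH : 0 < H) :
    (H:ℝ) * ‖∑ n ∈ Ioc a b, z n‖^2 ≤ ((b - a : ℤ) + H : ℝ) *
      ((∑ n ∈ Ioc a b, ‖z n‖^2) + 2 * ∑ d ∈ Ico 1 H, (1 - (d:ℝ)/H) *
        (∑ n ∈ Ioc a b, z (n + d) * (starRingEnd ℂ) (z n)).re) := by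
  set S := ∑ n ∈ Ioc a b, z n with hS
  set c : ℤ → ℂ := fun d => ∑ n ∈ Ioc a b, z (n + d) * (starRingEnd ℂ) (z n) with hcdef
  have hsum : (H:ℂ) * S = ∑ m ∈ Ioc (a - H) b, ∑ h ∈ range H, z (m + h) := by
    rw [Finset.sum_comm]
    rw [Finset.sum_congr rfl (g := fun _ => S)]
    · simp
    · intro h hh; simp at hh
      apply wsum_shift z a b _ _ _ hz <;> omega
  have hc : ∀ d, c (-d) = (starRingEnd ℂ) (c d) := by
    intro d
    simp only [hcdef, map_sum, map_mul, Complex.conj_conj]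
    have h0 := wsum_shift (fun n => z (n + -d) * (starRingEnd ℂ) (z n)) a b (a - |d|) (b + |d|) d
      (fun n hn => by simp [hz n hn]) (by have := le_abs_self d; omega) (by have := neg_abs_le d; omega)
    rw [← h0]
    have h1 := wsum_shift (fun n => (starRingEnd ℂ) (z (n + d)) * (z n)) a b (a - |d|) (b + |d|) 0
      (fun n hn => by simp [hz n hn]) (by have := abs_nonneg d; omega) (by have := abs_nonneg d; omega)
    rw [← h1]
    apply Finset.sum_congr rfl; intro x _; simp; ring
  have hcs : ‖(H:ℂ) * S‖^2 ≤ ((b - a : ℤ) + H : ℝ) * ∑ m ∈ Ioc (a - H) b, ‖∑ h ∈ range H, z (m + h)‖^2 := by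
    rw [hsum]
    have h1 : ‖∑ m ∈ Ioc (a - H) b, ∑ h ∈ range H, z (m + h)‖^2 ≤ (∑ m ∈ Ioc (a - H) b, ‖∑ h ∈ range H, z (m + h)‖)^2 := by
      gcongr; exact norm_sum_le _ _
    have h2 := @sq_sum_le_card_mul_sum_sq ℤ ℝ _ _ _ _ (Ioc (a - H) b) (fun m => ‖∑ h ∈ range H, z (m + h)‖)
    have h3 : ((Ioc (a - H) b).card : ℝ) = ((b - a : ℤ) + H : ℝ) := by
      rw [Int.card_Ioc]
      have : (((b - (a - H)).toNat : ℤ)) = (b - a) + H := by omega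
      exact_mod_cast this
    rw [h3] at h2
    linarith
  have hexp : (∑ m ∈ Ioc (a - H) b, ‖∑ h ∈ range H, z (m + h)‖^2 : ℝ)
      = (∑ h ∈ range H, ∑ h' ∈ range H, c ((h:ℤ) - h')).re := by
    have : ∀ h ∈ range H, ∀ h' ∈ range H, c ((h:ℤ) - h') = ∑ m ∈ Ioc (a - H) b, z (m + h) * (starRingEnd ℂ) (z (m + h')) := by
      intro h hh h' hh'
      simp at hh hh'
      have h0 := wsum_shift (fun n => z (n + (h - h')) * (starRingEnd ℂ) (z n)) a b (a - H) b h'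
        (fun n hn => by simp [hz n hn]) (by omega) (by omega)
      simp only [hcdef]
      rw [← h0]
      apply Finset.sum_congr rfl; intro x _; ring_nf
    rw [Finset.sum_congr rfl (fun h hh => Finset.sum_congr rfl (fun h' hh' => this h hh h' hh'))]
    rw [Finset.sum_congr rfl (fun h hh => Finset.sum_comm), Finset.sum_comm, Complex.re_sum]
    apply Finset.sum_congr rfl
    intro m _
    rw [← Finset.sum_mul_sum, ← map_sum, Complex.mul_conj, Complex.normSq_eq_norm_sq]
    norm_cast
  rw [hexp, sym_sum c hc] at hcs
  have hH' : (0:ℝ) < H := by exact_mod_cast hH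
  have hc0 : (c 0).re = ∑ n ∈ Ioc a b, ‖z n‖^2 := by
    simp only [hcdef, Complex.re_sum]
    apply Finset.sum_congr rfl; intro m _
    rw [add_zero, Complex.mul_conj, Complex.normSq_eq_norm_sq]; norm_cast
  rw [norm_mul, mul_pow, Complex.norm_natCast, hc0] at hcs
  have hfin : ∑ d ∈ Ico 1 H, ((H:ℝ) - d) * (c d).re = H * ∑ d ∈ Ico 1 H, (1 - (d:ℝ)/H) * (c d).re := by
    rw [Finset.mul_sum]; apply Finset.sum_congr rfl; intros; field_simp
  rw [hfin] at hcs
  have : (H:ℝ) * (H * ‖S‖^2) ≤ H * (((b - a : ℤ) + H : ℝ) *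
      ((∑ n ∈ Ioc a b, ‖z n‖^2) + 2 * ∑ d ∈ Ico 1 H, (1 - (d:ℝ)/H) * (c d).re)) := by
    linarith
  exact le_of_mul_le_mul_left this hH'

lemma weylN (z : ℕ → ℂ) (a b : ℕ) (hab : a ≤ b) (H : ℕ) (hH : 0 < H) :
    (H:ℝ) * ‖∑ n ∈ Ioc a b, z n‖^2 ≤ ((b:ℝ) - a + H) *
      ((∑ n ∈ Ioc a b, ‖z n‖^2) + 2 * ∑ d ∈ Ico 1 H, (1 - (d:ℝ)/H) *
        (∑ n ∈ Ioc a (b - d), z (n + d) * (starRingEnd ℂ) (z n)).re) := by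
  set y : ℤ → ℂ := fun n => if n ∈ Ioc (a:ℤ) b then z n.toNat else 0 with hy
  have h := weylZ y a b (by exact_mod_cast hab) (fun n hn => by simp only [hy]; rw [if_neg hn]) H hH
  have conv : ∀ (f : ℤ → ℂ) , ∑ n ∈ Ioc (a:ℤ) b, f n = ∑ n ∈ Ioc a b, f n := by
    intro f
    have : Ioc (a:ℤ) b = (Ioc a b).map Nat.castEmbedding := by
      ext x; simp; constructor
      · intro ⟨h1, h2⟩; exact ⟨x.toNat, by omega, by omega⟩
      · rintro ⟨n, h1, h2⟩; omega
    rw [this, Finset.sum_map]; rfl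
  have convR : ∀ (f : ℤ → ℝ) , ∑ n ∈ Ioc (a:ℤ) b, f n = ∑ n ∈ Ioc a b, f n := by
    intro f
    have : Ioc (a:ℤ) b = (Ioc a b).map Nat.castEmbedding := by
      ext x; simp; constructor
      · intro ⟨h1, h2⟩; exact ⟨x.toNat, by omega, by omega⟩
      · rintro ⟨n, h1, h2⟩; omega
    rw [this, Finset.sum_map]; rfl
  rw [conv, convR] at h
  have yv : ∀ n ∈ Ioc a b, y (n:ℤ) = z n := by
    intro n hn; simp only [hy]; rw [if_pos]; · simp
    simp at hn ⊢; exact hn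
  have yv2 : ∑ n ∈ Ioc a b, ‖y n‖^2 = ∑ n ∈ Ioc a b, ‖z n‖^2 :=
    Finset.sum_congr rfl (fun n hn => by rw [yv n hn])
  rw [Finset.sum_congr rfl yv, yv2] at h
  have h3 : ∀ d ∈ Ico 1 H, (1 - (d:ℝ)/H) * (∑ n ∈ Ioc (a:ℤ) b, y (n + d) * (starRingEnd ℂ) (y n)).re =
     (1 - (d:ℝ)/H) * (∑ n ∈ Ioc a (b - d), z (n + d) * (starRingEnd ℂ) (z n)).re := by
    intro d hd
    congr 2
    rw [conv]
    have hsub : Ioc a (b - d) ⊆ Ioc a b := Finset.Ioc_subset_Ioc le_rfl (by omega)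
    rw [← Finset.sum_subset hsub]
    · apply Finset.sum_congr rfl; intro n hn
      rw [yv n (hsub hn)]
      simp at hn
      have := yv (n + d) (by simp; omega)
      push_cast at this; rw [this]
    · intro n hn hn'
      simp at hn hn'
      have : y ((n:ℤ) + d) = 0 := by
        simp only [hy]; rw [if_neg]; simp; intro _; have := hn' hn.1; omega
      rw [this]; simp
  rw [Finset.sum_congr rfl h3] at h
  have h4 : (((b:ℤ) - a : ℤ) : ℝ) = (b:ℝ) - a := by push_cast; ring
  rw [h4] at h
  exact h

noncomputable def ctv (t : ℝ) : ℝ := Real.cos (Real.pi * t) / Real.sin (Real.pi * t)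
noncomputable def klw (t : ℝ) : ℂ := -1/2 - (ctv t / 2 : ℝ) * Complex.I

lemma klw_mul (t : ℝ) (h : Real.sin (Real.pi * t) ≠ 0) : (e t - 1) * klw t = 1 := by
  have he : e t = (Real.cos (2 * (Real.pi * t)) : ℝ) + (Real.sin (2 * (Real.pi * t)) : ℝ) * Complex.I := by
    unfold e
    rw [show (2 * (Real.pi:ℂ) * Complex.I * t) = ((2 * (Real.pi * t) : ℝ):ℂ) * Complex.I by push_cast; ring]
    rw [Complex.exp_mul_I]; push_cast; rfl
  rw [he, Real.cos_two_mul', Real.sin_two_mul]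
  unfold klw ctv
  set s := Real.sin (Real.pi * t)
  set k := Real.cos (Real.pi * t)
  have h1 : s^2 + k^2 = 1 := Real.sin_sq_add_cos_sq _
  have hs : (s:ℝ) ≠ 0 := h
  apply Complex.ext
  · simp [pow_two]; field_simp; linear_combination h1
  · simp [pow_two]; field_simp; linear_combination -k * h1

lemma sin_lb (t θ : ℝ) (h0 : 0 < θ) (h1 : θ ≤ t) (h2 : t ≤ 1 - θ) : 2 * θ ≤ Real.sin (Real.pi * t) := by
  have hpi := Real.pi_pos
  have key : ∀ u : ℝ, θ ≤ u → u ≤ 1/2 → 2 * θ ≤ Real.sin (Real.pi * u) := by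
    intro u hu1 hu2
    have := Real.mul_le_sin (x := Real.pi * u) (by nlinarith) (by nlinarith)
    have e1 : 2 / Real.pi * (Real.pi * u) = 2 * u := by field_simp
    rw [e1] at this; linarith
  rcases le_total t (1/2) with h | h
  · exact key t h1 h
  · have := key (1 - t) (by linarith) (by linarith)
    rwa [show Real.pi * (1 - t) = Real.pi - Real.pi * t by ring, Real.sin_pi_sub] at this

lemma ctv_anti (s t : ℝ) (h0 : 0 < s) (h1 : s ≤ t) (h2 : t < 1) : ctv t ≤ ctv s := by
  have hpi := Real.pi_pos
  unfold ctv
  have p1 : 0 < Real.sin (Real.pi * s) := Real.sin_pos_of_pos_of_lt_pi (by positivity) (by nlinarith)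
  have p2 : 0 < Real.sin (Real.pi * t) := Real.sin_pos_of_pos_of_lt_pi (by nlinarith) (by nlinarith)
  rw [div_le_div_iff₀ p2 p1]
  have := Real.sin_nonneg_of_nonneg_of_le_pi (x := Real.pi * t - Real.pi * s) (by nlinarith) (by nlinarith)
  rw [Real.sin_sub] at this
  linarith

lemma ctv_bd (t θ : ℝ) (h0 : 0 < θ) (h1 : θ ≤ t) (h2 : t ≤ 1 - θ) : |ctv t| ≤ 1 / (2 * θ) := by
  have := sin_lb t θ h0 h1 h2
  unfold ctv
  rw [abs_div, abs_of_pos (by linarith : 0 < Real.sin (Real.pi * t))]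
  apply div_le_div₀ (by norm_num) (Real.abs_cos_le_one _) (by linarith) this

lemma klw_bd (t θ : ℝ) (h0 : 0 < θ) (h1 : θ ≤ t) (h2 : t ≤ 1 - θ) : ‖klw t‖ ≤ 1 / (2 * θ) := by
  have := ctv_bd t θ h0 h1 h2
  unfold klw
  refine (norm_sub_le _ _).trans ?_
  rw [norm_mul, Complex.norm_I, Complex.norm_real, Real.norm_eq_abs, abs_div]
  have h3 : (1:ℝ) ≤ 1 / (2 * θ) := by rw [le_div_iff₀ (by linarith)]; linarith
  norm_num
  norm_num at this h3
  linarith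

lemma kl (f : ℕ → ℝ) (θ : ℝ) (h0 : 0 < θ) (p r : ℕ)
    (hb : ∀ n, p ≤ n → n ≤ p + r → θ ≤ f (n+1) - f n ∧ f (n+1) - f n ≤ 1 - θ)
    (hm : ∀ n, p ≤ n → n < p + r → f (n+1) - f n ≤ f (n+2) - f (n+1)) :
    ‖∑ n ∈ Icc p (p + r), e (f n)‖ ≤ 2 / θ := by
  have hst : ∀ n, p ≤ n → n ≤ p + r → e (f n) = (e (f (n+1)) - e (f n)) * klw (f (n+1) - f n) := by
    intro n h1 h2
    obtain ⟨h3, h4⟩ := hb n h1 h2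
    have := sin_lb _ θ h0 h3 h4
    have h5 := klw_mul (f (n+1) - f n) (by linarith)
    have h6 : e (f (n+1)) = e (f n) * e (f (n+1) - f n) := by rw [← e_add]; congr 1; ring
    rw [h6]
    linear_combination - (e (f n)) * h5
  have key : ∀ j, j ≤ r → ‖∑ n ∈ Icc p (p + j), e (f n) - e (f (p+j+1)) * klw (f (p+j+1) - f (p+j))‖
      ≤ ‖klw (f (p+1) - f p)‖ + (ctv (f (p+1) - f p) - ctv (f (p+j+1) - f (p+j))) / 2 := by
    intro j
    induction j with
    | zero =>
      intro _
      simp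
      have := hst p le_rfl (by omega)
      have h7 : e (f p) - e (f (p+1)) * klw (f (p+1) - f p) = - (e (f p) * klw (f (p+1) - f p)) := by
        linear_combination this
      rw [h7, norm_neg, norm_mul, e_norm, one_mul]
    | succ j ih =>
      intro hj
      have ih := ih (by omega)
      rw [← add_assoc, Finset.sum_Icc_succ_top (by omega)]
      have h8 := hst (p+j+1) (by omega) (by omega)
      have h9 : ∑ n ∈ Icc p (p + j), e (f n) + e (f (p+j+1)) - e (f (p+j+1+1)) * klw (f (p+j+1+1) - f (p+j+1))
        = (∑ n ∈ Icc p (p + j), e (f n) - e (f (p+j+1)) * klw (f (p+j+1) - f (p+j))) + e (f (p+j+1)) * (klw (f (p+j+1) - f (p+j)) - klw (f (p+j+1+1) - f (p+j+1))) := by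
        linear_combination h8
      rw [h9]
      refine (norm_add_le _ _).trans ?_
      rw [norm_mul, e_norm, one_mul]
      have hmj := hm (p+j) (by omega) (by omega)
      have b1 := hb (p+j) (by omega) (by omega)
      have b2 := hb (p+j+1) (by omega) (by omega)
      have h10 := ctv_anti _ _ (by linarith) hmj (by rw [show p+j+2 = p+j+1+1 by ring]; linarith)
      have h11 : ‖klw (f (p+j+1) - f (p+j)) - klw (f (p+j+1+1) - f (p+j+1))‖ = (ctv (f (p+j+1) - f (p+j)) - ctv (f (p+j+1+1) - f (p+j+1))) / 2 := by
        have : klw (f (p+j+1) - f (p+j)) - klw (f (p+j+1+1) - f (p+j+1)) = -(((ctv (f (p+j+1) - f (p+j)) - ctv (f (p+j+1+1) - f (p+j+1))) / 2 : ℝ) : ℂ) * Complex.I := by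
          unfold klw; push_cast; ring
        rw [this, norm_mul, norm_neg, Complex.norm_I, Complex.norm_real, Real.norm_eq_abs, abs_of_nonneg, mul_one]
        have : p + j + 2 = p+j+1+1 := by ring
        rw [this] at h10
        linarith
      linarith
  have h := key r le_rfl
  have b1 := hb p le_rfl (by omega)
  have b2 := hb (p+r) (by omega) (by omega)
  have k1 := klw_bd _ θ h0 b1.1 b1.2
  have k2 := klw_bd _ θ h0 b2.1 b2.2
  have c1 := abs_le.1 (ctv_bd _ θ h0 b1.1 b1.2)
  have c2 := abs_le.1 (ctv_bd _ θ h0 b2.1 b2.2)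
  have n1 := norm_sub_norm_le (∑ n ∈ Icc p (p + r), e (f n)) (e (f (p+r+1)) * klw (f (p+r+1) - f (p+r)))
  rw [norm_mul, e_norm, one_mul] at n1
  have : 2 / θ = 4 * (1 / (2 * θ)) := by field_simp; ring
  rw [this]
  linarith [c1.2, c2.1, (by positivity : 0 < 1/(2*θ))]

lemma conv_set (T : Finset ℕ) (hT : T.Nonempty) (hc : ∀ x ∈ T, ∀ y ∈ T, ∀ z, x ≤ z → z ≤ y → z ∈ T) :
    ∃ p r, T = Icc p (p + r) ∧ p ∈ T ∧ p + r ∈ T := by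
  have h1 := T.min'_mem hT
  have h2 := T.max'_mem hT
  have h3 := T.min'_le _ h2
  refine ⟨T.min' hT, T.max' hT - T.min' hT, ?_, h1, ?_⟩
  · rw [Nat.add_sub_cancel' h3]
    ext z; rw [mem_Icc]
    constructor
    · intro hz; exact ⟨T.min'_le z hz, T.le_max' z hz⟩
    · intro ⟨ha, hb⟩; exact hc _ h1 _ h2 z ha hb
  · rwa [Nat.add_sub_cancel' h3]

lemma vdc2 (f : ℕ → ℝ) (a b : ℕ) (hab0 : a ≤ b) (A lam : ℝ) (hA : 1 ≤ A) (hl : 0 < lam) (hl1 : lam ≤ 1)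
    (h : ∀ n, a < n → n < b → lam ≤ f (n+2) - 2 * f (n+1) + f n ∧ f (n+2) - 2 * f (n+1) + f n ≤ A * lam) :
    ‖∑ n ∈ Ioc a b, e (f n)‖ ≤ 16 * A * (((b:ℝ) - a) * Real.sqrt lam + 1 / Real.sqrt lam) := by
  rcases le_or_gt b a with hba | hab
  · rw [Finset.Ioc_eq_empty (by omega)]; simp
    have : (a:ℝ) ≤ b := by exact_mod_cast hab0
    have : 0 ≤ ((b:ℝ) - a) * Real.sqrt lam := mul_nonneg (by linarith) (Real.sqrt_nonneg _)
    positivity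
  set g : ℕ → ℝ := fun n => f (n+1) - f n with hg
  have gst : ∀ n, a < n → n < b → g n + lam ≤ g (n+1) ∧ g (n+1) ≤ g n + A * lam := by
    intro n h1 h2
    have := h n h1 h2
    simp only [hg]
    constructor <;> [linarith [this.1]; linarith [this.2]]
  have glb : ∀ j n, a < n → n + j ≤ b → g n + j * lam ≤ g (n+j) ∧ g (n + j) ≤ g n + j * (A * lam) := by
    intro j
    induction j with
    | zero => intro n _ _; simp
    | succ j ih =>
      intro n h1 h2
      have i1 := ih n h1 (by omega)
      have i2 := gst (n+j) (by omega) (by omega)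
      rw [← add_assoc]; push_cast
      constructor
      · linarith [i1.1, i2.1]
      · linarith [i1.2, i2.2]
  have gmono : ∀ m n, a < m → m ≤ n → n ≤ b → g m + ((n:ℝ) - m) * lam ≤ g n ∧ g n ≤ g m + ((n:ℝ) - m) * (A * lam):= by
    intro m n h1 h2 h3
    have := glb (n - m) m h1 (by omega)
    rw [Nat.add_sub_cancel' h2, Nat.cast_sub h2] at this
    exact this
  have gm : ∀ m n, a < m → m ≤ n → n ≤ b → g m ≤ g n := by
    intro m n h1 h2 h3
    have := (gmono m n h1 h2 h3).1
    have h4 : (m:ℝ) ≤ n := by exact_mod_cast h2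
    nlinarith
  have setc : ∀ (P : ℝ → Prop) (hP : ∀ x y z, P x → P y → x ≤ z → z ≤ y → P z) [DecidablePred P],
      ((Ioc a b).filter (fun n => P (g n))).Nonempty →
      ∃ p r, (Ioc a b).filter (fun n => P (g n)) = Icc p (p + r) ∧ p ∈ (Ioc a b).filter (fun n => P (g n)) ∧ p + r ∈ (Ioc a b).filter (fun n => P (g n)) := by
    intro P hP _ hne
    apply conv_set _ hne
    intro x hx y hy z h1 h2
    simp only [mem_filter, mem_Ioc] at hx hy ⊢
    refine ⟨⟨by omega, by omega⟩, hP (g x) (g y) (g z) hx.2 hy.2 (gm _ _ (by omega) h1 (by omega)) (gm _ _ (by omega) h2 (by omega))⟩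
  set s := Real.sqrt lam with hs
  have s0 : 0 < s := Real.sqrt_pos.2 hl
  have ss : s * s = lam := Real.mul_self_sqrt hl.le
  have s1 : s ≤ 1 := by nlinarith
  set θ := s / 2 with hθ
  have cardb : ∀ (P : ℝ → Prop) (u : ℝ) (hP : ∀ x y z, P x → P y → x ≤ z → z ≤ y → P z) (hu : ∀ x y, P x → P y → x ≤ y → y ≤ x + θ) [DecidablePred P],
      ((((Ioc a b).filter (fun n => P (g n))).card : ℕ) : ℝ) ≤ θ / lam + 1 := by
    intro P u hP hu _
    rcases ((Ioc a b).filter (fun n => P (g n))).eq_empty_or_nonempty with he | hne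
    · rw [he]; simp; positivity
    · obtain ⟨p, r, h1, h2, h3⟩ := setc P hP hne
      rw [h1, Nat.card_Icc]
      simp only [mem_filter, mem_Ioc] at h2 h3
      have h4 := gmono p (p+r) h2.1.1 (by omega) h3.1.2
      have h5 := hu _ _ h2.2 h3.2 (gm _ _ h2.1.1 (by omega) h3.1.2)
      have : p + r + 1 - p = r + 1 := by omega
      rw [this]; push_cast at h4 ⊢
      have : (r:ℝ) ≤ θ / lam := by rw [le_div_iff₀ hl]; linarith [h4.1]
      linarith
  have θ0 : 0 < θ := by positivity
  have block : ∀ k : ℤ, ‖∑ n ∈ (Ioc a b).filter (fun n => ⌊g n⌋ = k), e (f n)‖ ≤ 7 / s := by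
    intro k
    classical
    have split : ∑ n ∈ (Ioc a b).filter (fun n => ⌊g n⌋ = k), e (f n)
      = ∑ n ∈ (Ioc a b).filter (fun n => (k:ℝ) ≤ g n ∧ g n < k + θ), e (f n)
       + ∑ n ∈ (Ioc a b).filter (fun n => (k:ℝ) + 1 - θ < g n ∧ g n < k + 1), e (f n)
       + ∑ n ∈ (Ioc a b).filter (fun n => (k:ℝ) + θ ≤ g n ∧ g n ≤ k + 1 - θ), e (f n) := by
      simp only [Finset.sum_filter]
      rw [← Finset.sum_add_distrib, ← Finset.sum_add_distrib]
      apply Finset.sum_congr rfl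
      intro n _
      simp only [Int.floor_eq_iff]
      have : θ ≤ 1/2 := by linarith
      split_ifs with h1 h2 h3 h4 h3 h4 h4 h2 h3 h4 h4 h3 <;> first | (simp; done) | (exfalso; grind)
    rw [split]
    have t1 : ‖∑ n ∈ (Ioc a b).filter (fun n => (k:ℝ) ≤ g n ∧ g n < k + θ), e (f n)‖ ≤ θ/lam + 1 := by
      refine (norm_sum_le _ _).trans ?_
      simp only [e_norm, sum_const, nsmul_eq_mul, mul_one]
      exact cardb (fun y => (k:ℝ) ≤ y ∧ y < k + θ) 0 (by intro x y z h1 h2 h3 h4; constructor <;> linarith [h1.1, h2.2]) (by intro x y h1 h2 h3; linarith [h1.1, h2.2])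
    have t2 : ‖∑ n ∈ (Ioc a b).filter (fun n => (k:ℝ) + 1 - θ < g n ∧ g n < k + 1), e (f n)‖ ≤ θ/lam + 1 := by
      refine (norm_sum_le _ _).trans ?_
      simp only [e_norm, sum_const, nsmul_eq_mul, mul_one]
      exact cardb (fun y => (k:ℝ) + 1 - θ < y ∧ y < k + 1) 0 (by intro x y z h1 h2 h3 h4; constructor <;> linarith [h1.1, h2.2]) (by intro x y h1 h2 h3; linarith [h1.1, h2.2])
    have t3 : ‖∑ n ∈ (Ioc a b).filter (fun n => (k:ℝ) + θ ≤ g n ∧ g n ≤ k + 1 - θ), e (f n)‖ ≤ 2 / θ := by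
      rcases ((Ioc a b).filter (fun n => (k:ℝ) + θ ≤ g n ∧ g n ≤ k + 1 - θ)).eq_empty_or_nonempty with he | hne
      · rw [he]; simp; positivity
      · obtain ⟨p, r, h1, h2, h3⟩ := setc (fun y => (k:ℝ) + θ ≤ y ∧ y ≤ k + 1 - θ) (by intro x y z h1 h2 h3 h4; constructor <;> linarith [h1.1, h2.2]) hne
        have hmem : ∀ n, p ≤ n → n ≤ p + r → n ∈ (Ioc a b).filter (fun n => (k:ℝ) + θ ≤ g n ∧ g n ≤ k + 1 - θ) := by
          intro n h4 h5; rw [h1]; simp [h4, h5]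
        rw [h1]
        have := kl (fun n => f n - k * n) θ θ0 p r (by
          intro n h4 h5
          have := hmem n h4 h5
          simp only [mem_filter, mem_Ioc, hg] at this
          push_cast
          constructor <;> linarith [this.2.1, this.2.2]) (by
          intro n h4 h5
          have h6 := hmem n h4 h5.le
          have h7 := hmem (n+1) (by omega) (by omega)
          simp only [mem_filter, mem_Ioc] at h6 h7
          have := gm n (n+1) h6.1.1 (by omega) h7.1.2
          simp only [hg] at this
          push_cast
          rw [show n+2 = n+1+1 by ring]
          linarith)
        convert this using 3 with n hn
        rw [show f n = (f n - k * n) + ((k * n : ℤ) : ℝ) by push_cast; ring, e_add, e_int, mul_one]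
        congr 1; push_cast; ring
    refine (norm_add₃_le).trans ?_
    have q1 : θ / lam = 1 / (2 * s) := by rw [← ss, hθ]; field_simp
    have q2 : 2 / θ = 4 / s := by rw [hθ]; field_simp; ring
    have q3 : 1 ≤ 1 / s := by rw [le_div_iff₀ s0]; linarith
    have q4 : 1 / (2 * s) = (1/s)/2 := by field_simp
    have q5 : 4 / s = 4 * (1/s) := by ring
    have q6 : 7 / s = 7 * (1/s) := by ring
    rw [q1, q4] at t1 t2
    rw [q2, q5] at t3
    rw [q6]
    linarith
  have hfib : ∑ n ∈ Ioc a b, e (f n) = ∑ k ∈ Icc ⌊g (a+1)⌋ ⌊g b⌋, ∑ n ∈ (Ioc a b).filter (fun n => ⌊g n⌋ = k), e (f n) := by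
    rw [Finset.sum_fiberwise_of_maps_to]
    intro n hn
    rw [mem_Ioc] at hn
    rw [mem_Icc]
    exact ⟨Int.floor_le_floor (gm _ _ (by omega) (by omega) hn.2), Int.floor_le_floor (gm _ _ (by omega) (by omega) le_rfl)⟩
  rw [hfib]
  refine (norm_sum_le _ _).trans ?_
  refine (Finset.sum_le_sum (fun k _ => block k)).trans ?_
  rw [sum_const, nsmul_eq_mul, Int.card_Icc]
  have hgg := gmono (a+1) b (by omega) (by omega) le_rfl
  have hfl : ⌊g (a+1)⌋ ≤ ⌊g b⌋ := Int.floor_le_floor (gm _ _ (by omega) (by omega) le_rfl)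
  have hcard : (((⌊g b⌋ + 1 - ⌊g (a+1)⌋).toNat : ℕ) : ℝ) ≤ ((b:ℝ) - a) * (A * lam) + 2 := by
    have h1 : (((⌊g b⌋ + 1 - ⌊g (a+1)⌋).toNat : ℕ) : ℝ) = (⌊g b⌋:ℝ) + 1 - ⌊g (a+1)⌋ := by
      have : (((⌊g b⌋ + 1 - ⌊g (a+1)⌋).toNat : ℕ) : ℤ) = ⌊g b⌋ + 1 - ⌊g (a+1)⌋ := by omega
      exact_mod_cast this
    rw [h1]
    have h2 := Int.floor_le (g b)
    have h3 := Int.lt_floor_add_one (g (a+1))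
    have h4 := hgg.2
    push_cast at h4
    have : 0 ≤ A * lam := by positivity
    nlinarith
  have hab' : (a:ℝ) ≤ b := by exact_mod_cast hab.le
  calc _ ≤ (((b:ℝ) - a) * (A * lam) + 2) * (7 / s) := by gcongr
    _ = 7 * A * (((b:ℝ) - a) * s) + 14 * (1/s) := by rw [← ss]; field_simp; ring
    _ ≤ _ := by
      have : 0 ≤ ((b:ℝ) - a) * s := mul_nonneg (by linarith) s0.le
      have : 0 < 1 / s := by positivity
      nlinarith

/-- iterated differences -/
noncomputable def dif : List ℝ → (ℝ → ℝ) → ℝ → ℝ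
  | [], f, x => f x
  | h :: t, f, x => dif t f (x + h) - dif t f x
noncomputable def dpo : ℝ → ℕ → ℝ
  | _, 0 => 1
  | p, k+1 => p * dpo (p - 1) k

lemma dif_smul (t : List ℝ) (k : ℝ) (f : ℝ → ℝ) (x : ℝ) : dif t (fun y => k * f y) x = k * dif t f x := by
  induction t generalizing x with
  | nil => simp [dif]
  | cons h t ih => simp only [dif]; rw [ih, ih]; ring

lemma dif_hasDeriv (t : List ℝ) (ht : ∀ h ∈ t, 0 < h) (f f' : ℝ → ℝ) (hf : ∀ y, 0 < y → HasDerivAt f (f' y) y)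
    (x : ℝ) (hx : 0 < x) : HasDerivAt (dif t f) (dif t f' x) x := by
  induction t generalizing x with
  | nil => exact hf x hx
  | cons h t ih =>
    have h1 : ∀ h ∈ t, 0 < h := fun u hu => ht u (by simp [hu])
    have h0 := ht h (by simp)
    have a1 := (ih h1 (x + h) (by linarith)).comp_add_const x h
    have a2 := ih h1 x hx
    exact a1.sub a2

lemma dif_rpow (t : List ℝ) (ht : ∀ h ∈ t, 0 < h) (p x : ℝ) (hx : 0 < x) :
    ∃ ξ, x ≤ ξ ∧ ξ ≤ x + t.sum ∧ dif t (fun y => y ^ p) x = t.prod * dpo p t.length * ξ ^ (p - t.length) := by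
  induction t generalizing x p with
  | nil => exact ⟨x, le_rfl, by simp, by simp [dif, dpo]⟩
  | cons h t ih =>
    have h1 : ∀ h ∈ t, 0 < h := fun u hu => ht u (by simp [hu])
    have h0 := ht h (by simp)
    have hd : ∀ y, 0 < y → HasDerivAt (dif t (fun y => y ^ p)) (dif t (fun y => p * y ^ (p - 1)) y) y := by
      intro y hy
      apply dif_hasDeriv t h1 _ _ _ y hy
      intro z hz; exact Real.hasDerivAt_rpow_const (Or.inl hz.ne')
    obtain ⟨y, hy, he⟩ := exists_hasDerivAt_eq_slope (dif t (fun y => y ^ p)) (fun y => dif t (fun y => p * y ^ (p - 1)) y)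
      (by linarith : x < x + h) (fun z hz => (hd z (by linarith [hz.1])).continuousAt.continuousWithinAt)
      (fun z hz => hd z (by linarith [hz.1]))
    obtain ⟨ξ, k1, k2, k3⟩ := ih h1 (p - 1) y (by linarith [hy.1])
    refine ⟨ξ, by linarith [hy.1], by simp; linarith [hy.2], ?_⟩
    simp only [dif]
    rw [dif_smul, k3] at he
    have : x + h - x = h := by ring
    rw [this, eq_div_iff h0.ne'] at he
    rw [← he]
    simp only [List.prod_cons, List.length_cons, dpo]
    push_cast
    rw [show p - 1 - (t.length:ℝ) = p - (t.length + 1) by ring]; ring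

/-- repeated integration -/
lemma int_bd (g g' : ℝ → ℝ) (K : ℝ) (k : ℕ) (hK : 0 ≤ K) (hd : ∀ z, 0 ≤ z → z ≤ 1/2 → HasDerivAt g (g' z) z) (h0 : g 0 = 0)
    (hb : ∀ z, 0 ≤ z → z ≤ 1/2 → |g' z| ≤ K * z^k) : ∀ z, 0 ≤ z → z ≤ 1/2 → |g z| ≤ K * z^(k+1) := by
  intro z hz hz2
  have := Convex.norm_image_sub_le_of_norm_hasDerivWithin_le (f := g) (f' := g') (s := Set.Icc 0 z) (C := K * z^k) (x := 0) (y := z)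
    (fun y hy => (hd y hy.1 (hy.2.trans hz2)).hasDerivWithinAt) (fun y hy => by
      rw [Real.norm_eq_abs]
      refine (hb y hy.1 (hy.2.trans hz2)).trans ?_
      have := pow_le_pow_left₀ hy.1 hy.2 k
      gcongr) (convex_Icc 0 z) ⟨le_rfl, hz⟩ ⟨hz, le_rfl⟩
  rw [h0, sub_zero, sub_zero, Real.norm_eq_abs, Real.norm_eq_abs, abs_of_nonneg hz] at this
  rw [pow_succ]; linarith

lemma rpow_half_bd (p z : ℝ) (h1 : -(1/2) ≤ z) (h2 : z ≤ 1/2) : (1 + z) ^ p ≤ 2 ^ |p| := by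
  rcases le_total 0 p with hp | hp
  · rw [abs_of_nonneg hp]
    exact Real.rpow_le_rpow (by linarith) (by linarith) hp
  · rw [abs_of_nonpos hp]
    have : (1+z) ^ p = ((1+z)⁻¹)^(-p) := by rw [Real.inv_rpow (by linarith), Real.rpow_neg (by linarith), inv_inv]
    rw [this]
    apply Real.rpow_le_rpow (by rw [inv_nonneg]; linarith) _ (by linarith)
    rw [inv_le_comm₀ (by linarith) (by norm_num)]; linarith

/-- (1+v)^β first order Taylor -/
lemma hasDerivAt_p (p z : ℝ) (hz : -1 < z) : HasDerivAt (fun z => (1+z)^p) (p * (1+z)^(p-1)) z := by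
  have h := (Real.hasDerivAt_rpow_const (x := 1 + z) (p := p) (Or.inl (by linarith)))
  have := h.comp z ((hasDerivAt_id z).const_add 1)
  simpa [Function.comp_def] using this
lemma hasDerivAt_m (p z : ℝ) (hz : z < 1) : HasDerivAt (fun z => (1-z)^p) (-(p * (1-z)^(p-1))) z := by
  have h := (Real.hasDerivAt_rpow_const (x := 1 - z) (p := p) (Or.inl (by linarith)))
  have := h.comp z ((hasDerivAt_id z).const_sub 1)
  simpa [Function.comp_def] using this

lemma lin_bd (p : ℝ) : ∃ C > 0, ∀ z : ℝ, |z| ≤ 1/2 → |(1+z)^p - 1| ≤ C * |z| := by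
  refine ⟨|p| * 2^|p-1| + 1, by positivity, ?_⟩
  intro z hz
  have hz' := abs_le.1 hz
  have := Convex.norm_image_sub_le_of_norm_hasDerivWithin_le (f := fun z => (1+z)^p) (f' := fun z => p * (1+z)^(p-1)) (s := Set.Icc (-(1/2)) (1/2:ℝ)) (C := |p| * 2^|p-1|) (x := 0) (y := z)
    (fun y hy => (hasDerivAt_p p y (by linarith [hy.1])).hasDerivWithinAt) (fun y hy => by
      rw [Real.norm_eq_abs, abs_mul, abs_of_nonneg (a := (1+y)^(p-1)) (Real.rpow_nonneg (by linarith [hy.1]) _)]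
      have := rpow_half_bd (p-1) y hy.1 hy.2
      gcongr) (convex_Icc _ _) ⟨by norm_num, by norm_num⟩ ⟨hz'.1, hz'.2⟩
  simp only [add_zero, Real.one_rpow, sub_zero, Real.norm_eq_abs] at this
  nlinarith [abs_nonneg z]

lemma quad_bd (p : ℝ) : ∃ C > 0, ∀ z : ℝ, |z| ≤ 1/2 → |(1+z)^p - 1 - p * z| ≤ C * z^2 := by
  obtain ⟨C, hC, h⟩ := lin_bd (p-1)
  refine ⟨|p| * C + 1, by positivity, ?_⟩
  intro z hz
  have := Convex.norm_image_sub_le_of_norm_hasDerivWithin_le (f := fun z => (1+z)^p - 1 - p * z) (f' := fun z => p * (1+z)^(p-1) - p) (s := Set.Icc (-|z|) |z|) (C := |p| * C * |z|) (x := 0) (y := z)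
    (fun y hy => by
      have hy1 : -1 < y := by linarith [hy.1]
      have := ((hasDerivAt_p p y hy1).sub_const 1).sub ((hasDerivAt_id y).const_mul p)
      simp only [mul_one] at this
      exact this.hasDerivWithinAt) (fun y hy => by
      have hy' : |y| ≤ |z| := abs_le.2 ⟨hy.1, hy.2⟩
      rw [Real.norm_eq_abs, show p * (1+y)^(p-1) - p = p * ((1+y)^(p-1) - 1) by ring, abs_mul, mul_assoc]
      have := h y (hy'.trans hz)
      gcongr
      exact this.trans (by gcongr)) (convex_Icc _ _) ⟨by simp, by simp⟩ ⟨neg_abs_le z, le_abs_self z⟩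
  simp only [add_zero, Real.one_rpow, sub_zero, Real.norm_eq_abs, sub_self, mul_zero] at this
  have h2 : |z| * |z| = z^2 := by rw [← abs_mul, ← sq, abs_of_nonneg (sq_nonneg z)]
  rw [mul_assoc, h2] at this
  rw [add_mul]; linarith [sq_nonneg z]

/-- ψ expansions -/
lemma psi_odd (c : ℝ) : ∃ C > 0, ∀ z, 0 ≤ z → z ≤ 1/2 → |(1+z)^c - (1-z)^c - 2 * c * z| ≤ C * z^3 := by
  have b1 : ∀ z:ℝ, 0 ≤ z → z ≤ 1/2 → |(c * (c-1)) * ((1+z)^(c-2) - (1-z)^(c-2))| ≤ (|c * (c-1)| * (|c-2| * (2 * 2^|c-3|))) * z^1 := by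
    have b2 := int_bd (fun z => (1+z)^(c-2) - (1-z)^(c-2)) (fun z => (c-2) * (1+z)^(c-2-1) - -((c-2) * (1-z)^(c-2-1))) (|c-2| * (2 * 2^|c-3|)) 0 (by positivity)
      (fun z h1 h2 => (hasDerivAt_p _ z (by linarith)).sub (hasDerivAt_m _ z (by linarith))) (by simp) (by
        intro z h1 h2
        rw [show (c-2) * (1+z)^(c-2-1) - -((c-2) * (1-z)^(c-2-1)) = (c-2) * ((1+z)^(c-3) + (1+ -z)^(c-3)) by ring_nf, abs_mul, pow_zero, mul_one]
        gcongr
        rw [abs_of_nonneg (add_nonneg (Real.rpow_nonneg (by linarith) _) (Real.rpow_nonneg (by linarith) _))]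
        have := rpow_half_bd (c-3) z (by linarith) h2
        have := rpow_half_bd (c-3) (-z) (by linarith) (by linarith)
        linarith)
    intro z h1 h2
    rw [abs_mul]; have := b2 z h1 h2
    rw [mul_assoc]; simp only [zero_add] at this; gcongr
  have b3 := int_bd (fun z => c * (1+z)^(c-1) - -(c * (1-z)^(c-1)) - 2 * c) (fun z => (c * (c-1)) * ((1+z)^(c-2) - (1-z)^(c-2))) _ 1 (by positivity)
     (fun z h1 h2 => by
       have := (((hasDerivAt_p (c-1) z (by linarith)).const_mul c).sub (((hasDerivAt_m (c-1) z (by linarith)).const_mul c).neg)).sub_const (2*c)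
       refine this.congr_deriv ?_
       rw [show c - 1 - 1 = c - 2 by ring]
       ring) (by simp; ring) b1
  have b4 := int_bd (fun z => (1+z)^c - (1-z)^c - 2 * c * z) (fun z => c * (1+z)^(c-1) - -(c * (1-z)^(c-1)) - 2 * c) _ 2 (by positivity)
     (fun z h1 h2 => by
       have := ((hasDerivAt_p c z (by linarith)).sub (hasDerivAt_m c z (by linarith))).sub ((hasDerivAt_id z).const_mul (2*c))
       simp only [mul_one] at this
       exact this) (by simp) b3
  refine ⟨|c * (c-1)| * (|c-2| * (2 * 2^|c-3|)) + 1, by positivity, fun z h1 h2 => (b4 z h1 h2).trans ?_⟩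
  have : 0 ≤ z^3 := by positivity
  norm_num
  nlinarith

lemma psi_even4 (p : ℝ) : ∃ C > 0, ∀ z : ℝ, 0 ≤ z → z ≤ 1/2 → |(1+z)^p + (1-z)^p - 2 - p * (p-1) * z^2| ≤ C * z^4 := by
  obtain ⟨C, hC, h⟩ := psi_odd (p-1)
  have b := int_bd (fun z => (1+z)^p + (1-z)^p - 2 - p * (p-1) * z^2) (fun z => p * ((1+z)^(p-1) - (1-z)^(p-1) - 2 * (p-1) * z)) (|p| * C) 3 (by positivity)
    (fun z h1 h2 => by
       have := (((hasDerivAt_p p z (by linarith)).add (hasDerivAt_m p z (by linarith))).sub_const 2).sub ((hasDerivAt_pow 2 z).const_mul (p * (p-1)))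
       refine this.congr_deriv ?_
       push_cast; ring) (by simp; norm_num) (fun z h1 h2 => by
       rw [abs_mul, mul_assoc |p| C]; have := h z h1 h2; gcongr)
  refine ⟨|p| * C + 1, by positivity, fun z h1 h2 => (b z h1 h2).trans ?_⟩
  show _ * z^4 ≤ _
  gcongr; linarith

lemma psi_odd5 (p : ℝ) : ∃ C > 0, ∀ z : ℝ, 0 ≤ z → z ≤ 1/2 → |(1+z)^p - (1-z)^p - 2 * p * z - p * (p-1) * (p-2) / 3 * z^3| ≤ C * z^5 := by
  obtain ⟨C, hC, h⟩ := psi_even4 (p-1)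
  have b := int_bd (fun z => (1+z)^p - (1-z)^p - 2 * p * z - p * (p-1) * (p-2) / 3 * z^3) (fun z => p * ((1+z)^(p-1) + (1-z)^(p-1) - 2 - (p-1) * (p-1-1) * z^2)) (|p| * C) 4 (by positivity)
    (fun z h1 h2 => by
       have := (((hasDerivAt_p p z (by linarith)).sub (hasDerivAt_m p z (by linarith))).sub ((hasDerivAt_id z).const_mul (2*p))).sub ((hasDerivAt_pow 3 z).const_mul (p * (p-1) * (p-2) / 3))
       refine this.congr_deriv ?_
       push_cast; ring) (by simp) (fun z h1 h2 => by
       rw [abs_mul, mul_assoc |p| C]; have := h z h1 h2; gcongr)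
  refine ⟨|p| * C + 1, by positivity, fun z h1 h2 => (b z h1 h2).trans ?_⟩
  norm_num
  rw [add_mul]; linarith [(by positivity : 0 ≤ z^5)]

lemma psi_even_diff (c : ℝ) : ∃ C > 0, ∀ y z : ℝ, 0 ≤ y → y ≤ z → z ≤ 1/2 →
    |((1+z)^c + (1-z)^c) - ((1+y)^c + (1-y)^c) - c * (c-1) * (z^2 - y^2) - c*(c-1)*(c-2)*(c-3)/12 * (z^4 - y^4)| ≤ C * z^5 * (z - y) := by
  obtain ⟨C, hC, h⟩ := psi_odd5 (c-1)
  refine ⟨|c| * C + 1, by positivity, ?_⟩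
  intro y z hy hyz hz
  have := Convex.norm_image_sub_le_of_norm_hasDerivWithin_le (f := fun z => (1+z)^c + (1-z)^c - c * (c-1) * z^2 - c*(c-1)*(c-2)*(c-3)/12 * z^4)
    (f' := fun z => c * ((1+z)^(c-1) - (1-z)^(c-1) - 2 * (c-1) * z - (c-1) * (c-1-1) * (c-1-2) / 3 * z^3)) (s := Set.Icc 0 z) (C := |c| * C * z^5) (x := y) (y := z)
    (fun x hx => by
       have h1 := hx.1
       have h2 := hx.2
       have := (((hasDerivAt_p c x (by linarith)).add (hasDerivAt_m c x (by linarith))).sub ((hasDerivAt_pow 2 x).const_mul (c * (c-1)))).sub ((hasDerivAt_pow 4 x).const_mul (c*(c-1)*(c-2)*(c-3)/12))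
       exact (this.congr_deriv (by push_cast; ring)).hasDerivWithinAt)
    (fun x hx => by
       rw [Real.norm_eq_abs, abs_mul, mul_assoc |c| C]
       have h1 := hx.1
       have h2 := hx.2
       have := h x h1 (by linarith)
       gcongr
       exact this.trans (by gcongr)) (convex_Icc _ _) ⟨hy, hyz⟩ ⟨by linarith, le_rfl⟩
  rw [Real.norm_eq_abs, Real.norm_eq_abs, abs_of_nonneg (a := z - y) (by linarith)] at this
  have e1 : ∀ A B D E F G : ℝ, A - B - D * (E^2 - F^2) - G * (E^4 - F^4) = A - D * E^2 - G * E^4 - (B - D * F^2 - G * F^4) := by intros; ring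
  rw [e1]
  refine this.trans ?_
  have : 0 ≤ z^5 * (z - y) := mul_nonneg (by have : 0 ≤ z := by linarith
                                             positivity) (by linarith)
  nlinarith

lemma half_rpow (b u c : ℝ) (hb : 0 < b) (h : -b < u) : ((b + u)/2)^c = (b/2)^c * (1 + u/b)^c := by
  rw [← Real.mul_rpow (by positivity)]
  · congr 1; field_simp
  · have : 0 < (b + u)/b := div_pos (by linarith) hb
    rw [add_div, div_self hb.ne'] at this; linarith

lemma root_norm (b v p : ℝ) (hb : 0 < b) (hp : p ≠ 0) (hv : -1 < v) : (b^p * (1+v))^(1/p) = b * (1+v)^(1/p) := by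
  rw [Real.mul_rpow (by positivity) (by linarith), ← Real.rpow_mul hb.le]
  rw [mul_one_div_cancel hp, Real.rpow_one]

lemma tnorm (c : ℝ) (hc : 1 < c) : ∃ C > 0, ∀ m q : ℝ, 0 < m → 0 < q → C * q ≤ 2*m+q →
    |(((m+q)^c - m^c) / (c * 2^(1-c) * q))^(1/(c-1)) - (2*m+q)| ≤ C * q^2/(2*m+q) := by
  obtain ⟨C1, hC1, h1⟩ := psi_odd c
  obtain ⟨C2, hC2, h2⟩ := lin_bd (1/(c-1))
  refine ⟨C1 + 2 + C2 * C1, by positivity, ?_⟩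
  intro m q hm hq hb
  set b := 2*m+q with hbd
  have hb0 : 0 < b := by positivity
  set z := q/b with hz
  have hz0 : 0 < z := by positivity
  have hzz : (C1 + 2 + C2 * C1) * z ≤ 1 := by
    rw [hz, ← mul_div_assoc, div_le_one hb0]; exact hb
  have hz2 : z ≤ 1/2 := by nlinarith [mul_pos hC2 hC1]
  have k1 := h1 z hz0.le hz2
  set E := (1+z)^c - (1-z)^c - 2 * c * z with hE
  set v := E / (2*c*z) with hv
  have hv1 : |v| ≤ C1 * z^2 := by
    rw [hv, abs_div, abs_of_pos (by positivity : 0 < 2*c*z), div_le_iff₀ (by positivity)]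
    refine k1.trans ?_
    have : 0 ≤ C1 * z^3 := by positivity
    nlinarith
  have hv2 : |v| ≤ 1/2 := by
    refine hv1.trans ?_
    have : C1 * z ≤ 1 := by nlinarith [mul_pos hC2 hC1]
    nlinarith
  have hv3 := abs_le.1 hv2
  have ht : (m+q)^c - m^c = (b/2)^c * (2*c*z) * (1+v) := by
    have a1 : m + q = (b + q)/2 := by rw [hbd]; ring
    have a2 : m = (b + -q)/2 := by rw [hbd]; ring
    have a3 : (m+q)^c = (b/2)^c * (1+z)^c := by rw [a1, half_rpow b q c hb0 (by linarith)]
    have a4 : m^c = (b/2)^c * (1-z)^c := by rw [a2, half_rpow b (-q) c hb0 (by linarith)]; rw [hz]; congr 2; ring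
    rw [a3, a4]
    have : (2*c*z) * (1+v) = (1+z)^c - (1-z)^c := by
      rw [hv, mul_add, mul_div_cancel₀ _ (by positivity : 2*c*z ≠ 0), hE]; ring
    rw [mul_assoc, this]; ring
  have hy : ((m+q)^c - m^c) / (c * 2^(1-c) * q) = b^(c-1) * (1+v) := by
    rw [ht, Real.div_rpow hb0.le (by norm_num), Real.rpow_sub hb0, Real.rpow_sub (by norm_num : (0:ℝ) < 2), Real.rpow_one, Real.rpow_one, hz]
    field_simp
  rw [hy, root_norm b v (c-1) hb0 (by linarith) (by linarith)]
  have k2 := h2 v hv2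
  rw [show b * (1+v)^(1/(c-1)) - b = b * ((1+v)^(1/(c-1)) - 1) by ring, abs_mul, abs_of_pos hb0]
  have : (C1 + 2 + C2 * C1) * q^2/b = b * ((C1 + 2 + C2 * C1) * z^2) := by rw [hz]; field_simp
  rw [this]
  gcongr
  have : C2 * |v| ≤ C2 * (C1 * z^2) := by gcongr
  have : 0 ≤ z^2 := by positivity
  nlinarith

set_option maxHeartbeats 1000000 in
lemma snorm (c : ℝ) (hc : 2 < c) : ∃ C ≥ 1, ∀ n r s w : ℝ, 0 < n → 0 < r → 0 < s → r ≤ w → s ≤ w → C * w ≤ 2*n+r+s →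
    |(((n+r+s)^c - (n+r)^c - (n+s)^c + n^c) / (c * (c-1) * 2^(2-c) * (r*s)))^(1/(c-2)) -
      ((2*n+r+s) + (c-3)/6 * (r^2+s^2)/(2*n+r+s))| ≤ C * w^4/(2*n+r+s)^3 := by
  obtain ⟨C1, hC1, h1⟩ := psi_even_diff c
  obtain ⟨C2, hC2, h2⟩ := quad_bd (1/(c-2))
  set k := c * (c-1) with hk
  have hk0 : 0 < k := by rw [hk]; exact mul_pos (by linarith) (by linarith)
  set K1 := |(c-2)*(c-3)/3| + 16*C1/k with hK1
  have hK0 : 0 ≤ K1 := by positivity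
  set K2 := (1/(c-2)) * (16*C1/k) + C2 * K1^2 with hK2
  have hK20 : 0 ≤ K2 := by
    have : 0 < c - 2 := by linarith
    positivity
  refine ⟨4 + 2*K1 + K2, by linarith, ?_⟩
  have main : ∀ n r s w : ℝ, 0 < n → 0 < r → 0 < s → s ≤ r → r ≤ w → s ≤ w → (4 + 2*K1 + K2) * w ≤ 2*n+r+s →
    |(((n+r+s)^c - (n+r)^c - (n+s)^c + n^c) / (c * (c-1) * 2^(2-c) * (r*s)))^(1/(c-2)) -
      ((2*n+r+s) + (c-3)/6 * (r^2+s^2)/(2*n+r+s))| ≤ (4 + 2*K1 + K2) * w^4/(2*n+r+s)^3 := by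
    intro n r s w hn hr hs hsr hrw hsw hb
    set b := 2*n+r+s with hbd
    have hw : 0 < w := by linarith
    have hb0 : 0 < b := by positivity
    have h4w : 4 * w ≤ b := by nlinarith
    set z := (r+s)/b with hz
    set y := (r-s)/b with hy
    have hz2 : z ≤ 1/2 := by rw [hz, div_le_iff₀ hb0]; linarith
    have hy0 : 0 ≤ y := div_nonneg (by linarith) hb0.le
    have hyz : y ≤ z := by rw [hy, hz]; gcongr; linarith
    have k1 := h1 y z hy0 hyz hz2
    set E := ((1+z)^c + (1-z)^c) - ((1+y)^c + (1-y)^c) - k * (z^2 - y^2) - k*(c-2)*(c-3)/12 * (z^4 - y^4) with hE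
    set v := (c-2)*(c-3)/6 * (r^2+s^2)/b^2 + E/(4*k*r*s/b^2) with hv
    have hEb : |E/(4*k*r*s/b^2)| ≤ 16*C1/k * (w^4/b^4) := by
      have hP : 0 < 4*k*r*s/b^2 := by positivity
      rw [abs_div, abs_of_pos hP, div_le_iff₀ hP]
      refine k1.trans ?_
      have e1 : z - y = 2*s/b := by rw [hz, hy]; field_simp; ring
      have e2 : z^5 ≤ (2*r/b) * (2*w/b)^4 := by
        have : z ≤ 2*r/b := by rw [hz]; gcongr; linarith
        have : z ≤ 2*w/b := by rw [hz]; gcongr; linarith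
        have z0 : 0 ≤ z := by linarith
        calc z^5 = z * z^4 := by ring
          _ ≤ _ := by gcongr
      rw [e1]
      calc C1 * z^5 * (2*s/b) ≤ C1 * ((2*r/b) * (2*w/b)^4) * (2*s/b) := by gcongr
        _ = 16*C1/k * (w^4/b^4) * (4*k*r*s/b^2) := by field_simp; ring
    set q := w/b with hq
    have hq0 : 0 < q := by positivity
    have hq1 : (4 + 2*K1 + K2) * q ≤ 1 := by rw [hq, ← mul_div_assoc, div_le_one hb0]; exact hb
    have kq1 := mul_nonneg hK0 hq0.le
    have kq2 := mul_nonneg hK20 hq0.le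
    have hq4 : q ≤ 1/4 := by linarith only [kq1, kq2, hq1]
    have hqq : w^4/b^4 = q^4 := by rw [hq]; field_simp
    rw [hqq] at hEb
    have hv1 : |v| ≤ K1 * q^2 := by
      rw [hv]; refine (abs_add_le _ _).trans ?_
      have : |(c-2)*(c-3)/6 * (r^2+s^2)/b^2| ≤ |(c-2)*(c-3)/3| * q^2 := by
        rw [show (c-2)*(c-3)/6 * (r^2+s^2)/b^2 = (c-2)*(c-3)/3 * ((r^2+s^2)/(2*b^2)) by field_simp; ring, abs_mul]
        gcongr
        rw [abs_of_nonneg (by positivity), hq, div_pow, div_le_div_iff₀ (by positivity) (by positivity)]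
        have : r^2 ≤ w^2 := by gcongr
        have : s^2 ≤ w^2 := by gcongr
        have : 0 ≤ b^2 := by positivity
        calc (r^2+s^2) * b^2 ≤ (w^2+w^2) * b^2 := by gcongr
          _ = _ := by ring
      have h16 : 0 ≤ 16*C1/k := by positivity
      have : q^4 ≤ q^2 := pow_le_pow_of_le_one hq0.le (by linarith) (by norm_num)
      have : 16*C1/k * q^4 ≤ 16*C1/k * q^2 := by gcongr
      rw [hK1, add_mul]; linarith
    have hv2 : |v| ≤ 1/2 := by
      refine hv1.trans ?_
      calc K1 * q^2 = (K1*q)*q := by ring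
        _ ≤ 1/2*1 := mul_le_mul (by linarith only [kq2, hq1, hq0]) (by linarith only [hq4]) hq0.le (by norm_num)
        _ = _ := by norm_num
    have hv3 := abs_le.1 hv2
    have ht : (n+r+s)^c - (n+r)^c - (n+s)^c + n^c = (b/2)^c * (4*k*r*s/b^2) * (1+v) := by
      have a1 : (n+r+s)^c = (b/2)^c * (1+z)^c := by
        rw [show n+r+s = (b + (r+s))/2 by rw [hbd]; ring, half_rpow b _ c hb0 (by linarith)]
      have a2 : n^c = (b/2)^c * (1-z)^c := by
        rw [show n = (b + -(r+s))/2 by rw [hbd]; ring, half_rpow b _ c hb0 (by linarith)]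
        rw [hz]; congr 2; ring
      have a3 : (n+r)^c = (b/2)^c * (1+y)^c := by
        rw [show n+r = (b + (r-s))/2 by rw [hbd]; ring, half_rpow b _ c hb0 (by linarith)]
      have a4 : (n+s)^c = (b/2)^c * (1-y)^c := by
        rw [show n+s = (b + -(r-s))/2 by rw [hbd]; ring, half_rpow b _ c hb0 (by linarith)]
        rw [hy]; congr 2; ring
      rw [a1, a2, a3, a4]
      have : (4*k*r*s/b^2) * (1+v) = ((1+z)^c + (1-z)^c) - ((1+y)^c + (1-y)^c) := by
        have e0 : (4*k*r*s/b^2) * (E/(4*k*r*s/b^2)) = E := mul_div_cancel₀ _ (by positivity)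
        rw [hv, mul_add, mul_add, e0, hE]
        have e1 : z^2 - y^2 = 4*r*s/b^2 := by rw [hz, hy]; field_simp; ring
        have e2 : z^4 - y^4 = 8*r*s*(r^2+s^2)/b^4 := by rw [hz, hy]; field_simp; ring
        rw [e1, e2]; field_simp; ring
      rw [mul_assoc, this]; ring
    have hyy : ((n+r+s)^c - (n+r)^c - (n+s)^c + n^c) / (k * 2^(2-c) * (r*s)) = b^(c-2) * (1+v) := by
      rw [ht, Real.div_rpow hb0.le (by norm_num), Real.rpow_sub hb0, Real.rpow_sub (by norm_num : (0:ℝ) < 2), Real.rpow_two, Real.rpow_two]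
      field_simp; ring
    rw [hyy, root_norm b v (c-2) hb0 (by linarith) (by linarith)]
    have k2 := h2 v hv2
    have hc2 : 0 < c - 2 := by linarith
    have e5 : b * (1+v)^(1/(c-2)) - (b + (c-3)/6 * (r^2+s^2)/b) = b * (((1+v)^(1/(c-2)) - 1 - 1/(c-2) * v) + 1/(c-2) * (E/(4*k*r*s/b^2))) := by
      have : 1/(c-2) * v = (c-3)/6 * (r^2+s^2)/b^2 + 1/(c-2) * (E/(4*k*r*s/b^2)) := by
        rw [hv, mul_add]; congr 1; field_simp
      rw [this]
      generalize 1/(c-2) * (E/(4*k*r*s/b^2)) = W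
      generalize (1+v)^(1/(c-2)) = G
      field_simp; ring
    rw [e5, abs_mul, abs_of_pos hb0]
    have e6 : (4 + 2*K1 + K2) * w^4/b^3 = b * ((4 + 2*K1 + K2) * q^4) := by rw [hq]; field_simp
    rw [e6]
    gcongr
    refine (abs_add_le _ _).trans ?_
    rw [abs_mul, abs_of_pos (by positivity : 0 < 1/(c-2))]
    have e7 : C2 * v^2 ≤ C2 * (K1 * q^2)^2 := by
      have : v^2 ≤ (K1*q^2)^2 := by rw [← sq_abs v]; gcongr
      gcongr
    have e8 : 1/(c-2) * |E/(4*k*r*s/b^2)| ≤ 1/(c-2) * (16*C1/k * q^4) := by gcongr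
    have e9 : C2 * (K1 * q^2)^2 + 1/(c-2) * (16*C1/k * q^4) = K2 * q^4 := by rw [hK2]; ring
    have e10 : K2 * q^4 ≤ (4 + 2*K1 + K2) * q^4 := by gcongr; linarith
    linarith
  intro n r s w hn hr hs hrw hsw hb
  rcases le_total s r with h | h
  · exact main n r s w hn hr hs h hrw hsw hb
  · have := main n s r w hn hs hr h hsw hrw (by linarith)
    rw [show n + r + s = n + s + r by ring, show r * s = s * r by ring, show 2*n+r+s = 2*n+s+r by ring, show r^2+s^2 = s^2+r^2 by ring,
      show (n+s+r)^c - (n+r)^c - (n+s)^c + n^c = (n+s+r)^c - (n+s)^c - (n+r)^c + n^c by ring]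
    exact this

lemma ls_stage {ι κ : Type*} (s : Finset ι) (t : Finset κ) (φ : ι → κ → ℝ) (B : ℝ)
    (hB : ∀ (α : ι → ℂ) (β : κ → ℂ), (∀ i ∈ s, ‖α i‖ ≤ 1) → (∀ j ∈ t, ‖β j‖ ≤ 1) →
      ‖∑ i ∈ s, ∑ j ∈ t, α i * β j * e (φ i j)‖ ≤ B)
    (p : ι → ℝ) (z : κ → ℝ) (hp : ∀ i ∈ s, |p i| ≤ 1) (hz : ∀ j ∈ t, |z j| ≤ 1)
    (α : ι → ℂ) (β : κ → ℂ) (hα : ∀ i ∈ s, ‖α i‖ ≤ 1) (hβ : ∀ j ∈ t, ‖β j‖ ≤ 1) :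
    ‖∑ i ∈ s, ∑ j ∈ t, α i * β j * e (φ i j + p i * z j)‖ ≤ Real.exp (2 * Real.pi) * B := by
  have h1 : ∀ i j, HasSum (fun k : ℕ => ((2 * Real.pi * Complex.I)^k / (k.factorial : ℂ)) *
      ((α i * (p i : ℂ)^k) * (β j * (z j : ℂ)^k) * e (φ i j))) (α i * β j * e (φ i j + p i * z j)) := by
    intro i j
    have := NormedSpace.expSeries_div_hasSum_exp (2 * Real.pi * Complex.I * ((p i * z j : ℝ) : ℂ))
    rw [← Complex.exp_eq_exp_ℂ] at this
    have h2 := this.mul_left (α i * β j * e (φ i j))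
    rw [e_add]
    have hfun : (fun k : ℕ => ((2 * Real.pi * Complex.I)^k / (k.factorial : ℂ)) *
      ((α i * (p i : ℂ)^k) * (β j * (z j : ℂ)^k) * e (φ i j))) = (fun k : ℕ => α i * β j * e (φ i j) * ((2 * Real.pi * Complex.I * ((p i * z j : ℝ) : ℂ)) ^ k / (k.factorial : ℂ))) := by
      funext k; push_cast; rw [mul_pow _ ((p i:ℂ) * (z j:ℂ)), mul_pow (p i : ℂ)]; ring
    have hval : α i * β j * (e (φ i j) * e (p i * z j)) = α i * β j * e (φ i j) * Complex.exp (2 * Real.pi * Complex.I * ((p i * z j : ℝ) : ℂ)) := by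
      simp only [e]; ring
    rw [hfun, hval]; exact h2
  have h2 := hasSum_sum (s := s) (fun i _ => hasSum_sum (s := t) (fun j _ => h1 i j))
  have h3 := (NormedSpace.expSeries_div_hasSum_exp (2 * Real.pi : ℝ)).mul_right B
  rw [← Real.exp_eq_exp_ℝ] at h3
  refine HasSum.norm_le_of_bounded h2 h3 ?_
  intro k
  simp_rw [← Finset.mul_sum]
  rw [norm_mul]
  have e1 : ‖(2 * Real.pi * Complex.I : ℂ)^k / (k.factorial : ℂ)‖ = (2 * Real.pi)^k / k.factorial := by
    rw [norm_div, norm_pow, norm_mul, norm_mul, Complex.norm_I, Complex.norm_natCast, Complex.norm_real]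
    simp [abs_of_pos Real.pi_pos]
  rw [e1]
  have pi := Real.pi_pos
  gcongr
  apply hB
  · intro i hi
    rw [norm_mul, norm_pow, Complex.norm_real, Real.norm_eq_abs]
    exact mul_le_one₀ (hα i hi) (by positivity) (pow_le_one₀ (abs_nonneg _) (hp i hi))
  · intro i hi
    rw [norm_mul, norm_pow, Complex.norm_real, Real.norm_eq_abs]
    exact mul_le_one₀ (hβ i hi) (by positivity) (pow_le_one₀ (abs_nonneg _) (hz i hi))

lemma e_mul_nat (t : ℝ) (l : ℕ) : e (l * t) = e t ^ l := by
  unfold e; rw [← Complex.exp_nat_mul]; congr 1; push_cast; ring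

lemma orth (P : ℕ) (hP : 0 < P) (k k' : ℕ) (hk : k < P) (hk' : k' < P) :
    ∑ l ∈ range P, e (l * (((k:ℝ) - k')/P)) = if k = k' then (P:ℂ) else 0 := by
  have hP' : (P:ℝ) ≠ 0 := by positivity
  split_ifs with h
  · subst h; simp [e_zero]
  · simp_rw [e_mul_nat]
    have hx : e (((k:ℝ) - k')/P) ≠ 1 := by
      intro h1
      unfold e at h1
      rw [Complex.exp_eq_one_iff] at h1
      obtain ⟨n, hn⟩ := h1
      have h2 : ((((k:ℝ) - k')/P : ℝ) : ℂ) = (n:ℂ) := by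
        have : (2 * Real.pi * Complex.I : ℂ) ≠ 0 := by simp [Real.pi_ne_zero, Complex.I_ne_zero]
        apply mul_left_cancel₀ this; rw [hn]; ring
      have h3 : ((k:ℝ) - k')/P = n := by exact_mod_cast h2
      rw [div_eq_iff hP'] at h3
      have h4 : (k:ℤ) - k' = n * P := by exact_mod_cast h3
      have h5 : n = 0 := by
        by_contra hne
        have : 1 ≤ |n| := Int.one_le_abs hne
        have h6 : |(k:ℤ) - k'| = |n| * P := by rw [h4, abs_mul, Nat.abs_cast]
        have h7 : |(k:ℤ) - k'| < P := by rw [abs_lt]; omega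
        nlinarith
      rw [h5] at h4; omega
    have h1 := geom_sum_mul (e (((k:ℝ) - k')/P)) P
    have h2 : e (((k:ℝ) - k')/P) ^ P = 1 := by
      rw [← e_mul_nat, show (P:ℝ) * (((k:ℝ) - k')/P) = (((k:ℤ) - k' : ℤ) : ℝ) by push_cast; field_simp, e_int]
    rw [h2, sub_self] at h1
    exact (mul_eq_zero.1 h1).resolve_right (sub_ne_zero.2 hx)

lemma pair_bd {κ : Type*} (t : Finset κ) (k : κ → ℕ) (β : κ → ℂ) (hβ : ∀ j ∈ t, ‖β j‖ ≤ 1) (c : ℝ) (hc : 0 ≤ c) :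
    ‖∑ j ∈ t, ∑ j' ∈ t, β j * (starRingEnd ℂ) (β j') * (if k j = k j' then (c:ℂ) else 0)‖ ≤ c * ((t ×ˢ t).filter (fun q => k q.1 = k q.2)).card := by
  rw [← Finset.sum_product']
  refine (norm_sum_le _ _).trans ?_
  rw [Finset.card_filter]; push_cast; rw [Finset.mul_sum]
  apply Finset.sum_le_sum
  intro q hq
  rw [mem_product] at hq
  rw [norm_mul, norm_mul, RCLike.norm_conj]
  have := mul_le_one₀ (hβ _ hq.1) (norm_nonneg _) (hβ _ hq.2)
  split_ifs
  · rw [Complex.norm_real, Real.norm_eq_abs, abs_of_nonneg hc, mul_one]; exact mul_le_of_le_one_left hc this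
  · simp

lemma ls_grid {ι κ : Type*} (s : Finset ι) (t : Finset κ) (P : ℕ) (hP : 0 < P) (l : ι → ℕ) (k : κ → ℕ)
    (hl : ∀ i ∈ s, l i < P) (hk : ∀ j ∈ t, k j < P)
    (α : ι → ℂ) (β : κ → ℂ) (hα : ∀ i ∈ s, ‖α i‖ ≤ 1) (hβ : ∀ j ∈ t, ‖β j‖ ≤ 1) :
    ‖∑ i ∈ s, ∑ j ∈ t, α i * β j * e ((l i : ℝ) * (k j) / P)‖^2 ≤
      P * ((s ×ˢ s).filter (fun q => l q.1 = l q.2)).card * ((t ×ˢ t).filter (fun q => k q.1 = k q.2)).card := by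
  set S : ℕ → ℂ := fun m => ∑ j ∈ t, β j * e ((m : ℝ) * (k j) / P) with hS
  set a : ℕ → ℂ := fun m => ∑ i ∈ s, if l i = m then α i else 0 with ha
  have h1 : ∑ i ∈ s, ∑ j ∈ t, α i * β j * e ((l i : ℝ) * (k j) / P) = ∑ m ∈ range P, a m * S m := by
    simp only [ha, Finset.sum_mul]
    rw [Finset.sum_comm (s := range P)]
    apply Finset.sum_congr rfl
    intro i hi
    rw [Finset.sum_eq_single (l i)]
    · simp [hS, Finset.mul_sum, mul_assoc]
    · intro m _ hm; rw [if_neg (Ne.symm hm)]; simp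
    · intro h; exact absurd (mem_range.2 (hl i hi)) h
  have h2 : ‖∑ m ∈ range P, a m * S m‖^2 ≤ (∑ m ∈ range P, ‖a m‖^2) * (∑ m ∈ range P, ‖S m‖^2) := by
    refine le_trans ?_ (Finset.sum_mul_sq_le_sq_mul_sq _ _ _)
    gcongr
    refine (norm_sum_le _ _).trans ?_
    simp [norm_mul]
  have hn : ∀ w : ℂ, ((‖w‖^2 : ℝ) : ℂ) = w * (starRingEnd ℂ) w := by
    intro w; rw [Complex.mul_conj, Complex.normSq_eq_norm_sq]
  have h3 : (∑ m ∈ range P, ‖a m‖^2) ≤ ((s ×ˢ s).filter (fun q => l q.1 = l q.2)).card := by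
    have e1 : ((∑ m ∈ range P, ‖a m‖^2 : ℝ) : ℂ) = ∑ i ∈ s, ∑ i' ∈ s, α i * (starRingEnd ℂ) (α i') * (if l i = l i' then ((1:ℝ):ℂ) else 0) := by
      push_cast
      have : ∀ m, ((‖a m‖:ℂ))^2 = ∑ i ∈ s, ∑ i' ∈ s, (if l i = m then α i else 0) * (starRingEnd ℂ) (if l i' = m then α i' else 0) := by
        intro m; have := hn (a m); push_cast at this; rw [this]; simp only [ha, map_sum]; rw [Finset.sum_mul_sum]
      simp_rw [this]
      rw [Finset.sum_comm]; apply Finset.sum_congr rfl; intro i hi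
      rw [Finset.sum_comm]; apply Finset.sum_congr rfl; intro i' hi'
      rw [Finset.sum_eq_single (l i)]
      · by_cases h : l i = l i'
        · simp [h]
        · simp [h, Ne.symm h]
      · intro m _ hm; rw [if_neg (Ne.symm hm)]; simp
      · intro h; exact absurd (mem_range.2 (hl i hi)) h
    have e2 := pair_bd s l α hα 1 zero_le_one
    rw [← e1, Complex.norm_real, Real.norm_eq_abs, one_mul] at e2
    exact (le_abs_self _).trans e2
  have h4 : (∑ m ∈ range P, ‖S m‖^2) ≤ P * ((t ×ˢ t).filter (fun q => k q.1 = k q.2)).card := by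
    have e1 : ((∑ m ∈ range P, ‖S m‖^2 : ℝ) : ℂ) = ∑ j ∈ t, ∑ j' ∈ t, β j * (starRingEnd ℂ) (β j') * (if k j = k j' then ((P:ℝ):ℂ) else 0) := by
      push_cast
      have : ∀ m : ℕ, ((‖S m‖:ℂ))^2 = ∑ j ∈ t, ∑ j' ∈ t, β j * (starRingEnd ℂ) (β j') * e (m * (((k j:ℝ) - k j')/P)) := by
        intro m; have := hn (S m); push_cast at this; rw [this]; simp only [hS, map_sum]; rw [Finset.sum_mul_sum]
        apply Finset.sum_congr rfl; intro j _
        apply Finset.sum_congr rfl; intro j' _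
        rw [map_mul, e_conj, show (m:ℝ) * (((k j:ℝ) - k j')/P) = m * k j / P + -(m * k j' / P) by ring, e_add]; ring
      simp_rw [this]
      rw [Finset.sum_comm]; apply Finset.sum_congr rfl; intro j hj
      rw [Finset.sum_comm]; apply Finset.sum_congr rfl; intro j' hj'
      rw [← Finset.mul_sum, orth P hP _ _ (hk j hj) (hk j' hj')]
    have e2 := pair_bd t k β hβ P (by positivity)
    rw [← e1, Complex.norm_real, Real.norm_eq_abs] at e2
    exact (le_abs_self _).trans e2
  rw [h1]
  refine h2.trans ?_
  calc _ ≤ (((s ×ˢ s).filter (fun q => l q.1 = l q.2)).card : ℝ) * (P * ((t ×ˢ t).filter (fun q => k q.1 = k q.2)).card) := by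
        gcongr
    _ = _ := by ring

lemma floor_close (x y δ : ℝ) (hδ : 0 < δ) (hx : 0 ≤ x) (hy : 0 ≤ y) (h : ⌊x/δ⌋₊ = ⌊y/δ⌋₊) : |x - y| ≤ δ := by
  have h1 := Nat.floor_le (div_nonneg hx hδ.le)
  have h2 := Nat.lt_floor_add_one (x/δ)
  have h3 := Nat.floor_le (div_nonneg hy hδ.le)
  have h4 := Nat.lt_floor_add_one (y/δ)
  rw [h] at h1 h2
  have : |x/δ - y/δ| ≤ 1 := by rw [abs_le]; constructor <;> linarith
  rw [← sub_div, abs_div, abs_of_pos hδ, div_le_one hδ] at this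
  exact this

open scoped Classical in
lemma dls {ι κ : Type*} (s : Finset ι) (t : Finset κ) (u : ι → ℝ) (v : κ → ℝ) (U V : ℝ) (hU : 0 < U) (hV : 0 < V) (hUV : 1 ≤ U * V)
    (hu : ∀ i ∈ s, 0 ≤ u i ∧ u i ≤ U) (hv : ∀ j ∈ t, 0 ≤ v j ∧ v j ≤ V)
    (α : ι → ℂ) (β : κ → ℂ) (hα : ∀ i ∈ s, ‖α i‖ ≤ 1) (hβ : ∀ j ∈ t, ‖β j‖ ≤ 1) :
    ‖∑ i ∈ s, ∑ j ∈ t, α i * β j * e (u i * v j)‖^2 ≤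
      17 * (Real.exp (2 * Real.pi))^4 * (U * V) * ((s ×ˢ s).filter (fun q => |u q.1 - u q.2| ≤ 1/V)).card
        * ((t ×ˢ t).filter (fun q => |v q.1 - v q.2| ≤ 1/U)).card := by
  set P := ⌈16 * (U*V)⌉₊ with hP
  have hP1 : 16 * (U*V) ≤ P := Nat.le_ceil _
  have hP2 : (P:ℝ) ≤ 17 * (U*V) := by
    have := (Nat.ceil_lt_add_one (by positivity : 0 ≤ 16 * (U*V))).le
    linarith
  have hP0 : (0:ℝ) < P := by linarith
  have hPn : 0 < P := by exact_mod_cast hP0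
  set du := 1/(4*V) with hdu
  set dv := 4*V/P with hdv
  have hdu0 : 0 < du := by positivity
  have hdv0 : 0 < dv := by positivity
  have hdv1 : dv ≤ 1/(4*U) := by
    rw [hdv, div_le_div_iff₀ hP0 (by positivity)]; linarith
  have hdd : du * dv = 1/P := by rw [hdu, hdv]; field_simp
  set l : ι → ℕ := fun i => ⌊u i/du⌋₊ with hl
  set k : κ → ℕ := fun j => ⌊v j/dv⌋₊ with hk
  have hl1 : ∀ i ∈ s, l i < P := by
    intro i hi
    have h1 := Nat.floor_le (div_nonneg (hu i hi).1 hdu0.le)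
    have h2 : u i / du ≤ 4 * (U * V) := by
      rw [hdu, div_div_eq_mul_div, div_one]; nlinarith [(hu i hi).2]
    have : ((l i : ℕ) : ℝ) < P := by simp only [hl]; linarith
    exact_mod_cast this
  have hk1 : ∀ j ∈ t, k j < P := by
    intro j hj
    have h1 := Nat.floor_le (div_nonneg (hv j hj).1 hdv0.le)
    have h2 : v j / dv ≤ P / 4 := by
      rw [hdv, div_div_eq_mul_div, div_le_div_iff₀ (by positivity) (by positivity)]; nlinarith [(hv j hj).2]
    have : ((k j : ℕ) : ℝ) < P := by simp only [hk]; linarith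
    exact_mod_cast this
  set B := Real.sqrt (P * ((s ×ˢ s).filter (fun q => l q.1 = l q.2)).card * ((t ×ˢ t).filter (fun q => k q.1 = k q.2)).card) with hB
  have st0 : ∀ (α : ι → ℂ) (β : κ → ℂ), (∀ i ∈ s, ‖α i‖ ≤ 1) → (∀ j ∈ t, ‖β j‖ ≤ 1) →
      ‖∑ i ∈ s, ∑ j ∈ t, α i * β j * e ((l i : ℝ) * (k j) / P)‖ ≤ B := by
    intro α β hα hβ
    exact Real.le_sqrt_of_sq_le (ls_grid s t P hPn l k hl1 hk1 α β hα hβ)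
  have st1 := ls_stage s t _ B st0 (fun i => (u i - l i * du) * V) (fun j => v j / V) (by
      intro i hi
      have h1 := Nat.floor_le (div_nonneg (hu i hi).1 hdu0.le)
      have h2 := Nat.lt_floor_add_one (u i/du)
      rw [le_div_iff₀ hdu0] at h1
      rw [div_lt_iff₀ hdu0] at h2
      have h3 : |u i - l i * du| ≤ du := by rw [abs_le]; simp only [hl]; constructor <;> linarith
      rw [abs_mul, abs_of_pos hV]
      have : du * V ≤ 1 := by rw [hdu]; field_simp; norm_num
      nlinarith) (by
      intro j hj
      rw [abs_div, abs_of_pos hV, abs_of_nonneg (hv j hj).1, div_le_one hV]; exact (hv j hj).2)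
  have st2 := ls_stage s t _ _ st1 (fun i => l i * du / U) (fun j => (v j - k j * dv) * U) (by
      intro i hi
      have h1 := Nat.floor_le (div_nonneg (hu i hi).1 hdu0.le)
      rw [le_div_iff₀ hdu0] at h1
      rw [abs_div, abs_of_pos hU, abs_of_nonneg (by positivity), div_le_one hU]
      exact h1.trans (hu i hi).2) (by
      intro j hj
      have h1 := Nat.floor_le (div_nonneg (hv j hj).1 hdv0.le)
      have h2 := Nat.lt_floor_add_one (v j/dv)
      rw [le_div_iff₀ hdv0] at h1
      rw [div_lt_iff₀ hdv0] at h2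
      have h3 : |v j - k j * dv| ≤ dv := by rw [abs_le]; simp only [hk]; constructor <;> linarith
      rw [abs_mul, abs_of_pos hU]
      have : dv * U ≤ 1 := by
        calc dv * U ≤ 1/(4*U) * U := by gcongr
          _ = 1/4 := by field_simp
          _ ≤ 1 := by norm_num
      nlinarith) α β hα hβ
  have hid : ∀ i j, (l i : ℝ) * (k j) / P + (u i - l i * du) * V * (v j / V) + l i * du / U * ((v j - k j * dv) * U) = u i * v j := by
    intro i j
    have : (l i : ℝ) * (k j) / P = l i * k j * (du * dv) := by rw [hdd]; ring
    rw [this]; field_simp; ring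
  simp_rw [hid] at st2
  have hfin := pow_le_pow_left₀ (norm_nonneg _) st2 2
  refine hfin.trans ?_
  rw [mul_pow, mul_pow, hB, Real.sq_sqrt (by positivity)]
  have c1 : (((s ×ˢ s).filter (fun q => l q.1 = l q.2)).card : ℝ) ≤ ((s ×ˢ s).filter (fun q => |u q.1 - u q.2| ≤ 1/V)).card := by
    norm_cast
    apply Finset.card_le_card
    intro q hq
    rw [mem_filter, mem_product] at hq ⊢
    refine ⟨hq.1, (floor_close _ _ du hdu0 (hu _ hq.1.1).1 (hu _ hq.1.2).1 hq.2).trans ?_⟩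
    rw [hdu]; apply one_div_le_one_div_of_le hV; linarith
  have c2 : (((t ×ˢ t).filter (fun q => k q.1 = k q.2)).card : ℝ) ≤ ((t ×ˢ t).filter (fun q => |v q.1 - v q.2| ≤ 1/U)).card := by
    norm_cast
    apply Finset.card_le_card
    intro q hq
    rw [mem_filter, mem_product] at hq ⊢
    refine ⟨hq.1, (floor_close _ _ dv hdv0 (hv _ hq.1.1).1 (hv _ hq.1.2).1 hq.2).trans (hdv1.trans ?_)⟩
    apply one_div_le_one_div_of_le hU; linarith
  calc _ ≤ (Real.exp (2*Real.pi))^2 * ((Real.exp (2*Real.pi))^2 * ((17 * (U*V)) * ((s ×ˢ s).filter (fun q => |u q.1 - u q.2| ≤ 1/V)).card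
        * ((t ×ˢ t).filter (fun q => |v q.1 - v q.2| ≤ 1/U)).card)) := by gcongr
    _ = _ := by ring

lemma spaced {ι : Type*} (T : Finset ι) (g : ι → ℝ) (a l s : ℝ) (hs : 0 < s) (hl : 0 ≤ l)
    (h1 : ∀ i ∈ T, a ≤ g i ∧ g i ≤ a + l) (h2 : ∀ i ∈ T, ∀ j ∈ T, i ≠ j → s ≤ |g i - g j|) :
    (T.card : ℝ) ≤ 1 + l / s := by
  have hc : T.card ≤ (range (⌊l/s⌋₊ + 1)).card := by
    apply Finset.card_le_card_of_injOn (fun i => ⌊(g i - a)/s⌋₊)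
    · intro i hi
      have := h1 i hi
      simp only [coe_range, Set.mem_Iio]
      apply Nat.lt_succ_of_le
      apply Nat.floor_le_floor
      gcongr; linarith
    · intro i hi j hj hij
      by_contra hne
      have a1 := h1 i hi
      have a2 := h1 j hj
      have h3 := h2 i hi j hj hne
      simp only at hij
      have b1 := Nat.floor_le (div_nonneg (by linarith : 0 ≤ g i - a) hs.le)
      have b2 := Nat.lt_floor_add_one ((g i - a)/s)
      have b3 := Nat.floor_le (div_nonneg (by linarith : 0 ≤ g j - a) hs.le)
      have b4 := Nat.lt_floor_add_one ((g j - a)/s)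
      rw [hij] at b1 b2
      rw [le_div_iff₀ hs] at b1 b3
      rw [div_lt_iff₀ hs] at b2 b4
      have : |g i - g j| < s := by rw [abs_lt]; constructor <;> nlinarith
      linarith
  rw [card_range] at hc
  have := Nat.floor_le (div_nonneg hl hs.le)
  have h3 : (T.card : ℝ) ≤ (⌊l/s⌋₊ : ℝ) + 1 := by exact_mod_cast hc
  linarith

lemma divisor_bd (ε : ℝ) (hε : 0 < ε) : ∃ C ≥ (1:ℝ), ∀ n : ℕ, 0 < n → ((n.divisors.card : ℕ) : ℝ) ≤ C * (n:ℝ)^ε := by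
  set K : ℝ := 1 + 1/(ε * Real.log 2) with hK
  have hl2 : 0 < Real.log 2 := Real.log_pos (by norm_num)
  have hK1 : 1 ≤ K := by rw [hK]; have : 0 < 1/(ε * Real.log 2) := by positivity
                         linarith
  set P0 : ℕ := ⌈(2:ℝ)^(1/ε)⌉₊ with hP0
  refine ⟨K^P0, one_le_pow₀ hK1, ?_⟩
  intro n hn
  have hterm : ∀ p ∈ n.primeFactors, ((n.factorization p + 1 : ℕ) : ℝ) ≤ (if p < P0 then K else 1) * (((p:ℝ)^(n.factorization p))^ε) := by
    intro p hp
    have hp2 : 2 ≤ p := (Nat.prime_of_mem_primeFactors hp).two_le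
    have hp2' : (2:ℝ) ≤ p := by exact_mod_cast hp2
    set v := n.factorization p
    rw [← Real.rpow_natCast, ← Real.rpow_mul (by positivity)]
    split_ifs with h
    · have h1 : (2:ℝ)^((v:ℝ)*ε) ≤ (p:ℝ)^((v:ℝ)*ε) := Real.rpow_le_rpow (by norm_num) hp2' (by positivity)
      have h2 : 1 + Real.log 2 * ((v:ℝ)*ε) ≤ (2:ℝ)^((v:ℝ)*ε) := by
        rw [Real.rpow_def_of_pos (by norm_num)]
        have := Real.add_one_le_exp (Real.log 2 * ((v:ℝ)*ε)); linarith
      have h3 : ((v + 1 : ℕ):ℝ) ≤ K * (1 + Real.log 2 * ((v:ℝ)*ε)) := by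
        rw [hK]; push_cast
        have : (1 + 1 / (ε * Real.log 2)) * (1 + Real.log 2 * (↑v * ε)) = 1 + v + (1 / (ε * Real.log 2) + Real.log 2 * (↑v * ε)) := by
          field_simp; ring
        rw [this]
        have : 0 ≤ (1 / (ε * Real.log 2) + Real.log 2 * (↑v * ε)) := by positivity
        linarith
      refine h3.trans ?_
      gcongr
      linarith
    · rw [one_mul]
      push Not at h
      have h1 : (2:ℝ)^(1/ε) ≤ p := (Nat.le_ceil _).trans (by exact_mod_cast h)
      have h2 : ((2:ℝ)^(1/ε))^((v:ℝ)*ε) ≤ (p:ℝ)^((v:ℝ)*ε) := Real.rpow_le_rpow (by positivity) h1 (by positivity)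
      rw [← Real.rpow_mul (by norm_num), show 1/ε * ((v:ℝ)*ε) = v by field_simp, Real.rpow_natCast] at h2
      refine le_trans ?_ h2
      have : v + 1 ≤ 2^v := Nat.lt_two_pow_self
      exact_mod_cast this
  rw [Nat.card_divisors hn.ne']
  push_cast
  have h1 : ∏ x ∈ n.primeFactors, ((n.factorization x : ℝ) + 1) ≤ ∏ p ∈ n.primeFactors, ((if p < P0 then K else 1) * (((p:ℝ)^(n.factorization p))^ε)) := by
    apply Finset.prod_le_prod
    · intro i _; positivity
    · intro p hp; have := hterm p hp; push_cast at this; exact this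
  refine h1.trans ?_
  rw [Finset.prod_mul_distrib]
  have h2 : ∏ p ∈ n.primeFactors, ((p:ℝ)^(n.factorization p))^ε = (n:ℝ)^ε := by
    rw [Real.finsetProd_rpow _ _ (fun i _ => by positivity)]
    congr 1
    have := Nat.prod_factorization_pow_eq_self hn.ne'
    rw [Nat.prod_factorization_eq_prod_primeFactors] at this
    exact_mod_cast this
  rw [h2]
  gcongr
  rw [Finset.prod_ite, Finset.prod_const, Finset.prod_const_one, mul_one]
  apply pow_le_pow_right₀ hK1
  have : (n.primeFactors.filter (fun p => p < P0)) ⊆ range P0 := by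
    intro p hp; rw [mem_filter] at hp; exact mem_range.2 hp.2
  simpa using Finset.card_le_card this

lemma rpow_bilip (α : ℝ) (hα : 0 < α) : ∃ k > 0, ∀ s t : ℝ, 1/2 ≤ s → s ≤ 2 → 1/2 ≤ t → t ≤ 2 → k * |s - t| ≤ |s^α - t^α| := by
  set k := α * min ((2:ℝ)^(α-1)) ((1/2:ℝ)^(α-1)) with hk
  have hk0 : 0 < k := by positivity
  have main : ∀ s t : ℝ, 1/2 ≤ s → t ≤ 2 → s < t → k * |s - t| ≤ |s^α - t^α| := by
    intro s t hs ht hst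
    obtain ⟨ξ, h1, h2, h3⟩ := dif_rpow [t - s] (by intro h hh; simp at hh; linarith) α s (by linarith)
    simp [dif, dpo] at h1 h2 h3
    rw [abs_sub_comm, abs_sub_comm (s^α), h3, abs_mul, abs_mul, abs_of_pos hα]
    have h4 : min ((2:ℝ)^(α-1)) ((1/2:ℝ)^(α-1)) ≤ |ξ^(α-1)| := by
      rw [abs_of_pos (Real.rpow_pos_of_pos (by linarith) _)]
      by_cases h : 1 ≤ α
      · exact (min_le_right _ _).trans (Real.rpow_le_rpow (by norm_num) (by linarith) (by linarith))
      · exact (min_le_left _ _).trans (Real.rpow_le_rpow_of_nonpos (by linarith) (by linarith) (by linarith))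
    rw [hk]
    have : 0 ≤ α * |t - s| := by positivity
    nlinarith
  refine ⟨k, hk0, ?_⟩
  intro s t hs hs2 ht ht2
  rcases lt_trichotomy s t with h | h | h
  · exact main s t hs ht2 h
  · subst h; simp
  · rw [abs_sub_comm, abs_sub_comm (s^α)]; exact main t s ht hs2 h

lemma gcd_sep (g a a' b b' : ℕ) (A : ℝ) (hg : 0 < g) (h1 : a.gcd a' = g) (h2 : b.gcd b' = g) (ha : 0 < a) (ha' : 0 < a') (hb : 0 < b) (hb' : 0 < b')
    (hA1 : (a':ℝ) ≤ A) (hA2 : (b':ℝ) ≤ A) (hne : (a, a') ≠ (b, b')) : ((g:ℝ)/A)^2 ≤ |(a:ℝ)/a' - b/b'| := by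
  have hA : 0 < A := by have : (0:ℝ) < a' := by exact_mod_cast ha'
                        linarith
  obtain ⟨x, x', hco, hx, hx'⟩ := Nat.exists_coprime a a'
  obtain ⟨y, y', hco2, hy, hy'⟩ := Nat.exists_coprime b b'
  rw [h1] at hx hx'
  rw [h2] at hy hy'
  have hxx : 0 < x' := by by_contra h; have : x' = 0 := by omega
                          rw [this] at hx'; omega
  have hyy : 0 < y' := by by_contra h; have : y' = 0 := by omega
                          rw [this] at hy'; omega
  have hd : x * y' ≠ y * x' := by
    intro h
    have e1 : x' ∣ y' := hco.symm.dvd_of_dvd_mul_left (by rw [h]; exact Dvd.intro_left y rfl)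
    have e2 : y' ∣ x' := hco2.symm.dvd_of_dvd_mul_left (by rw [← h]; exact Dvd.intro_left x rfl)
    have e3 := Nat.dvd_antisymm e1 e2
    rw [e3] at h
    have e4 := Nat.eq_of_mul_eq_mul_right hyy h
    apply hne
    rw [hx, hx', hy, hy', e3, e4]
  have hd2 : (1:ℝ) ≤ |(x:ℝ) * y' - y * x'| := by
    have : (1:ℤ) ≤ |(x:ℤ) * y' - y * x'| := Int.one_le_abs (by intro h; apply hd; zify; linarith)
    exact_mod_cast this
  have ha'r : (0:ℝ) < a' := by exact_mod_cast ha'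
  have hb'r : (0:ℝ) < b' := by exact_mod_cast hb'
  rw [div_sub_div _ _ ha'r.ne' hb'r.ne', abs_div, abs_of_pos (mul_pos ha'r hb'r), div_pow]
  have e5 : (a:ℝ) * b' - a' * b = g^2 * ((x:ℝ) * y' - y * x') := by rw [hx, hx', hy, hy']; push_cast; ring
  rw [e5, abs_mul, abs_of_nonneg (by positivity : (0:ℝ) ≤ (g:ℝ)^2)]
  apply div_le_div₀ (by positivity)
  · nlinarith [sq_nonneg (g:ℝ)]
  · positivity
  · nlinarith

lemma fib_card {α β : Type*} [DecidableEq β] (S : Finset α) (t : Finset β) (f : α → β) (h : ∀ a ∈ S, f a ∈ t) (bd : ℝ)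
    (hb : ∀ b ∈ t, ((S.filter (fun a => f a = b)).card : ℝ) ≤ bd) : (S.card : ℝ) ≤ t.card * bd := by
  rw [Finset.card_eq_sum_card_fiberwise (f := f) (t := t) h]
  push_cast
  refine (Finset.sum_le_sum hb).trans ?_
  simp

lemma mult_card (B h : ℕ) : ((((Ioc 0 B).filter (fun x => h ∣ x)) ×ˢ ((Ioc 0 B).filter (fun x => h ∣ x))).card : ℝ) ≤ ((B:ℝ)/h)^2 := by
  rw [card_product, Nat.Ioc_filter_dvd_card_eq_div]
  push_cast
  have : ((B/h : ℕ) : ℝ) ≤ (B:ℝ)/h := Nat.cast_div_le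
  rw [sq]; gcongr

lemma harm_bd (A : ℕ) : ∑ g ∈ Ioc 0 A, (1:ℝ)/g ≤ 1 + Real.log A := by
  have h := harmonic_le_one_add_log A
  rw [harmonic_eq_sum_Icc] at h
  push_cast at h
  refine le_trans (le_of_eq ?_) h
  apply Finset.sum_congr
  · ext x; simp [mem_Ioc, mem_Icc]; omega
  · intro x _; rw [one_div]

noncomputable def gset (α : ℝ) (A B : ℕ) (D : ℝ) : Finset ((ℕ × ℕ) × (ℕ × ℕ)) :=
  open scoped Classical in
  (((Ioc 0 A) ×ˢ (Ioc 0 A)) ×ˢ ((Ioc 0 B) ×ˢ (Ioc 0 B))).filter (fun p => A ≤ 2 * p.1.1 ∧ A ≤ 2 * p.1.2 ∧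
    |((p.1.1:ℝ)/p.1.2)^α - (p.2.2:ℝ)/p.2.1| ≤ D)

lemma mem_gset (α : ℝ) (A B : ℕ) (D : ℝ) (p : (ℕ × ℕ) × (ℕ × ℕ)) : p ∈ gset α A B D ↔
    ((0 < p.1.1 ∧ p.1.1 ≤ A) ∧ (0 < p.1.2 ∧ p.1.2 ≤ A)) ∧ ((0 < p.2.1 ∧ p.2.1 ≤ B) ∧ (0 < p.2.2 ∧ p.2.2 ≤ B)) ∧
    (A ≤ 2 * p.1.1 ∧ A ≤ 2 * p.1.2 ∧ |((p.1.1:ℝ)/p.1.2)^α - (p.2.2:ℝ)/p.2.1| ≤ D) := by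
  unfold gset
  simp only [mem_filter, mem_product, mem_Ioc]
  tauto

lemma gfib (α : ℝ) (hα : 0 < α) : ∃ C ≥ (1:ℝ), ∀ (A B g h : ℕ) (D : ℝ), 0 ≤ D → 0 < g → 0 < h → 0 < A → 0 < B →
    (((gset α A B D).filter (fun p => (p.1.1.gcd p.1.2, p.2.2.gcd p.2.1) = (g, h))).card : ℝ) ≤
      C * ((A:ℝ)/g * (B/h) + D * ((A:ℝ)/g)^2 * ((B:ℝ)/h)^2) := by
  obtain ⟨k, hk, hlip⟩ := rpow_bilip α hα
  refine ⟨1 + 2 + 2/k, by have : 0 < 2/k := by positivity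
                          linarith, ?_⟩
  intro A B g h D hD hg hh hA hB
  have hA' : (0:ℝ) < A := by exact_mod_cast hA
  have hB' : (0:ℝ) < B := by exact_mod_cast hB
  have hg' : (0:ℝ) < g := by exact_mod_cast hg
  have hh' : (0:ℝ) < h := by exact_mod_cast hh
  set T := (gset α A B D).filter (fun p => (p.1.1.gcd p.1.2, p.2.2.gcd p.2.1) = (g, h)) with hT
  have memT : ∀ p ∈ T, p ∈ gset α A B D ∧ p.1.1.gcd p.1.2 = g ∧ p.2.2.gcd p.2.1 = h := by
    intro p hp; rw [hT, mem_filter, Prod.mk.injEq] at hp; exact hp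
  have hd1 : ∀ p ∈ T, p.1 ∈ ((Ioc 0 A).filter (fun x => g ∣ x)) ×ˢ ((Ioc 0 A).filter (fun x => g ∣ x)) := by
    intro p hp
    obtain ⟨h1, h2, h3⟩ := memT p hp
    rw [mem_gset] at h1
    simp only [mem_product, mem_filter, mem_Ioc]
    exact ⟨⟨h1.1.1, h2 ▸ Nat.gcd_dvd_left _ _⟩, ⟨h1.1.2, h2 ▸ Nat.gcd_dvd_right _ _⟩⟩
  have hd2 : ∀ p ∈ T, p.2 ∈ ((Ioc 0 B).filter (fun x => h ∣ x)) ×ˢ ((Ioc 0 B).filter (fun x => h ∣ x)) := by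
    intro p hp
    obtain ⟨h1, h2, h3⟩ := memT p hp
    rw [mem_gset] at h1
    simp only [mem_product, mem_filter, mem_Ioc]
    exact ⟨⟨h1.2.1.1, h3 ▸ Nat.gcd_dvd_right _ _⟩, ⟨h1.2.1.2, h3 ▸ Nat.gcd_dvd_left _ _⟩⟩
  have c1 : (T.card : ℝ) ≤ ((A:ℝ)/g)^2 * (1 + 2 * D * ((B:ℝ)/h)^2) := by
    refine (fib_card T _ (fun p => p.1) hd1 (1 + 2 * D * ((B:ℝ)/h)^2) ?_).trans ?_
    · intro q _
      have := spaced (T.filter (fun p => p.1 = q)) (fun p => (p.2.2:ℝ)/p.2.1) (((q.1:ℝ)/q.2)^α - D) (2*D) (((h:ℝ)/B)^2) (by positivity) (by positivity) (by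
          intro p hp
          rw [mem_filter] at hp
          have h1 := (memT p hp.1).1
          rw [mem_gset, hp.2] at h1
          have h2 := abs_le.1 h1.2.2.2.2
          constructor <;> linarith [h2.1, h2.2]) (by
          intro p hp p' hp' hne
          rw [mem_filter] at hp hp'
          obtain ⟨h1, h2, h3⟩ := memT p hp.1
          obtain ⟨h1', h2', h3'⟩ := memT p' hp'.1
          rw [mem_gset] at h1 h1'
          refine gcd_sep h _ _ _ _ B hh h3 h3' h1.2.1.2.1 h1.2.1.1.1 h1'.2.1.2.1 h1'.2.1.1.1 (by exact_mod_cast h1.2.1.1.2) (by exact_mod_cast h1'.2.1.1.2) ?_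
          intro heq
          rw [Prod.mk.injEq] at heq
          apply hne
          exact Prod.ext (hp.2.trans hp'.2.symm) (Prod.ext heq.2 heq.1))
      refine this.trans (le_of_eq ?_)
      field_simp
    · gcongr
      exact mult_card A g
  have c2 : (T.card : ℝ) ≤ ((B:ℝ)/h)^2 * (1 + 2 / k * D * ((A:ℝ)/g)^2) := by
    refine (fib_card T _ (fun p => p.2) hd2 (1 + 2 / k * D * ((A:ℝ)/g)^2) ?_).trans ?_
    · intro q _
      have := spaced (T.filter (fun p => p.2 = q)) (fun p => ((p.1.1:ℝ)/p.1.2)^α) (((q.2:ℝ)/q.1) - D) (2*D) (k * ((g:ℝ)/A)^2) (by positivity) (by positivity) (by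
          intro p hp
          rw [mem_filter] at hp
          have h1 := (memT p hp.1).1
          rw [mem_gset, hp.2] at h1
          have h2 := abs_le.1 h1.2.2.2.2
          constructor <;> linarith [h2.1, h2.2]) (by
          intro p hp p' hp' hne
          rw [mem_filter] at hp hp'
          obtain ⟨h1, h2, h3⟩ := memT p hp.1
          obtain ⟨h1', h2', h3'⟩ := memT p' hp'.1
          rw [mem_gset] at h1 h1'
          have hsep := gcd_sep g _ _ _ _ A hg h2 h2' h1.1.1.1 h1.1.2.1 h1'.1.1.1 h1'.1.2.1 (by exact_mod_cast h1.1.2.2) (by exact_mod_cast h1'.1.2.2) (by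
            intro heq
            rw [Prod.mk.injEq] at heq
            apply hne
            exact Prod.ext (Prod.ext heq.1 heq.2) (hp.2.trans hp'.2.symm))
          have rr : ∀ a b : ℕ, 0 < b → a ≤ A → b ≤ A → A ≤ 2 * a → A ≤ 2 * b → 1/2 ≤ (a:ℝ)/b ∧ (a:ℝ)/b ≤ 2 := by
            intro a b hb h1 h2 h3 h4
            have hb' : (0:ℝ) < b := by exact_mod_cast hb
            have e1 : (b:ℝ) ≤ 2 * a := by exact_mod_cast h2.trans h3
            have e2 : (a:ℝ) ≤ 2 * b := by exact_mod_cast h1.trans h4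
            rw [le_div_iff₀ hb', div_le_iff₀ hb']; constructor <;> linarith
          have r1 := rr _ _ h1.1.2.1 h1.1.1.2 h1.1.2.2 h1.2.2.1 h1.2.2.2.1
          have r2 := rr _ _ h1'.1.2.1 h1'.1.1.2 h1'.1.2.2 h1'.2.2.1 h1'.2.2.2.1
          refine le_trans ?_ (hlip _ _ r1.1 r1.2 r2.1 r2.2)
          gcongr)
      refine this.trans (le_of_eq ?_)
      field_simp
    · gcongr
      exact mult_card B h
  set x := (A:ℝ)/g
  set y := (B:ℝ)/h
  have hx : 0 ≤ x := by positivity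
  have hy : 0 ≤ y := by positivity
  have hxy : 0 ≤ x * y := by positivity
  have hz : 0 ≤ D * x^2 * y^2 := by positivity
  have hkz : 0 ≤ 2/k * (x*y) := by positivity
  have hkz2 : 0 ≤ 2/k * (D * x^2*y^2) := by positivity
  rcases le_total x y with hle | hle
  · refine c1.trans ?_
    have : x^2 ≤ x * y := by nlinarith
    nlinarith
  · refine c2.trans ?_
    have : y^2 ≤ x * y := by nlinarith
    nlinarith

lemma gcount (α : ℝ) (hα : 0 < α) : ∃ C ≥ (1:ℝ), ∀ (A B : ℕ) (D : ℝ), 0 ≤ D → 0 < A → 0 < B →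
    ((gset α A B D).card : ℝ) ≤ C * ((A:ℝ) * B + D * (A:ℝ)^2 * (B:ℝ)^2) * (1 + Real.log A) * (1 + Real.log B) := by
  obtain ⟨C, hC, hf⟩ := gfib α hα
  refine ⟨C, hC, ?_⟩
  intro A B D hD hA hB
  have hA' : (0:ℝ) < A := by exact_mod_cast hA
  have hB' : (0:ℝ) < B := by exact_mod_cast hB
  rw [Finset.card_eq_sum_card_fiberwise (f := fun p => (p.1.1.gcd p.1.2, p.2.2.gcd p.2.1)) (t := (Ioc 0 A) ×ˢ (Ioc 0 B))]
  swap
  · intro p hp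
    rw [mem_coe, mem_gset] at hp
    simp only [mem_coe, mem_product, mem_Ioc]
    exact ⟨⟨Nat.gcd_pos_of_pos_left _ hp.1.1.1, (Nat.gcd_le_left _ hp.1.1.1).trans hp.1.1.2⟩,
      ⟨Nat.gcd_pos_of_pos_left _ hp.2.1.2.1, (Nat.gcd_le_left _ hp.2.1.2.1).trans hp.2.1.2.2⟩⟩
  push_cast
  set E := (A:ℝ) * B + D * (A:ℝ)^2 * (B:ℝ)^2 with hE
  have hE0 : 0 ≤ E := by positivity
  calc _ ≤ ∑ q ∈ (Ioc 0 A) ×ˢ (Ioc 0 B), C * E * ((1:ℝ)/q.1 * (1/q.2)) := by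
        apply Finset.sum_le_sum
        intro q hq
        simp only [mem_product, mem_Ioc] at hq
        have hg' : (1:ℝ) ≤ q.1 := by exact_mod_cast hq.1.1
        have hh' : (1:ℝ) ≤ q.2 := by exact_mod_cast hq.2.1
        refine (hf A B q.1 q.2 D hD hq.1.1 hq.2.1 hA hB).trans ?_
        rw [mul_assoc C E]
        refine mul_le_mul_of_nonneg_left ?_ (by linarith)
        have e1 : (A:ℝ)/q.1 * (B/q.2) = A * B * ((1:ℝ)/q.1 * (1/q.2)) := by ring
        have e2 : D * ((A:ℝ)/q.1)^2 * ((B:ℝ)/q.2)^2 = D * (A:ℝ)^2 * (B:ℝ)^2 * ((1:ℝ)/q.1 * (1/q.2))^2 := by ring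
        have e3 : 0 ≤ (1:ℝ)/q.1 * (1/q.2) := by positivity
        have e4 : (1:ℝ)/q.1 * (1/q.2) ≤ 1 := by
          apply mul_le_one₀
          · rw [div_le_one (by linarith)]; exact hg'
          · positivity
          · rw [div_le_one (by linarith)]; exact hh'
        rw [e1, e2, hE, add_mul]
        gcongr
        nlinarith
    _ = C * E * ((∑ g ∈ Ioc 0 A, (1:ℝ)/g) * (∑ h ∈ Ioc 0 B, (1:ℝ)/h)) := by
        rw [← Finset.mul_sum, Finset.sum_mul_sum, ← Finset.sum_product']
    _ ≤ C * E * ((1 + Real.log A) * (1 + Real.log B)) := by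
        have := harm_bd A
        have := harm_bd B
        have : 0 ≤ Real.log A := Real.log_nonneg (by exact_mod_cast hA)
        gcongr
    _ = _ := by ring

lemma ratio_bd (α : ℝ) (hα : 0 < α) : ∃ C ≥ (1:ℝ), ∀ k A A' v v' z : ℝ, 0 < k → 0 < A → 0 < A' → 0 < v → 0 < v' → A ≤ 2 * A' →
    z ≤ 1/2 → |v' - v| ≤ z * v → |(v'/(k*A'))^α - (A/A')^α * (v/(k*A))^α| ≤ C * z * (v/(k*A))^α := by
  obtain ⟨C, hC, h⟩ := lin_bd α
  refine ⟨1 + 2^α * C, by have : 0 < (2:ℝ)^α * C := by positivity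
                          linarith, ?_⟩
  intro k A A' v v' z hk hA hA' hv hv' hAA hz hvv
  set w := (v' - v)/v with hw
  have hwz : |w| ≤ z := by rw [hw, abs_div, abs_of_pos hv, div_le_iff₀ hv]; exact hvv
  have h1 := h w (hwz.trans hz)
  have hz0 : 0 ≤ z := (abs_nonneg _).trans hwz
  have e0 : 1 + w = v'/v := by rw [hw]; field_simp; ring
  have e1 : v'/(k*A') = (A/A') * (v/(k*A)) * (1 + w) := by rw [e0]; field_simp
  have hy : 0 < (v/(k*A))^α := by positivity
  have hth : 0 < (A/A')^α := by positivity
  have hth2 : (A/A')^α ≤ 2^α := by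
    apply Real.rpow_le_rpow (by positivity) _ hα.le
    rw [div_le_iff₀ hA']; exact hAA
  rw [e1, Real.mul_rpow (by positivity) (by rw [e0]; positivity), Real.mul_rpow (by positivity) (by positivity)]
  have e2 : (A/A')^α * (v/(k*A))^α * (1+w)^α - (A/A')^α * (v/(k*A))^α = (A/A')^α * (v/(k*A))^α * ((1+w)^α - 1) := by ring
  rw [e2, abs_mul, abs_of_pos (by positivity)]
  calc (A/A')^α * (v/(k*A))^α * |(1+w)^α - 1| ≤ 2^α * (v/(k*A))^α * (C * z) := by
        gcongr
        exact h1.trans (by gcongr)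
    _ ≤ _ := by
        have : 0 ≤ z * (v/(k*A))^α := by positivity
        nlinarith

noncomputable def tt (c m q : ℝ) : ℝ := (m+q)^c - m^c

lemma tt_bd (c : ℝ) (hc : 1 < c) (m q M : ℝ) (hM : 0 < M) (h1 : M ≤ m) (hq : 0 < q) : q * M^(c-1) ≤ tt c m q := by
  obtain ⟨ξ, h2, h3, h4⟩ := dif_rpow [q] (by intro h hh; simp at hh; linarith) c m (by linarith)
  simp [dif, dpo] at h2 h3 h4
  unfold tt
  rw [h4]
  have : M^(c-1) ≤ ξ^(c-1) := Real.rpow_le_rpow hM.le (by linarith) (by linarith)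
  have h0 : 0 ≤ M^(c-1) := by positivity
  calc q * M^(c-1) = q * 1 * M^(c-1) := by ring
    _ ≤ q * c * ξ^(c-1) := by gcongr

set_option maxHeartbeats 2000000 in
lemma left_core (c : ℝ) (hc : 1 < c) : ∃ C ≥ (1:ℝ), ∀ M Q P m q m' q' : ℝ, 0 < M → 0 < Q → C * Q ≤ M → 1 ≤ P →
    M ≤ m → m ≤ 2*M → M ≤ m' → m' ≤ 2*M → Q ≤ q → q ≤ 2*Q → Q ≤ q' → q' ≤ 2*Q →
    |tt c m q - tt c m' q'| ≤ Q * M^(c-1)/P →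
    |(q/q')^(1/(c-1)) - (2*m'+q')/(2*m+q)| ≤ C * (1/P + Q^2/M^2) := by
  obtain ⟨C1, hC1, h1⟩ := tnorm c hc
  have hα : 0 < 1/(c-1) := by apply one_div_pos.2; linarith
  obtain ⟨C2, hC2, h2⟩ := ratio_bd (1/(c-1)) hα
  set α := 1/(c-1) with hαd
  set B := (2:ℝ)^α with hB
  have hB0 : 0 < B := by positivity
  refine ⟨1 + 2*C1 + 2*B + 6 + 4*C1*(1+B) + 2*C2, by nlinarith [mul_pos hC1 hB0], ?_⟩
  set C0 := 1 + 2*C1 + 2*B + 6 + 4*C1*(1+B) + 2*C2 with hC0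
  intro M Q P m q m' q' hM hQ hQM hP a1 a2 a3 a4 b1 b2 b3 b4 hd
  have hCB : 0 < C1 * B := by positivity
  have hQM1 : Q ≤ M := by nlinarith
  have hq : 0 < q := by linarith
  have hq' : 0 < q' := by linarith
  have hb : 0 < 2*m+q := by linarith
  have hθ0 : 0 ≤ (q/q')^α := by positivity
  have hθ : (q/q')^α ≤ B := by
    apply Real.rpow_le_rpow (by positivity) _ hα.le
    rw [div_le_iff₀ hq']; linarith
  have hDn : 0 ≤ Q^2/M^2 := by positivity
  have hPn : 0 < 1/P := by positivity
  by_cases hP2 : P < 2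
  · have e1 : (2*m'+q')/(2*m+q) ≤ 3 := by rw [div_le_iff₀ hb]; linarith
    have e2 : 0 ≤ (2*m'+q')/(2*m+q) := by apply div_nonneg <;> linarith
    have e3 : 1/2 ≤ 1/P := by apply one_div_le_one_div_of_le <;> linarith
    have e4 : |(q/q')^α - (2*m'+q')/(2*m+q)| ≤ B + 3 := by rw [abs_le]; constructor <;> linarith
    refine e4.trans ?_
    have : B + 3 ≤ C0 * (1/2) := by rw [hC0]; linarith only [hC1, hC2, hB0, hCB]
    refine this.trans ?_
    have : 0 ≤ C0 := by rw [hC0]; linarith only [hC1, hC2, hB0, hCB]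
    gcongr; linarith
  · push Not at hP2
    have hz : 1/P ≤ 1/2 := one_div_le_one_div_of_le (by norm_num) hP2
    have t1 := tt_bd c hc m q M hM a1 hq
    have t2 := tt_bd c hc m' q' M hM a3 hq'
    have hMc : 0 < M^(c-1) := by positivity
    have tp1 : 0 < tt c m q := lt_of_lt_of_le (by positivity) t1
    have tp2 : 0 < tt c m' q' := lt_of_lt_of_le (by positivity) t2
    have hC1Q : ∀ m q, M ≤ m → q ≤ 2*Q → 0 < q → C1*q ≤ 2*m+q := by
      intro m q h h' h''
      have : C1 * q ≤ C1 * (2*Q) := by gcongr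
      nlinarith
    set k0 := c*2^(1-c) with hk0
    have hk0p : 0 < k0 := by rw [hk0]; positivity
    have r1 := h2 k0 q q' (tt c m q) (tt c m' q') (1/P) hk0p hq hq' tp1 tp2 (by linarith) hz (by
      rw [abs_sub_comm]; refine hd.trans ?_
      rw [div_eq_mul_one_div, mul_comm]
      gcongr
      exact (by gcongr : Q * M^(c-1) ≤ q * M^(c-1)).trans t1)
    have y1 := h1 m q (by linarith) hq (hC1Q m q a1 b2 hq)
    have y2 := h1 m' q' (by linarith) hq' (hC1Q m' q' a3 b4 hq')
    change |(tt c m q/(k0*q))^α - (2*m+q)| ≤ _ at y1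
    change |(tt c m' q'/(k0*q'))^α - (2*m'+q')| ≤ _ at y2
    set y := (tt c m q/(k0*q))^α
    set y' := (tt c m' q'/(k0*q'))^α
    set θ := (q/q')^α
    set b := 2*m+q
    set b' := 2*m'+q'
    have w1 : C1*q^2/b ≤ b := by
      rw [div_le_iff₀ hb]
      have := hC1Q m q a1 b2 hq
      have h3 : q ≤ b := by linarith
      calc C1*q^2 = (C1*q)*q := by ring
        _ ≤ b*b := mul_le_mul this h3 hq.le hb.le
    have w2 : ∀ m q, M ≤ m → 0 < q → q ≤ 2*Q → C1*q^2/(2*m+q) ≤ 2*C1*Q^2/M := by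
      intro m q h h' h''
      rw [div_le_div_iff₀ (by linarith) hM]
      have e1 : q^2 ≤ 4*Q^2 := (pow_le_pow_left₀ h'.le h'' 2).trans_eq (by ring)
      have : 0 ≤ C1 * Q^2 := by positivity
      calc C1 * q^2*M ≤ C1 * (4*Q^2) * M := by gcongr
        _ ≤ _ := by have := mul_le_mul_of_nonneg_left (by linarith : 4*M ≤ 2*(2*m+q)) this; linarith only [this]
    have w3 := w2 m q a1 hq b2
    have w4 := w2 m' q' a3 hq' b4
    have hyb : y ≤ 2*b := by linarith [(abs_le.1 y1).2]
    have f1 : |θ*b - b'| ≤ 2*C1*Q^2/M + C2*(1/P)*(2*b) + B * (2*C1*Q^2/M) := by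
      have : θ*b - b' = (y' - b') - (y' - θ*y) - θ*(y - b) := by ring
      rw [this]
      refine (abs_sub _ _).trans ?_
      refine add_le_add ((abs_sub _ _).trans (add_le_add (y2.trans w4) (r1.trans ?_))) ?_
      · gcongr
      · rw [abs_mul, abs_of_nonneg hθ0]
        exact mul_le_mul hθ (y1.trans w3) (abs_nonneg _) hB0.le
    have f2 : θ - b'/b = (θ*b - b')/b := by field_simp
    rw [f2, abs_div, abs_of_pos hb, div_le_iff₀ hb]
    refine f1.trans ?_
    have f3 : Q^2/M ≤ Q^2/M^2*b := by
      have : Q^2/M = Q^2/M^2*M := by field_simp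
      rw [this]; gcongr; linarith
    have g1 : 2*C1*Q^2/M ≤ 2*C1*(Q^2/M^2*b) := by
      rw [mul_div_assoc]; gcongr
    have g2 : B * (2*C1*Q^2/M) ≤ B * (2*C1*(Q^2/M^2*b)) := by gcongr
    have s1 : 0 ≤ Q^2/M^2*b := by positivity
    have s2 : 0 ≤ 1/P * b := by positivity
    have s3 : 0 ≤ C1 * (1/P*b) := by positivity
    have s4 : 0 ≤ B * (1/P*b) := by positivity
    have s5 : 0 ≤ C1 * B * (1/P*b) := by positivity
    have s6 : 0 ≤ C1 * (Q^2/M^2*b) := by positivity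
    have s7 : 0 ≤ B * (Q^2/M^2*b) := by positivity
    have s8 : 0 ≤ C1 * B * (Q^2/M^2*b) := by positivity
    have s9 : 0 ≤ C2 * (Q^2/M^2*b) := by positivity
    have hr : C0 * (1/P + Q^2/M^2) * b = (7 + 2*C1 + 2*B + 4*C1 + 4*(C1*B) + 2*C2) * (1/P*b) + (7 + 2*C1 + 2*B + 4*C1 + 4*(C1*B) + 2*C2) * (Q^2/M^2*b) := by
      rw [hC0]; ring
    rw [hr]
    linarith

lemma log_helper (x y : ℝ) (hx : 1 ≤ x) (hxy : x ≤ 7 * y) (hy : 1 ≤ y) : 1 + Real.log x ≤ 3 * (1 + Real.log y) := by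
  have h1 : Real.log x ≤ Real.log (7*y) := Real.log_le_log (by linarith) hxy
  rw [Real.log_mul (by norm_num) (by linarith)] at h1
  have h2 : Real.log 7 ≤ 2 := by
    have : Real.log 7 < 2 := by
      rw [Real.log_lt_iff_lt_exp (by norm_num)]
      have := Real.exp_one_gt_d9
      have h : Real.exp 2 = Real.exp 1 * Real.exp 1 := by rw [← Real.exp_add]; norm_num
      rw [h]; nlinarith
    linarith
  have := Real.log_nonneg hy
  linarith

lemma left_count (c : ℝ) (hc : 1 < c) : ∃ C ≥ (1:ℝ), ∀ (M : ℝ) (Q : ℕ) (P : ℝ) (W : Finset ((ℕ×ℕ)×(ℕ×ℕ))), 1 ≤ M → 0 < Q → C * Q ≤ M → 1 ≤ P →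
    (∀ p ∈ W, (Q ≤ p.1.1 ∧ p.1.1 ≤ 2*Q ∧ M ≤ p.1.2 ∧ p.1.2 ≤ 2*M) ∧ (Q ≤ p.2.1 ∧ p.2.1 ≤ 2*Q ∧ M ≤ p.2.2 ∧ p.2.2 ≤ 2*M) ∧
      |tt c p.1.2 p.1.1 - tt c p.2.2 p.2.1| ≤ Q * M^(c-1)/P) →
    (W.card : ℝ) ≤ C * (Q * M + (Q*M)^2 * (1/P + Q^2/M^2)) * (1 + Real.log M)^2 := by
  obtain ⟨C1, hC1, h1⟩ := left_core c hc
  have hα : 0 < 1/(c-1) := by apply one_div_pos.2; linarith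
  obtain ⟨C2, hC2, h2⟩ := gcount (1/(c-1)) hα
  have h12 : 1 ≤ C1 * C2 := by nlinarith
  refine ⟨1296 * (C1 * C2), by linarith, ?_⟩
  intro M Q P W hM hQ hQM hP hW
  have hQ' : (1:ℝ) ≤ Q := by exact_mod_cast hQ
  have hQMl : 6 * (Q:ℝ) ≤ M := by nlinarith
  have hQM1 : C1 * (Q:ℝ) ≤ M := by
    refine le_trans ?_ hQM
    gcongr
    nlinarith
  set D := C1 * (1/P + (Q:ℝ)^2/M^2) with hD
  have hD0 : 0 ≤ D := by positivity
  set B := ⌊5*M⌋₊ with hB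
  have hB1 : (B:ℝ) ≤ 5*M := Nat.floor_le (by linarith)
  have hB0 : 0 < B := by rw [hB, Nat.floor_pos]; linarith
  have hcard : W.card ≤ (gset (1/(c-1)) (2*Q) B D).card := by
    apply Finset.card_le_card_of_injOn (fun p => ((p.1.1, p.2.1), (2*p.1.2+p.1.1, 2*p.2.2+p.2.1)))
    · intro p hp
      obtain ⟨⟨a1,a2,a3,a4⟩,⟨b1,b2,b3,b4⟩,h⟩ := hW p hp
      have e1 : (p.1.1:ℝ) ≤ 2*Q := by exact_mod_cast a2
      have e2 : (p.2.1:ℝ) ≤ 2*Q := by exact_mod_cast b2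
      have e3 : (Q:ℝ) ≤ p.1.1 := by exact_mod_cast a1
      have e4 : (Q:ℝ) ≤ p.2.1 := by exact_mod_cast b1
      rw [mem_coe, mem_gset]
      refine ⟨⟨⟨by simp only; omega, by simp only; omega⟩, ⟨by simp only; omega, by simp only; omega⟩⟩, ⟨⟨by simp only; omega, ?_⟩, ⟨by simp only; omega, ?_⟩⟩, by simp only; omega, by simp only; omega, ?_⟩
      · apply Nat.le_floor; push_cast; linarith
      · apply Nat.le_floor; push_cast; linarith
      · push_cast
        exact h1 M Q P p.1.2 p.1.1 p.2.2 p.2.1 (by linarith) (by linarith) hQM1 hP a3 a4 b3 b4 e3 e1 e4 e2 h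
    · intro p hp p' hp' heq
      simp only [Prod.mk.injEq] at heq
      obtain ⟨⟨e1,e2⟩,e3,e4⟩ := heq
      ext <;> omega
  have hg := h2 (2*Q) B D hD0 (by omega) hB0
  have hW1 : (W.card : ℝ) ≤ (gset (1/(c-1)) (2*Q) B D).card := by exact_mod_cast hcard
  refine hW1.trans (hg.trans ?_)
  have hl0 := Real.log_nonneg hM
  have l1 : 1 + Real.log ((2*Q:ℕ):ℝ) ≤ 3 * (1 + Real.log M) := by
    apply log_helper _ _ (by push_cast; linarith) (by push_cast; linarith) hM
  have l2 : 1 + Real.log (B:ℝ) ≤ 3 * (1 + Real.log M) := by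
    apply log_helper _ _ (by exact_mod_cast hB0) (by linarith) hM
  have l20 : 0 ≤ 1 + Real.log (B:ℝ) := by
    have := Real.log_nonneg (by exact_mod_cast hB0 : (1:ℝ) ≤ B); linarith
  have m1 : ((2*Q:ℕ):ℝ) * B + D * ((2*Q:ℕ):ℝ)^2 * (B:ℝ)^2 ≤ C1 * (100 * (Q * M + (Q*M)^2 * (1/P + Q^2/M^2))) := by
    have i1 : ((2*Q:ℕ):ℝ) * B ≤ 10 * (Q*M) := by
      push_cast
      calc 2 * (Q:ℝ) * B ≤ 2 * Q * (5*M) := by gcongr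
        _ = _ := by ring
    have i2 : D * ((2*Q:ℕ):ℝ)^2 * (B:ℝ)^2 ≤ D * (100 * (Q*M)^2) := by
      have : ((2*Q:ℕ):ℝ)^2 * (B:ℝ)^2 ≤ 100 * (Q*M)^2 := by
        rw [← mul_pow]
        calc (((2*Q:ℕ):ℝ) * B)^2 ≤ (10 * (Q*M))^2 := by gcongr
          _ = _ := by ring
      rw [mul_assoc]; gcongr
    have i3 : D * (100 * (Q*M)^2) = C1 * (100 * ((Q*M)^2 * (1/P + Q^2/M^2))) := by rw [hD]; ring
    have i4 : (Q*M:ℝ) ≤ C1 * (Q*M) := le_mul_of_one_le_left (by positivity) hC1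
    have i5 : 0 ≤ (Q*M:ℝ) := by positivity
    linarith
  have hE0 : 0 ≤ Q * M + (Q*M)^2 * (1/P + Q^2/M^2) := by positivity
  calc _ ≤ C2 * (C1 * (100 * (Q * M + (Q*M)^2 * (1/P + Q^2/M^2)))) * (3 * (1 + Real.log M)) * (3 * (1 + Real.log M)) := by
        gcongr
    _ ≤ _ := by
        have : 0 ≤ C1 * C2 * ((Q * M + (Q*M)^2 * (1/P + Q^2/M^2)) * (1+Real.log M)^2) := by positivity
        linarith only [this]

lemma right_alg (b b' θ ρ ρ' κ y y' N w B E G : ℝ) (hN : 0 < N) (hw : 0 ≤ w) (hwN : w ≤ N) (hB : 1 ≤ B)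
    (hb : 2*N ≤ b) (hb' : 2*N ≤ b') (hθ : 1 ≤ B * θ) (hθ2 : θ ≤ B) (hρ0 : 0 ≤ ρ) (hρ : ρ ≤ 2*w^2) (hρ0' : 0 ≤ ρ') (hρ' : ρ' ≤ 2*w^2)
    (hκ : |κ| ≤ 1) (h1 : |y - (b + κ*ρ/b)| ≤ E) (h2 : |y' - (b' + κ*ρ'/b')| ≤ E) (h3 : |y' - θ*y| ≤ G) :
    |b' - θ*b - κ*(θ*ρ - ρ'/θ)/b| ≤ (1+B)*(E*(1+B)+G) + B*(1+B)*(w^4/N^3) := by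
  have hb0 : 0 < b := by linarith
  have hb0' : 0 < b' := by linarith
  have hθ0 : 0 < θ := by by_contra h; push Not at h; nlinarith
  set e0 := b' + κ*ρ'/b' - θ*(b + κ*ρ/b) with he0
  have hE : 0 ≤ E := (abs_nonneg _).trans h1
  have hG : 0 ≤ G := (abs_nonneg _).trans h3
  have b0 : |e0| ≤ E*(1+B)+G := by
    have : e0 = -(y' - (b' + κ*ρ'/b')) + (y' - θ*y) + θ*(y - (b + κ*ρ/b)) := by rw [he0]; ring
    rw [this]
    refine (abs_add_le _ _).trans ?_
    have i1 := abs_add_le (-(y' - (b' + κ*ρ'/b'))) (y' - θ*y)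
    rw [abs_neg] at i1
    have i2 : |θ*(y - (b + κ*ρ/b))| ≤ B * E := by
      rw [abs_mul, abs_of_pos hθ0]; gcongr
    linarith
  set e1 := E*(1+B)+G
  have d0 : ∀ r t : ℝ, 0 ≤ r → r ≤ 2*w^2 → 2*N ≤ t → |κ*r/t| ≤ w^2/N := by
    intro r t hr hr2 ht
    rw [abs_div, abs_mul, abs_of_nonneg hr, abs_of_pos (by linarith : 0 < t), div_le_div_iff₀ (by linarith) hN]
    have : |κ| * r ≤ 1*(2*w^2) := by gcongr
    calc |κ| * r*N ≤ 1*(2*w^2)*N := by gcongr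
      _ = w^2*(2*N) := by ring
      _ ≤ w^2*t := by gcongr
  have b1 : |θ*b - b'| ≤ e1 + (1+B)*(w^2/N) := by
    have : θ*b - b' = -e0 + κ*ρ'/b' - θ*(κ*ρ/b) := by rw [he0]; ring
    rw [this]
    refine (abs_sub _ _).trans ?_
    have i1 := abs_add_le (-e0) (κ*ρ'/b')
    rw [abs_neg] at i1
    have i2 := d0 ρ' b' hρ0' hρ' hb'
    have i3 : |θ*(κ*ρ/b)| ≤ B * (w^2/N) := by
      rw [abs_mul, abs_of_pos hθ0]; gcongr; exact d0 ρ b hρ0 hρ hb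
    linarith
  have b2 : b' - θ*b - κ*(θ*ρ - ρ'/θ)/b = e0 - κ*ρ'/b' * ((θ*b - b')/(θ*b)) := by
    rw [he0]; field_simp; ring
  rw [b2]
  refine (abs_sub _ _).trans ?_
  have hθb : 2*N/B ≤ θ*b := by
    rw [div_le_iff₀ (by linarith)]
    calc 2*N ≤ b := hb
      _ = 1 * b := by ring
      _ ≤ B*θ*b := by gcongr
      _ = _ := by ring
  have b3 : |κ*ρ'/b' * ((θ*b - b')/(θ*b))| ≤ (w^2/N) * ((e1 + (1+B)*(w^2/N))/(2*N/B)) := by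
    rw [abs_mul, abs_div (θ*b - b'), abs_of_pos (mul_pos hθ0 hb0)]
    have he1 : 0 ≤ e1 := (abs_nonneg _).trans b0
    gcongr
    exact d0 ρ' b' hρ0' hρ' hb'
  have b4 : (w^2/N) * ((e1 + (1+B)*(w^2/N))/(2*N/B)) = B/2 * ((w/N)^2*e1) + B/2*(1+B)*(w^4/N^3) := by
    field_simp
  have he1 : 0 ≤ e1 := (abs_nonneg _).trans b0
  have b5 : (w/N)^2*e1 ≤ e1 := by
    apply mul_le_of_le_one_left he1
    apply pow_le_one₀ (by positivity)
    rw [div_le_one hN]; exact hwN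
  have b6 : 0 ≤ B*(1+B)*(w^4/N^3) := by positivity
  have b7 : B/2 * ((w/N)^2*e1) ≤ B/2*e1 := by gcongr
  have b8 : 0 ≤ B*e1 := by positivity
  have : B/2*(1+B)*(w^4/N^3) = (B*(1+B)*(w^4/N^3))/2 := by ring
  linarith

noncomputable def ss (c n r s : ℝ) : ℝ := (n+r+s)^c-(n+r)^c-(n+s)^c+n^c

lemma ss_bd (c : ℝ) (hc : 2 < c) (n r s N : ℝ) (hN : 0 < N) (h1 : N ≤ n) (hr : 0 < r) (hs : 0 < s) : r * s * N^(c-2) ≤ ss c n r s := by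
  obtain ⟨ξ, h2, h3, h4⟩ := dif_rpow [r, s] (by intro h hh; simp at hh; rcases hh with h | h <;> linarith) c n (by linarith)
  simp [dif, dpo] at h2 h3 h4
  have e1 : ss c n r s = (n + r + s) ^ c - (n + r) ^ c - ((n + s) ^ c - n ^ c) := by unfold ss; ring
  rw [e1, h4]
  have : N^(c-2) ≤ ξ^(c-2) := Real.rpow_le_rpow hN.le (by linarith) (by linarith)
  have h0 : 0 ≤ N^(c-2) := by positivity
  have hcc : 1 ≤ c*(c-1) := by nlinarith
  calc r*s * N^(c-2) = r*s * 1 * N^(c-2) := by ring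
    _ ≤ r*s * (c*(c-1)) * ξ^(c-2) := by gcongr

lemma right_core (c : ℝ) (hc : 2 < c) (hc3 : c < 3) : ∃ C ≥ (1:ℝ), ∀ N w R P n r s n' r' s' : ℝ, 0 < N → C * w ≤ N → 0 < R → 2 ≤ P →
    N ≤ n → n ≤ 2*N → N ≤ n' → n' ≤ 2*N → 0 < r → 0 < s → 0 < r' → 0 < s' → r ≤ w → s ≤ w → r' ≤ w → s' ≤ w →
    R ≤ r*s → r*s ≤ 2*R → R ≤ r'*s' → r'*s' ≤ 2*R →
    |ss c n r s - ss c n' r' s'| ≤ R * N^(c-2)/P →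
    |(2*n'+r'+s') - ((r*s)/(r'*s'))^(1/(c-2))*(2*n+r+s) -
      (c-3)/6*(((r*s)/(r'*s'))^(1/(c-2))*(r^2+s^2) - (r'^2+s'^2)/((r*s)/(r'*s'))^(1/(c-2)))/(2*n+r+s)| ≤ C * (N/P + w^4/N^3) := by
  obtain ⟨C1, hC1, h1⟩ := snorm c hc
  have hα : 0 < 1/(c-2) := by apply one_div_pos.2; linarith
  obtain ⟨C2, hC2, h2⟩ := ratio_bd (1/(c-2)) hα
  set α := 1/(c-2) with hαd
  set B := (2:ℝ)^α with hB
  have hB1 : 1 ≤ B := Real.one_le_rpow (by norm_num) hα.le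
  have hfin : 1 ≤ 4*C1 + (1+B)*(C1*(1+B)+16*C2) + B*(1+B) := by
    have : 0 ≤ (1+B)*(C1*(1+B)+16*C2) + B*(1+B) := by positivity
    linarith
  refine ⟨4*C1 + (1+B)*(C1*(1+B)+16*C2) + B*(1+B), hfin, ?_⟩
  intro N w R P n r s n' r' s' hN hwN hR hP a1 a2 a3 a4 hr hs hr' hs' b1 b2 b3 b4 d1 d2 d3 d4 hd
  have hw0 : 0 < w := by linarith
  have hwN1 : 4 * C1 * w ≤ N := by
    refine le_trans ?_ hwN
    have : 0 ≤ ((1+B)*(C1*(1+B)+16*C2) + B*(1+B)) * w := by positivity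
    linarith
  have hwN2 : 4 * w ≤ N := by
    have : 4 * 1 * w ≤ 4 * C1 * w := by gcongr
    linarith
  have hC1w : C1 * w ≤ N := by
    have : 0 ≤ C1 * w := by positivity
    linarith
  clear_value B
  have v1 := ss_bd c hc n r s N hN a1 hr hs
  have v2 := ss_bd c hc n' r' s' N hN a3 hr' hs'
  have hNc : 0 < N^(c-2) := by positivity
  have vp1 : 0 < ss c n r s := lt_of_lt_of_le (by positivity) v1
  have vp2 : 0 < ss c n' r' s' := lt_of_lt_of_le (by positivity) v2
  set k0 := c*(c-1)*2^(2-c) with hk0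
  have hk0p : 0 < k0 := by
    rw [hk0]; have : 0 < c - 1 := by linarith
    positivity
  have hz : 1/P ≤ 1/2 := one_div_le_one_div_of_le (by norm_num) hP
  have r1 := h2 k0 (r*s) (r'*s') (ss c n r s) (ss c n' r' s') (1/P) hk0p (by positivity) (by positivity) vp1 vp2 (by linarith) hz (by
      rw [abs_sub_comm]; refine hd.trans ?_
      rw [div_eq_mul_one_div, mul_comm]
      gcongr
      exact (by gcongr : R * N^(c-2) ≤ r*s * N^(c-2)).trans v1)
  have y1 := h1 n r s w (by linarith) hr hs b1 b2 (by linarith)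
  have y2 := h1 n' r' s' w (by linarith) hr' hs' b3 b4 (by linarith)
  change |(ss c n r s/(k0*(r*s)))^α - _| ≤ _ at y1
  change |(ss c n' r' s'/(k0*(r'*s')))^α - _| ≤ _ at y2
  have q1 : 1 ≤ B * ((r*s)/(r'*s'))^α := by
    rw [hB, ← Real.mul_rpow (by norm_num) (by positivity)]
    apply Real.one_le_rpow _ hα.le
    rw [← mul_div_assoc, le_div_iff₀ (by positivity)]; linarith
  have q2 : ((r*s)/(r'*s'))^α ≤ B := by
    rw [hB]
    apply Real.rpow_le_rpow (by positivity) _ hα.le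
    rw [div_le_iff₀ (by positivity)]; linarith
  have hk : |(c-3)/6| ≤ 1 := by rw [abs_le]; constructor <;> linarith
  generalize (ss c n r s/(k0*(r*s)))^α = y at *
  generalize (ss c n' r' s'/(k0*(r'*s')))^α = y' at *
  generalize ((r*s)/(r'*s'))^α = θ at *
  have p1 : 2*N ≤ 2*n+r+s := by linarith
  have p2 : 2*n+r+s ≤ 6*N := by linarith
  have p1' : 2*N ≤ 2*n'+r'+s' := by linarith
  have rb : ∀ r s : ℝ, 0 < r → 0 < s → r ≤ w → s ≤ w → r^2+s^2 ≤ 2*w^2 := by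
    intro r s h1 h2 h3 h4
    have : r^2 ≤ w^2 := by gcongr
    have : s^2 ≤ w^2 := by gcongr
    linarith
  have eb : ∀ b : ℝ, 2*N ≤ b → C1*w^4/b^3 ≤ C1*(w^4/N^3) := by
    intro b hb
    rw [mul_div_assoc]
    have : N ≤ b := by linarith
    gcongr
  have y1' := y1.trans (eb _ p1)
  have y2' := y2.trans (eb _ p1')
  have s1 : w^4/N^3 ≤ w := by
    rw [div_le_iff₀ (by positivity)]
    have : w ≤ N := by linarith
    calc w^4 = w * w^3 := by ring
      _ ≤ w * N^3 := by gcongr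
  have s2 : |(c-3)/6*(r^2+s^2)/(2*n+r+s)| ≤ w := by
    rw [abs_div, abs_mul, abs_of_pos (by positivity : 0 < r^2+s^2), abs_of_pos (by linarith : 0 < 2*n+r+s), div_le_iff₀ (by linarith)]
    calc |(c-3)/6| * (r^2+s^2) ≤ 1 * (2*w^2) := by
          gcongr; exact rb r s hr hs b1 b2
      _ = w*(2*w) := by ring
      _ ≤ w * (2*n+r+s) := by gcongr; linarith
  have hyb : y ≤ 16*N := by
    have t1 := (abs_le.1 y1').2
    have t2 := (abs_le.1 s2).2
    have t3 : C1*(w^4/N^3) ≤ C1*w := by gcongr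
    linarith
  have r1' : |y' - θ*y| ≤ 16*C2*(N/P) := by
    refine r1.trans ?_
    calc C2*(1/P)*y ≤ C2*(1/P)*(16*N) := by gcongr
      _ = _ := by ring
  have fin := right_alg (2*n+r+s) (2*n'+r'+s') θ (r^2+s^2) (r'^2+s'^2) ((c-3)/6) y y' N w B _ _ hN hw0.le (by linarith) hB1 p1 p1' q1 q2
    (by positivity) (rb r s hr hs b1 b2) (by positivity) (rb r' s' hr' hs' b3 b4) hk y1' y2' r1'
  refine fin.trans ?_
  have u1 : 0 ≤ w^4/N^3 := by positivity
  have u2 : 0 ≤ N/P := by positivity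
  have u3 : 0 ≤ 4*C1*(N/P + w^4/N^3) := by positivity
  have u4 : 0 ≤ ((1+B)*(C1*(1+B)) + B*(1+B))*(N/P) := by positivity
  have u5 : 0 ≤ (1+B)*(16*C2)*(w^4/N^3) := by positivity
  have u6 : (4*C1 + (1+B)*(C1*(1+B)+16*C2) + B*(1+B)) * (N/P + w^4/N^3) = (1 + B) * (C1 * (w ^ 4 / N ^ 3) * (1 + B) + 16 * C2 * (N / P)) + B * (1 + B) * (w ^ 4 / N ^ 3) + 4*C1*(N/P + w^4/N^3) + ((1+B)*(C1*(1+B)) + B*(1+B))*(N/P) + (1+B)*(16*C2)*(w^4/N^3) := by ring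
  linarith

lemma min_dy (m s ε : ℝ) (hε : 0 < ε) (hm0 : 0 ≤ m) (hm : m ≤ 1) (hs : m * s ≤ ε) (J : ℕ) :
    m ≤ (∑ j ∈ range J, if s ≤ 4 * 2^j * ε then ((1/2:ℝ))^j else 0) + (1/2)^J := by
  induction J with
  | zero => simpa using hm
  | succ J ih =>
    rw [Finset.sum_range_succ]
    have hp : (0:ℝ) < (1/2)^J := by positivity
    split_ifs with h
    · rw [pow_succ]; linarith
    · push Not at h
      have h0 : 0 ≤ (∑ j ∈ range J, if s ≤ 4 * 2^j * ε then ((1/2:ℝ))^j else 0) := by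
        apply Finset.sum_nonneg; intro j _; split_ifs <;> positivity
      have h2 : m * (4 * 2^J * ε) ≤ ε := (mul_le_mul_of_nonneg_left h.le hm0).trans hs
      have h3 : m * (4 * 2^J) ≤ 1 := by
        by_contra hc; push Not at hc
        nlinarith
      have h4 : m * 2^J * (1/2)^J = m := by rw [mul_assoc, ← mul_pow]; norm_num
      rw [pow_succ]
      nlinarith

noncomputable def hset (K I : ℕ) (θ T : ℝ) : Finset (ℕ × ℕ) :=
  open scoped Classical in
  ((Ico (2^I) (2^(I+1))) ×ˢ (Ioc 0 (K * 2^(I+1)))).filter (fun q => |θ * q.1 - q.2| ≤ T)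

lemma mem_hset (K I : ℕ) (θ T : ℝ) (q : ℕ × ℕ) : q ∈ hset K I θ T ↔ (2^I ≤ q.1 ∧ q.1 < 2^(I+1)) ∧ (0 < q.2 ∧ q.2 ≤ K * 2^(I+1)) ∧ |θ * q.1 - q.2| ≤ T := by
  unfold hset
  simp only [mem_filter, mem_product, mem_Ico, mem_Ioc]
  tauto

/-- points b in Sol with next solution at b+l -/
noncomputable def gapset (Sol : Finset ℕ) (f : ℕ → ℕ) (l l' : ℕ) : Finset ℕ :=
  open scoped Classical in
  Sol.filter (fun b => b + l ∈ Sol ∧ (∀ x ∈ Sol, b < x → b + l ≤ x) ∧ f (b+l) = f b + l')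

lemma gap_pair (N θ κ ε : ℝ) (hN : 0 < N) (hε : 0 < ε) (Sol : Finset ℕ) (f : ℕ → ℕ) 
    (h1 : ∀ b ∈ Sol, N ≤ (b:ℝ) ∧ (b:ℝ) ≤ 8*N ∧ |(f b:ℝ) - θ*b - κ/b| ≤ ε) (l l' : ℕ) (hl : 0 < l) :
    ∃ m : ℝ, 0 ≤ m ∧ m ≤ 1 ∧ m * |θ*l-l'| ≤ ε ∧ ((gapset Sol f l l').card : ℝ) ≤ 1 + 64*(N/l)*m := by
  have hl' : (0:ℝ) < l := by exact_mod_cast hl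
  set G := gapset Sol f l l' with hG
  have memG : ∀ b ∈ G, b ∈ Sol ∧ b + l ∈ Sol ∧ (∀ x ∈ Sol, b < x → b + l ≤ x) ∧ f (b+l) = f b + l' := by
    intro b hb; rw [hG, gapset, mem_filter] at hb; exact hb
  have hsp : ∀ i ∈ G, ∀ j ∈ G, i ≠ j → (l:ℝ) ≤ |((i:ℕ):ℝ) - j| := by
    have : ∀ i ∈ G, ∀ j ∈ G, i < j → (l:ℝ) ≤ |((i:ℕ):ℝ) - j| := by
      intro i hi j hj hij
      have h3 := (memG i hi).2.2.1 j (memG j hj).1 hij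
      have h4 : (i:ℝ) + l ≤ j := by exact_mod_cast h3
      rw [abs_sub_comm, abs_of_nonneg (by linarith)]; linarith
    intro i hi j hj hij
    rcases lt_or_gt_of_ne hij with h | h
    · exact this i hi j hj h
    · rw [abs_sub_comm]; exact this j hj i hi h
  have hs : ∀ b ∈ G, |(θ*l-l') - κ*l*(1/((b:ℝ)*(b+l)))| ≤ 2*ε := by
    intro b hb
    obtain ⟨a1, a2, a3, a4⟩ := memG b hb
    obtain ⟨b1, b2, b3⟩ := h1 b a1
    obtain ⟨d1, d2, d3⟩ := h1 _ a2
    rw [a4] at d3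
    push_cast at d3 d1 d2
    have hb0 : (0:ℝ) < b := by linarith
    have hbl : (0:ℝ) < b + l := by linarith
    have e1 : (θ*l-l') - κ*l*(1/((b:ℝ)*(b+l))) = ((f b:ℝ) - θ*b - κ/b) - ((f b:ℝ) + l' - θ*(b+l) - κ/(b+l)) := by
      field_simp; ring
    rw [e1]
    refine (abs_sub _ _).trans ?_
    linarith
  by_cases hσ : |θ*l-l'| ≤ 4*ε
  · refine ⟨1/4, by norm_num, by norm_num, by linarith, ?_⟩
    have := spaced G (fun b => (b:ℝ)) N (7*N) l hl' (by linarith) (by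
      intro b hb; obtain ⟨b1, b2, _⟩ := h1 b (memG b hb).1
      constructor <;> linarith) hsp
    refine this.trans ?_
    have e0 : 0 < N/l := by positivity
    have : 7*N/l = 7*(N/l) := by ring
    rw [this]; linarith
  · push Not at hσ
    have hσ0 : 0 < |θ*l-l'| := by linarith
    refine ⟨ε/|θ*l-l'|, by positivity, by rw [div_le_one hσ0]; linarith, by rw [div_mul_cancel₀ _ hσ0.ne'], ?_⟩
    rcases G.eq_empty_or_nonempty with he | hne
    · rw [he]; simp; positivity
    have hkey : ∀ i ∈ G, ∀ j ∈ G, i < j → (j:ℝ) - i ≤ 64*N*(ε/|θ*l-l'|) := by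
      intro i hi j hj hij
      have s1 := hs i hi
      have s2 := hs j hj
      have hij' : (i:ℝ) < j := by exact_mod_cast hij
      obtain ⟨b1, b2, _⟩ := h1 i (memG i hi).1
      obtain ⟨d1, d2, _⟩ := h1 j (memG j hj).1
      set s := θ*l-l'
      have hi0 : (0:ℝ) < i := by linarith
      have hj0 : (0:ℝ) < j := by linarith
      set g1 := 1/((i:ℝ)*(i+l)) with hg1
      set g2 := 1/((j:ℝ)*(j+l)) with hg2
      have hg10 : 0 < g1 := by positivity
      have t1 : |s|/2 ≤ |κ*l| * g1 := by
        have : |s| ≤ |s - κ*l*g1| + |κ*l*g1| := by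
          have := abs_add_le (s - κ*l*g1) (κ*l*g1); simpa using this
        rw [abs_mul (κ*l), abs_of_pos hg10] at this
        linarith
      have t2 : |κ*l| * |g1 - g2| ≤ 4*ε := by
        rw [← abs_mul]
        have : κ*l*(g1-g2) = (s - κ*l*g2) - (s - κ*l*g1) := by ring
        rw [this]
        refine (abs_sub _ _).trans ?_
        linarith
      have t3 : g1 * ((j-i)/(8*N)) ≤ g1 - g2 := by
        have : g2 ≤ g1 * (i/j) := by
          rw [hg1, hg2, ← mul_div_assoc, div_mul_eq_mul_div, one_mul, div_div, div_le_div_iff₀ (by positivity) (by positivity)]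
          have : (0:ℝ) ≤ i * j * (j - i) := mul_nonneg (by positivity) (by linarith)
          nlinarith
        have h5 : (j-i)/(8*N) ≤ 1 - (i:ℝ)/j := by
          have : 1 - (i:ℝ)/j = (j-i)/j := by field_simp
          rw [this]
          apply div_le_div_of_nonneg_left _ hj0 d2
          linarith
        calc g1 * ((j-i)/(8*N)) ≤ g1 * (1 - (i:ℝ)/j) := by gcongr
          _ = g1 - g1*(i/j) := by ring
          _ ≤ _ := by linarith
      have t4 : |s|/2 * ((j-i)/(8*N)) ≤ 4*ε := by
        have hji : 0 ≤ ((j:ℝ)-i)/(8*N) := by apply div_nonneg <;> linarith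
        calc |s|/2 * ((j-i)/(8*N)) ≤ |κ*l| * g1 * ((j-i)/(8*N)) := by gcongr
          _ = |κ*l| * (g1 * ((j-i)/(8*N))) := by ring
          _ ≤ |κ*l| * |g1 - g2| := by gcongr; exact t3.trans (le_abs_self _)
          _ ≤ _ := t2
      have e1 : |s|/2 * ((j-i)/(8*N)) = (|s| * (j - i))/(16*N) := by field_simp; ring
      rw [e1, div_le_iff₀ (by positivity)] at t4
      rw [mul_div_assoc', le_div_iff₀ hσ0]
      linarith
    have := spaced G (fun b => (b:ℝ)) (G.min' hne) (64*N*(ε/|θ*l-l'|)) l hl' (by positivity) (by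
      intro b hb
      have hle := G.min'_le b hb
      have hle' : ((G.min' hne : ℕ):ℝ) ≤ b := by exact_mod_cast hle
      refine ⟨hle', ?_⟩
      rcases hle.eq_or_lt with h | h
      · rw [← h]; have : 0 ≤ 64*N*(ε/|θ*l-l'|) := by positivity
        linarith
      · have := hkey _ (G.min'_mem hne) b hb h; linarith) hsp
    refine this.trans (le_of_eq ?_)
    ring

lemma gap_count (N θ κ ε Bt : ℝ) (K I J : ℕ) (hN : 0 < N) (hε : 0 < ε) (hJ : N ≤ 2^J) (hBt : 1 ≤ Bt) (hK : Bt + 1 ≤ K) (hθ : 1 ≤ Bt * θ) (hθ2 : θ ≤ Bt)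
    (hε2 : 8 * Bt * ε ≤ 1) (W : ℝ) (hW : |κ| ≤ W) (hW2 : 8 * Bt * W ≤ N^2) (Sol : Finset ℕ) (f : ℕ → ℕ) 
    (h1 : ∀ b ∈ Sol, N ≤ (b:ℝ) ∧ (b:ℝ) ≤ 8*N ∧ |(f b:ℝ) - θ*b - κ/b| ≤ ε) :
    (Sol.card : ℝ) ≤ 1 + 7*N/2^I + ∑ i ∈ range I, (65 * ((hset K i θ (2*ε + W*2^(i+1)/N^2)).card : ℝ) + 
        64 * (N/2^i) * ∑ j ∈ range J, (1/2:ℝ)^j * ((hset K i θ (4*2^j*ε)).card : ℝ)) := by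
  classical
  set Big := Sol.filter (fun b => ∀ x ∈ Sol, b < x → b + 2^I ≤ x) with hBig
  have hbig : (Big.card : ℝ) ≤ 1 + 7*N/2^I := by
    apply spaced Big (fun b => (b:ℝ)) N (7*N) (2^I) (by positivity) (by linarith)
    · intro b hb; rw [hBig, mem_filter] at hb
      obtain ⟨b1, b2, _⟩ := h1 b hb.1
      constructor <;> linarith
    · have : ∀ i ∈ Big, ∀ j ∈ Big, i < j → (2^I:ℝ) ≤ |((i:ℕ):ℝ) - j| := by
        intro i hi j hj hij
        rw [hBig, mem_filter] at hi hj
        have h4 : (i:ℝ) + 2^I ≤ j := by exact_mod_cast hi.2 j hj.1 hij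
        have h5 : (0:ℝ) < 2^I := by positivity
        rw [abs_sub_comm, abs_of_nonneg (by linarith)]; linarith
      intro i hi j hj hij
      rcases lt_or_gt_of_ne hij with h | h
      · exact this i hi j hj h
      · rw [abs_sub_comm]; exact this j hj i hi h
  have hsub : Sol ⊆ Big ∪ (range I).biUnion (fun i => (hset K i θ (2*ε + W*2^(i+1)/N^2)).biUnion (fun q => gapset Sol f q.1 q.2)) := by
    intro b hb
    rw [mem_union]
    by_cases hB : b ∈ Big
    · exact Or.inl hB
    right
    have hex : ∃ x ∈ Sol, b < x ∧ x < b + 2^I := by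
      by_contra hcon; push Not at hcon
      apply hB; rw [hBig, mem_filter]; exact ⟨hb, hcon⟩
    obtain ⟨x0, hx0, hx1, hx2⟩ := hex
    set Nx := Sol.filter (fun x => b < x) with hNx
    have hne : Nx.Nonempty := ⟨x0, by rw [hNx, mem_filter]; exact ⟨hx0, hx1⟩⟩
    have hy := Nx.min'_mem hne
    set y := Nx.min' hne with hyd
    have hymin : ∀ x ∈ Sol, b < x → y ≤ x := by
      intro x hx hbx; apply Nx.min'_le; rw [hNx, mem_filter]; exact ⟨hx, hbx⟩
    rw [hNx, mem_filter] at hy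
    have hyx := hymin x0 hx0 hx1
    obtain ⟨l, hl⟩ : ∃ l, y = b + l := ⟨y - b, by omega⟩
    have hl0 : 0 < l := by omega
    have hlI : l < 2^I := by omega
    obtain ⟨a1, a2, a3⟩ := h1 b hb
    obtain ⟨d1, d2, d3⟩ := h1 y hy.1
    rw [hl] at d1 d2 d3
    push_cast at d1 d2 d3
    have hb0 : (0:ℝ) < b := by linarith
    have hl' : (0:ℝ) < l := by exact_mod_cast hl0
    have hkey : |θ*l - ((f (b+l):ℝ) - f b)| ≤ 2*ε + W*l/N^2 := by
      have e1 : θ*l - ((f (b+l):ℝ) - f b) = ((f b:ℝ) - θ*b - κ/b) - ((f (b+l):ℝ) - θ*(b+l) - κ/(b+l)) + κ*l/(b*(b+l)) := by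
        field_simp; ring
      rw [e1]
      refine (abs_add_le _ _).trans ?_
      have i1 := abs_sub ((f b:ℝ) - θ*b - κ/b) ((f (b+l):ℝ) - θ*(b+l) - κ/(b+l))
      have i2 : |κ*l/(b*(b+l))| ≤ W*l/N^2 := by
        rw [abs_div, abs_mul, abs_of_pos hl', abs_of_pos (by positivity : (0:ℝ) < b*(b+l))]
        have : N^2 ≤ b*(b+l) := by rw [sq]; gcongr
        have : 0 ≤ W := (abs_nonneg _).trans hW
        gcongr
      linarith
    have hW0 : 0 ≤ W := (abs_nonneg _).trans hW
    have hWl : 8 * Bt * (W*l/N^2) ≤ l := by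
      rw [mul_div_assoc', div_le_iff₀ (by positivity)]
      calc 8*Bt*(W*l) = 8*Bt*W*l := by ring
        _ ≤ N^2*l := by gcongr
        _ = _ := by ring
    have hl1 : (1:ℝ) ≤ l := by exact_mod_cast hl0
    have hsmall : 2*ε + W*l/N^2 ≤ 3/8*l := by
      have q1 : 8*1*ε ≤ 8*Bt*ε := by gcongr
      have q2 : 8*1*(W*l/N^2) ≤ 8*Bt*(W*l/N^2) := by gcongr
      linarith
    have hpos : (0:ℝ) < (f (b+l):ℝ) - f b := by
      have hk := (abs_le.1 hkey).2
      have q : Bt * (θ*l - ((f (b+l):ℝ) - f b)) ≤ Bt * (2*ε + W*l/N^2) := by gcongr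
      have q2 : (1:ℝ)*l ≤ Bt*θ*l := by gcongr
      have q3 : 0 < Bt * ((f (b+l):ℝ) - f b) := by linarith
      exact (pos_iff_pos_of_mul_pos q3).1 (by linarith)
    have hlt : f b < f (b+l) := by
      have : (f b:ℝ) < f (b+l) := by linarith
      exact_mod_cast this
    obtain ⟨l', hl'2⟩ : ∃ l', f (b+l) = f b + l' := ⟨f (b+l) - f b, by omega⟩
    have hl'0 : 0 < l' := by omega
    rw [hl'2] at hkey
    push_cast at hkey
    rw [add_sub_cancel_left] at hkey
    have hlog := Nat.pow_log_le_self 2 hl0.ne'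
    have hlog2 := Nat.lt_pow_succ_log_self (by norm_num : 1 < 2) l
    set i := Nat.log 2 l
    have hiI : i < I := by
      by_contra h; push Not at h
      have : 2^I ≤ 2^i := Nat.pow_le_pow_right (by norm_num) h
      omega
    have hl2r : (l:ℝ) ≤ 2^(i+1) := by exact_mod_cast hlog2.le
    rw [mem_biUnion]
    refine ⟨i, mem_range.2 hiI, ?_⟩
    rw [mem_biUnion]
    refine ⟨(l, l'), ?_, ?_⟩
    · rw [mem_hset]
      refine ⟨⟨hlog, hlog2⟩, ⟨hl'0, ?_⟩, ?_⟩
      · have : (l':ℝ) ≤ K * 2^(i+1) := by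
          have hk := (abs_le.1 hkey).1
          have q1 : θ*l ≤ Bt*l := by gcongr
          have q2 : (l':ℝ) ≤ (Bt+1)*l := by linarith
          calc (l':ℝ) ≤ (Bt+1)*l := q2
            _ ≤ K*2^(i+1) := by gcongr
        exact_mod_cast this
      · refine hkey.trans ?_
        gcongr
    · rw [gapset, mem_filter]
      refine ⟨hb, hl ▸ hy.1, ?_, hl'2⟩
      intro x hx hbx
      rw [← hl]; exact hymin x hx hbx
  have hc1 := Finset.card_le_card hsub
  have hc2 : (Sol.card : ℝ) ≤ Big.card + ∑ i ∈ range I, ∑ q ∈ hset K i θ (2*ε + W*2^(i+1)/N^2), ((gapset Sol f q.1 q.2).card : ℝ) := by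
    have := hc1.trans (Finset.card_union_le _ _)
    have h3 := this.trans (Nat.add_le_add_left ((Finset.card_biUnion_le).trans (Finset.sum_le_sum (fun i _ => Finset.card_biUnion_le))) _)
    exact_mod_cast h3
  refine hc2.trans ?_
  refine add_le_add hbig (Finset.sum_le_sum ?_)
  intro i hi
  set T0 := 2*ε + W*2^(i+1)/N^2
  have hpt : ∀ q ∈ hset K i θ T0, ((gapset Sol f q.1 q.2).card : ℝ) ≤ 65 + 64*(N/2^i) * ∑ j ∈ range J, if |θ*q.1-q.2| ≤ 4*2^j*ε then ((1/2:ℝ))^j else 0 := by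
    intro q hq
    rw [mem_hset] at hq
    have hq0 : 0 < q.1 := lt_of_lt_of_le (by positivity) hq.1.1
    obtain ⟨m, m0, m1, m2, m3⟩ := gap_pair N θ κ ε hN hε Sol f h1 q.1 q.2 hq0
    have m4 := min_dy m _ ε hε m0 m1 m2 J
    set S := ∑ j ∈ range J, if |θ*q.1-q.2| ≤ 4*2^j*ε then ((1/2:ℝ))^j else 0
    have e1 : N/(q.1:ℝ) ≤ N/2^i := by
      apply div_le_div_of_nonneg_left hN.le (by positivity)
      exact_mod_cast hq.1.1
    have e2 : N/(q.1:ℝ) ≤ N := div_le_self hN.le (by exact_mod_cast hq0)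
    have hS : 0 ≤ S := by apply Finset.sum_nonneg; intro j _; split_ifs <;> positivity
    have e3 : N * (1/2)^J ≤ 1 := by
      calc N*(1/2)^J ≤ 2^J*(1/2)^J := by gcongr
        _ = 1 := by rw [← mul_pow]; norm_num
    calc _ ≤ 1 + 64*(N/q.1)*m := m3
      _ ≤ 1 + 64*(N/q.1)*(S + (1/2)^J) := by gcongr
      _ = 1 + 64*(N/q.1)*S + 64*((N/q.1)*(1/2)^J) := by ring
      _ ≤ 1 + 64*(N/2^i)*S + 64*(N*(1/2)^J) := by gcongr
      _ ≤ _ := by linarith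
  refine (Finset.sum_le_sum hpt).trans ?_
  rw [Finset.sum_add_distrib, Finset.sum_const, nsmul_eq_mul, ← Finset.mul_sum, mul_comm (65:ℝ)]
  have hfin : ∑ q ∈ hset K i θ T0, ∑ j ∈ range J, (if |θ*q.1-q.2| ≤ 4*2^j*ε then ((1/2:ℝ))^j else 0) ≤ ∑ j ∈ range J, (1/2:ℝ)^j * ((hset K i θ (4*2^j*ε)).card : ℝ) := by
    rw [Finset.sum_comm]
    apply Finset.sum_le_sum
    intro j _
    rw [← Finset.sum_filter, Finset.sum_const, nsmul_eq_mul, mul_comm]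
    gcongr
    intro q hq
    rw [mem_filter, mem_hset] at hq
    rw [mem_hset]
    exact ⟨hq.1.1, hq.1.2.1, hq.2⟩
  gcongr

lemma nat_interval_card (S : Finset ℕ) (a l : ℝ) (hl : 0 ≤ l) (h : ∀ i ∈ S, a ≤ (i:ℝ) ∧ (i:ℝ) ≤ a + l) : (S.card : ℝ) ≤ 1 + l := by
  have := spaced S (fun i => (i:ℝ)) a l 1 one_pos hl h (by
    intro i _ j _ hij
    have : (i:ℤ) ≠ j := by exact_mod_cast hij
    have h2 : (1:ℤ) ≤ |(i:ℤ) - j| := Int.one_le_abs (sub_ne_zero.2 this)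
    exact_mod_cast h2)
  simpa using this

lemma perp_crude (N θ κ ε : ℝ) (a a' : ℕ) (hN : 1 ≤ N) (hε : 0 < ε) (T : Finset (ℕ×ℕ))
    (h : ∀ q ∈ T, N ≤ (q.1:ℝ) ∧ (q.1:ℝ) ≤ 2*N ∧ |(2*(q.2:ℝ)+a') - θ*(2*q.1+a) - κ/(2*q.1+a)| ≤ ε) :
    (T.card : ℝ) ≤ 2*N*(1+ε) := by
  have h1 := fib_card T (T.image (fun q => q.1)) (fun q => q.1) (fun q hq => mem_image_of_mem _ hq) (1+ε) (by
    intro b hb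
    have e1 : (T.filter (fun q => q.1 = b)).card = ((T.filter (fun q => q.1 = b)).image (fun q => q.2)).card := by
      rw [Finset.card_image_of_injOn]
      intro q hq q' hq' hh
      simp only [coe_filter, Set.mem_ofPred_eq] at hq hq'
      exact Prod.ext (hq.2.trans hq'.2.symm) hh
    rw [e1]
    apply nat_interval_card _ ((θ*(2*b+a) + κ/(2*b+a) - a' - ε)/2) ε hε.le
    intro i hi
    simp only [mem_image, mem_filter] at hi
    obtain ⟨q, ⟨hq, rfl⟩, rfl⟩ := hi
    have := abs_le.1 (h q hq).2.2
    constructor <;> linarith [this.1, this.2])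
  have h2 : ((T.image (fun q => q.1)).card : ℝ) ≤ 1 + N := by
    apply nat_interval_card _ N N (by linarith)
    intro i hi
    simp only [mem_image] at hi
    obtain ⟨q, hq, rfl⟩ := hi
    have := h q hq
    constructor <;> linarith [this.1, this.2.1]
  refine h1.trans ?_
  gcongr
  linarith

lemma perp_triv (N : ℝ) (hN : 1 ≤ N) (T : Finset (ℕ×ℕ))
    (h : ∀ q ∈ T, (N ≤ (q.1:ℝ) ∧ (q.1:ℝ) ≤ 2*N) ∧ (N ≤ (q.2:ℝ) ∧ (q.2:ℝ) ≤ 2*N)) :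
    (T.card : ℝ) ≤ 4*N^2 := by
  have h1 : T ⊆ (T.image (fun q => q.1)) ×ˢ (T.image (fun q => q.2)) := by
    intro q hq; rw [mem_product]; exact ⟨mem_image_of_mem _ hq, mem_image_of_mem _ hq⟩
  have h2 : (T.card:ℝ) ≤ ((T.image (fun q => q.1)).card:ℝ) * (T.image (fun q => q.2)).card := by
    have := card_le_card h1
    rw [card_product] at this
    exact_mod_cast this
  have h3 : ((T.image (fun q => q.1)).card : ℝ) ≤ 1 + N := by
    apply nat_interval_card _ N N (by linarith)
    intro i hi
    simp only [mem_image] at hi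
    obtain ⟨q, hq, rfl⟩ := hi
    have := (h q hq).1
    constructor <;> linarith [this.1, this.2]
  have h4 : ((T.image (fun q => q.2)).card : ℝ) ≤ 1 + N := by
    apply nat_interval_card _ N N (by linarith)
    intro i hi
    simp only [mem_image] at hi
    obtain ⟨q, hq, rfl⟩ := hi
    have := (h q hq).2
    constructor <;> linarith [this.1, this.2]
  calc (T.card:ℝ) ≤ _ := h2
    _ ≤ (1+N)*(1+N) := by gcongr
    _ ≤ (2*N)*(2*N) := by gcongr <;> linarith
    _ = _ := by ring

lemma perp_fine (N θ κ ε Bt : ℝ) (a a' : ℕ) (K I J : ℕ) (hN : 1 ≤ N) (ha : (a:ℝ) ≤ N) (hε : 0 < ε) (hJ : 2*N ≤ 2^J) (hBt : 1 ≤ Bt) (hK : Bt + 1 ≤ K) (hθ : 1 ≤ Bt * θ) (hθ2 : θ ≤ Bt)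
    (hε2 : 8 * Bt * ε ≤ 1) (W : ℝ) (hW : |κ| ≤ W) (hW2 : 8 * Bt * W ≤ (2*N)^2) (T : Finset (ℕ×ℕ))
    (h : ∀ q ∈ T, N ≤ (q.1:ℝ) ∧ (q.1:ℝ) ≤ 2*N ∧ |(2*(q.2:ℝ)+a') - θ*(2*q.1+a) - κ/(2*q.1+a)| ≤ ε) :
    (T.card : ℝ) ≤ 1 + 7*(2*N)/2^I + ∑ i ∈ range I, (65 * ((hset K i θ (2*ε + W*2^(i+1)/(2*N)^2)).card : ℝ) + 
        64 * ((2*N)/2^i) * ∑ j ∈ range J, (1/2:ℝ)^j * ((hset K i θ (4*2^j*ε)).card : ℝ)) := by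
  have hε3 : ε ≤ 1/8 := by
    have : 8*1*ε ≤ 8*Bt*ε := by gcongr
    linarith
  set f : ℕ → ℕ := fun b => ⌊θ*b + κ/b + 1/2⌋₊ with hf
  have hfb : ∀ q ∈ T, f (2*q.1+a) = 2*q.2+a' := by
    intro q hq
    have := abs_le.1 (h q hq).2.2
    rw [hf]
    simp only
    rw [Nat.floor_eq_iff]
    · push_cast
      constructor <;> linarith [this.1, this.2]
    · push_cast
      have : (0:ℝ) ≤ 2*(q.2:ℝ)+a' := by positivity
      linarith [this]
  have e1 : T.card = (T.image (fun q => 2*q.1+a)).card := by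
    rw [Finset.card_image_of_injOn]
    intro q hq q' hq' hh
    simp only at hh
    have h1 := hfb q hq
    have h2 := hfb q' hq'
    rw [hh, h2] at h1
    exact Prod.ext (by omega) (by omega)
  rw [e1]
  apply gap_count (2*N) θ κ ε Bt K I J (by linarith) hε hJ hBt hK hθ hθ2 hε2 W hW hW2 _ f
  intro b hb
  simp only [mem_image] at hb
  obtain ⟨q, hq, rfl⟩ := hb
  rw [hfb q hq]
  have h3 := h q hq
  have : (0:ℝ) ≤ a := by positivity
  push_cast
  refine ⟨by linarith [h3.1], by linarith [h3.2.1], h3.2.2⟩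

lemma fib_sum (R : ℕ) (hR : 0 < R) (Dv : ℝ) (hD : ∀ A : ℕ, 0 < A → A ≤ 2*R → (A.divisors.card : ℝ) ≤ Dv) (Ps : Finset (ℕ×ℕ))
    (hPs : ∀ p ∈ Ps, R ≤ p.1*p.2 ∧ p.1*p.2 ≤ 2*R) (G : ℕ → ℕ → ℝ) (hG : ∀ a b, 0 ≤ G a b) :
    ∑ p ∈ Ps ×ˢ Ps, G (p.1.1*p.1.2) (p.2.1*p.2.2) ≤ Dv^2 * ∑ q ∈ (Icc R (2*R)) ×ˢ (Icc R (2*R)), G q.1 q.2 := by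
  have hfib : ∀ a ∈ Icc R (2*R), ((Ps.filter (fun p => p.1*p.2 = a)).card : ℝ) ≤ Dv := by
    intro a ha
    rw [mem_Icc] at ha
    refine le_trans ?_ (hD a (by omega) ha.2)
    have : (Ps.filter (fun p => p.1*p.2 = a)).card ≤ a.divisors.card := by
      apply Finset.card_le_card_of_injOn (fun p => p.1)
      · intro p hp
        simp only [coe_filter, Set.mem_ofPred_eq] at hp
        simp only [mem_coe, Nat.mem_divisors]
        exact ⟨⟨p.2, hp.2.symm⟩, by omega⟩
      · intro p hp p' hp' hh
        simp only [coe_filter, Set.mem_ofPred_eq] at hp hp'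
        simp only at hh
        refine Prod.ext hh ?_
        have h1 := hp.2; have h2 := hp'.2
        rw [← h2, hh] at h1
        have : 0 < p'.1 := by
          rcases Nat.eq_zero_or_pos p'.1 with h0 | h0
          · rw [h0] at h2; omega
          · exact h0
        exact Nat.eq_of_mul_eq_mul_left this h1
    exact_mod_cast this
  have hone : ∀ g : ℕ → ℝ, (∀ a, 0 ≤ g a) → ∑ p ∈ Ps, g (p.1*p.2) ≤ Dv * ∑ a ∈ Icc R (2*R), g a := by
    intro g hg
    rw [← Finset.sum_fiberwise_of_maps_to (s := Ps) (t := Icc R (2*R)) (g := fun p => p.1*p.2) (fun p hp => mem_Icc.2 (hPs p hp)), Finset.mul_sum]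
    apply Finset.sum_le_sum
    intro a ha
    rw [Finset.sum_congr rfl (g := fun _ => g a) (by intro p hp; rw [mem_filter] at hp; rw [hp.2]), Finset.sum_const, nsmul_eq_mul]
    exact mul_le_mul_of_nonneg_right (hfib a ha) (hg a)
  have hDv : 0 ≤ Dv := le_trans (by positivity) (hD 1 one_pos (by omega))
  rw [Finset.sum_product, Finset.sum_product]
  calc ∑ x ∈ Ps, ∑ y ∈ Ps, G (x.1*x.2) (y.1*y.2) ≤ ∑ x ∈ Ps, Dv * ∑ b ∈ Icc R (2*R), G (x.1*x.2) b := by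
        apply Finset.sum_le_sum; intro x _; exact hone _ (hG _)
    _ ≤ Dv * ∑ a ∈ Icc R (2*R), (Dv * ∑ b ∈ Icc R (2*R), G a b) := by
        apply hone (fun a => Dv * ∑ b ∈ Icc R (2*R), G a b)
        intro a; exact mul_nonneg hDv (Finset.sum_nonneg (fun b _ => hG _ _))
    _ = _ := by rw [← Finset.mul_sum]; ring

lemma hsum (α : ℝ) (hα : 0 < α) (K : ℕ) (hK : 0 < K) : ∃ C ≥ (1:ℝ), ∀ (R i : ℕ) (T N : ℝ), 0 < R → (R:ℝ) ≤ N → 0 ≤ T → (2:ℝ)^i ≤ N →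
    ∑ q ∈ (Icc R (2*R)) ×ˢ (Icc R (2*R)), ((hset K i (((q.1:ℝ)/q.2)^α) T).card : ℝ) ≤ C * (R * 2^i + T * 2^i * R^2) * (1 + Real.log N)^2 := by
  obtain ⟨C, hC, hg⟩ := gcount α hα
  have hK' : (1:ℝ) ≤ K := by exact_mod_cast hK
  have hlK : 0 ≤ Real.log K := Real.log_nonneg hK'
  refine ⟨C*(16*K^2)*((1+1)*(2+Real.log K)), ?_, ?_⟩
  · have h1 : (1:ℝ) ≤ 16*K^2 := by nlinarith
    have h2 : (1:ℝ) ≤ (1+1)*(2+Real.log K) := by linarith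
    calc (1:ℝ) = 1*1*1 := by norm_num
      _ ≤ _ := by gcongr
  intro R i T N hR hRN hT hi
  have hR' : (1:ℝ) ≤ R := by exact_mod_cast hR
  have hN : 1 ≤ N := hR'.trans hRN
  have hL : 0 ≤ Real.log N := Real.log_nonneg hN
  have h1 : ∑ q ∈ (Icc R (2*R)) ×ˢ (Icc R (2*R)), ((hset K i (((q.1:ℝ)/q.2)^α) T).card : ℝ) ≤ ((gset α (2*R) (K*2^(i+1)) (T/2^i)).card : ℝ) := by
    have : (((Icc R (2*R)) ×ˢ (Icc R (2*R))).sigma (fun q => hset K i (((q.1:ℝ)/q.2)^α) T)).card ≤ (gset α (2*R) (K*2^(i+1)) (T/2^i)).card := by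
      apply Finset.card_le_card_of_injOn (fun z => (z.1, z.2))
      · rintro ⟨q, l⟩ hz
        simp only [coe_sigma, Set.mem_sigma_iff, mem_coe, mem_product, mem_Icc, mem_hset] at hz
        obtain ⟨⟨⟨q1, q2⟩, q3, q4⟩, ⟨l1, l2⟩, ⟨l3, l4⟩, l5⟩ := hz
        simp only [mem_coe]
        rw [mem_gset]
        have l1' : (2:ℝ)^i ≤ l.1 := by exact_mod_cast l1
        have hl0 : 0 < l.1 := lt_of_lt_of_le (by positivity) l1
        have hl0' : (0:ℝ) < l.1 := by exact_mod_cast hl0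
        refine ⟨⟨⟨by simp only; omega, by simp only; omega⟩, by simp only; omega, by simp only; omega⟩, ⟨⟨hl0, ?_⟩, l3, l4⟩, by simp only; omega, by simp only; omega, ?_⟩
        · simp only
          calc l.1 ≤ 1*2^(i+1) := by omega
            _ ≤ K*2^(i+1) := Nat.mul_le_mul_right _ hK
        · simp only
          have e1 : ((q.1:ℝ)/q.2)^α - (l.2:ℝ)/l.1 = (((q.1:ℝ)/q.2)^α * l.1 - l.2)/l.1 := by field_simp
          rw [e1, abs_div, abs_of_pos hl0']
          gcongr
      · rintro ⟨q, l⟩ _ ⟨q', l'⟩ _ hh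
        simp only [Prod.mk.injEq] at hh
        obtain ⟨h1, h2⟩ := hh
        subst h1; subst h2; rfl
    rw [Finset.card_sigma] at this
    exact_mod_cast this
  refine h1.trans ((hg _ _ _ (by positivity) (by omega) (by positivity)).trans ?_)
  push_cast
  have hl1 : 1 + Real.log (2*R) ≤ (1+1)*(1+Real.log N) := by
    rw [Real.log_mul (by norm_num) (by positivity)]
    have := Real.log_le_log (by positivity) hRN
    have := Real.log_two_lt_d9
    linarith
  have hl2 : 1 + Real.log (K*2^(i+1)) ≤ (2+Real.log K)*(1+Real.log N) := by
    rw [Real.log_mul (by positivity) (by positivity), pow_succ, Real.log_mul (by positivity) (by positivity)]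
    have := Real.log_le_log (by positivity) hi
    have := Real.log_two_lt_d9
    nlinarith [mul_nonneg hlK hL]
  have hl10 : 0 ≤ 1 + Real.log (2*R) := by
    have := Real.log_nonneg (by linarith : (1:ℝ) ≤ 2*R); linarith
  have hl20 : 0 ≤ 1 + Real.log (K*2^(i+1)) := by
    have h2 : (1:ℝ) ≤ 2^(i+1) := one_le_pow₀ (by norm_num)
    have := Real.log_nonneg (by nlinarith : (1:ℝ) ≤ K*2^(i+1)); linarith
  have hm : (2 * (R:ℝ) * (K * 2^(i+1)) + T/2^i*(2*R)^2*(K*2^(i+1))^2) ≤ 16*K^2*(R*2^i+T*2^i*R^2) := by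
    have e1 : 2 * (R:ℝ) * (K * 2^(i+1)) + T/2^i*(2*R)^2*(K*2^(i+1))^2 = 4*K*(R*2^i) + 16*K^2*(T*2^i*R^2) := by
      field_simp; ring
    rw [e1, mul_add]
    gcongr
    · norm_num
    · nlinarith
  calc C * (2 * (R:ℝ) * (K * 2^(i+1)) + T/2^i*(2*R)^2*(K*2^(i+1))^2) * (1 + Real.log (2*R)) * (1+Real.log (K*2^(i+1)))
      ≤ C * (16*K^2*(R*2^i+T*2^i*R^2)) * ((1+1)*(1+Real.log N)) * ((2+Real.log K)*(1+Real.log N)) := by gcongr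
    _ = _ := by ring

lemma log_two_pow (n : ℕ) (N : ℝ) (h : (2:ℝ)^n ≤ N) : (n:ℝ) ≤ 2*(1+Real.log N) - 2 := by
  have h1 := Real.log_le_log (by positivity) h
  rw [Real.log_pow] at h1
  have := Real.log_two_gt_d9
  have h0 : (0:ℝ) ≤ n := by positivity
  nlinarith

lemma hsum_total (α : ℝ) (hα : 0 < α) (K : ℕ) (hK : 0 < K) : ∃ C ≥ (1:ℝ), ∀ (R I J : ℕ) (ε W w N : ℝ), 0 < R → (R:ℝ) ≤ N → 0 < ε → 1 ≤ w → 
    0 ≤ W → (2:ℝ)^I * w^((2:ℝ)/3) ≤ N → N ≤ 2*2^I*w^((2:ℝ)/3) → (J:ℝ) ≤ 4*(1+Real.log N) →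
    ∑ q ∈ (Icc R (2*R)) ×ˢ (Icc R (2*R)), (1 + 7*(2*N)/2^I + ∑ i ∈ range I, (65 * ((hset K i (((q.1:ℝ)/q.2)^α) (2*ε + W*w^2*2^(i+1)/(2*N)^2)).card : ℝ) + 
        64 * ((2*N)/2^i) * ∑ j ∈ range J, (1/2:ℝ)^j * ((hset K i (((q.1:ℝ)/q.2)^α) (4*2^j*ε)).card : ℝ)))
     ≤ (C*(1+W)) * (1+Real.log N)^4 * (R*N + R^2*w^((2:ℝ)/3) + R^2*(N*ε)) := by
  obtain ⟨C, hC, hs⟩ := hsum α hα K hK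
  refine ⟨116 + 5000*C, by linarith, ?_⟩
  intro R I J ε W w N hR hRN hε hw hW hI1 hI2 hJ
  have hR' : (1:ℝ) ≤ R := by exact_mod_cast hR
  have hN : 1 ≤ N := hR'.trans hRN
  set v := w^((2:ℝ)/3) with hv
  have hv1 : 1 ≤ v := Real.one_le_rpow hw (by norm_num)
  set L := 1 + Real.log N with hL
  have hL1 : 1 ≤ L := by have := Real.log_nonneg hN; linarith
  set Z := R*N + R^2*v + R^2*(N*ε) with hZ
  have hZ0 : 0 ≤ Z := by positivity
  have hZ1 : R*N ≤ Z := by rw [hZ]; have : 0 ≤ R^2*v + R^2*(N*ε) := by positivity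
                           linarith
  have hZ2 : R^2*v ≤ Z := by rw [hZ]; have : 0 ≤ R*N + R^2*(N*ε) := by positivity
                             linarith
  have hZ3 : R^2*(N*ε) ≤ Z := by rw [hZ]; have : 0 ≤ R*N + R^2*v := by positivity
                                 linarith
  have hwv : w^2 = v^3 := by
    rw [hv, ← Real.rpow_natCast, ← Real.rpow_natCast, ← Real.rpow_mul (by linarith)]
    norm_num
  have hIN : (2:ℝ)^I ≤ N := le_trans (le_mul_of_one_le_right (by positivity) hv1) hI1
  have hIL : (I:ℝ) ≤ 2*L := by have := log_two_pow I N hIN; linarith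
  rw [Finset.sum_add_distrib, Finset.sum_comm]
  have hA : ∑ q ∈ (Icc R (2*R)) ×ˢ (Icc R (2*R)), (1 + 7*(2*N)/2^I) ≤ 116*Z := by
    rw [Finset.sum_const, card_product, Nat.card_Icc, nsmul_eq_mul]
    have e1 : ((2*R+1-R : ℕ):ℝ) = R + 1 := by
      have : 2*R+1-R = R+1 := by omega
      rw [this]; push_cast; ring
    push_cast
    rw [e1]
    have h1 : 1 + 7*(2*N)/2^I ≤ 29*v := by
      have : 7*(2*N)/2^I ≤ 28*v := by
        rw [div_le_iff₀ (by positivity)]; linarith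
      linarith
    calc ((R:ℝ)+1)*(R+1)*(1 + 7*(2*N)/2^I) ≤ (R+R)*(R+R)*(29*v) := by gcongr
      _ = 116*(R^2*v) := by ring
      _ ≤ _ := by linarith
  have hB : ∀ i ∈ range I, ∑ q ∈ (Icc R (2*R)) ×ˢ (Icc R (2*R)), (65 * ((hset K i (((q.1:ℝ)/q.2)^α) (2*ε + W*w^2*2^(i+1)/(2*N)^2)).card : ℝ) + 
        64 * ((2*N)/2^i) * ∑ j ∈ range J, (1/2:ℝ)^j * ((hset K i (((q.1:ℝ)/q.2)^α) (4*2^j*ε)).card : ℝ)) ≤ 2500*C*(1+W)*L^3*Z := by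
    intro i hi
    rw [mem_range] at hi
    have hi2 : (2:ℝ)^i ≤ 2^I := pow_le_pow_right₀ (by norm_num) hi.le
    have hiN : (2:ℝ)^i ≤ N := hi2.trans hIN
    rw [Finset.sum_add_distrib, ← Finset.mul_sum, ← Finset.mul_sum, Finset.sum_comm]
    have b1 := hs R i (2*ε + W*w^2*2^(i+1)/(2*N)^2) N hR hRN (by positivity) hiN
    have b2 : ∀ j ∈ range J, ∑ q ∈ (Icc R (2*R)) ×ˢ (Icc R (2*R)), (1/2:ℝ)^j * ((hset K i (((q.1:ℝ)/q.2)^α) (4*2^j*ε)).card : ℝ) ≤ 2^i * (C*L^2*(R+4*ε*R^2)) := by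
      intro j _
      rw [← Finset.mul_sum]
      have := hs R i (4*2^j*ε) N hR hRN (by positivity) hiN
      have hj : (1/2:ℝ)^j ≤ 1 := pow_le_one₀ (by norm_num) (by norm_num)
      have hj2 : (1/2:ℝ)^j*2^j = 1 := by rw [← mul_pow]; norm_num
      calc _ ≤ (1/2:ℝ)^j * (C * (R * 2^i + 4*2^j*ε * 2^i * R^2) * L^2) := by gcongr
        _ = 2^i * (C*L^2*((1/2:ℝ)^j*R+4*ε*R^2*((1/2:ℝ)^j*2^j))) := by ring
        _ ≤ 2^i * (C*L^2*(1*R+4*ε*R^2*1)) := by rw [hj2]; gcongr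
        _ = _ := by ring
    have b2' := Finset.sum_le_sum b2
    rw [Finset.sum_const, card_range, nsmul_eq_mul] at b2'
    have b1' : (R:ℝ) * 2^i + (2*ε + W*w^2*2^(i+1)/(2*N)^2) * 2^i * R^2 ≤ (3+W)*Z := by
      have t1 : (R:ℝ) * 2^i ≤ Z := le_trans (by gcongr) hZ1
      have t2 : 2*ε * 2^i * R^2 ≤ 2*Z := by
        calc 2*ε * 2^i * R^2 ≤ 2*ε*N*R^2 := by gcongr
          _ = 2*(R^2*(N*ε)) := by ring
          _ ≤ _ := by linarith
      have t3 : W*w^2*2^(i+1)/(2*N)^2 * 2^i * R^2 ≤ W*Z := by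
        have t4 : w^2*2^(i+1)/(2*N)^2 * 2^i ≤ v := by
          rw [div_mul_eq_mul_div, div_le_iff₀ (by positivity), hwv]
          have : (2^i*v)^2 ≤ N^2 := by
            have : (2:ℝ)^i*v ≤ N := le_trans (by gcongr) hI1
            gcongr
          calc v^3*2^(i+1)*2^i = 2*(v*(2^i*v)^2) := by ring
            _ ≤ 2*(v*N^2) := by gcongr
            _ ≤ v*(2*N)^2 := by have := mul_nonneg (by linarith : 0 ≤ v) (sq_nonneg N); linarith only [this]
        calc _ = W*((w^2*2^(i+1)/(2*N)^2 * 2^i)*R^2) := by ring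
          _ ≤ W*(v*R^2) := by gcongr
          _ = W*(R^2*v) := by ring
          _ ≤ _ := by gcongr
      calc _ = (R:ℝ) * 2^i + 2*ε * 2^i * R^2 + W*w^2*2^(i+1)/(2*N)^2 * 2^i * R^2 := by ring
        _ ≤ _ := by linarith
    have b3 : 64 * ((2*N)/2^i) * (J*(2^i * (C*L^2*(R+4*ε*R^2)))) ≤ 2048*C*L^3*Z := by
      calc 64 * ((2*N)/2^i) * (J*(2^i * (C*L^2*(R+4*ε*R^2)))) = 128*C*L^2*J*(R*N+4*(R^2*(N*ε))) := by
            field_simp; ring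
        _ ≤ 128*C*L^2*(4*L)*(4*Z) := by
            have : 0 ≤ R^2*v := by positivity
            have hRN0 : 0 ≤ R*N := by positivity
            gcongr
            rw [hZ]; linarith
        _ = _ := by ring
    calc _ ≤ 65*(C*((3+W)*Z)*L^2) + 64 * ((2*N)/2^i) * (J*(2^i * (C*L^2*(R+4*ε*R^2)))) := by
          gcongr
          exact b1.trans (by gcongr)
      _ ≤ 65*(C*((3+W)*Z)*L^2) + 2048*C*L^3*Z := by linarith
      _ ≤ 65*(C*((3*(1+W))*Z)*L^3) + 2048*(C*L^3*Z)*(1+W) := by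
          have g1 : 0 ≤ C*L^3*Z := by positivity
          have g2 : C*((3+W)*Z)*L^2 ≤ C*((3*(1+W))*Z)*L^3 := by
            have : L^2 ≤ L^3 := pow_le_pow_right₀ hL1 (by norm_num)
            gcongr
            linarith
          have g3 : C*L^3*Z*1 ≤ C*L^3*Z*(1+W) := mul_le_mul_of_nonneg_left (by linarith) g1
          linarith
      _ = 2243*(C*(1+W)*L^3*Z) := by ring
      _ ≤ 2500*(C*(1+W)*L^3*Z) := by
          have : 0 ≤ C*(1+W)*L^3*Z := by positivity
          linarith
      _ = _ := by ring
  have hB' := Finset.sum_le_sum hB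
  rw [Finset.sum_const, card_range, nsmul_eq_mul] at hB'
  calc _ ≤ 116*Z + I*(2500*C*(1+W)*L^3*Z) := add_le_add hA hB'
    _ ≤ 116*(1+W)*L^4*Z + (2*L)*(2500*C*(1+W)*L^3*Z) := by
        have h4 : 1 ≤ (1+W)*L^4 := by
          have := one_le_pow₀ hL1 (n := 4)
          calc (1:ℝ) = 1*1 := by norm_num
            _ ≤ (1+W)*L^4 := by gcongr; linarith
        have h5 : 116*Z ≤ 116*(1+W)*L^4*Z := by
          have := mul_le_mul_of_nonneg_right h4 hZ0
          linarith
        gcongr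
    _ = _ := by ring

lemma right_split (R : ℕ) (hR : 0 < R) (Dv : ℝ) (hD : ∀ A : ℕ, 0 < A → A ≤ 2*R → (A.divisors.card : ℝ) ≤ Dv)
    (W : Finset ((ℕ×ℕ×ℕ)×(ℕ×ℕ×ℕ))) 
    (hW : ∀ p ∈ W, (R ≤ p.1.1*p.1.2.1 ∧ p.1.1*p.1.2.1 ≤ 2*R) ∧ (R ≤ p.2.1*p.2.2.1 ∧ p.2.1*p.2.2.1 ≤ 2*R))
    (G : ℕ → ℕ → ℝ) (hG : ∀ a b, 0 ≤ G a b)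
    (hf : ∀ r s r' s' : ℕ, R ≤ r*s → r*s ≤ 2*R → R ≤ r'*s' → r'*s' ≤ 2*R → ∀ T : Finset (ℕ×ℕ), (∀ q ∈ T, ((r,s,q.1),(r',s',q.2)) ∈ W) → (T.card : ℝ) ≤ G (r*s) (r'*s')) :
    (W.card : ℝ) ≤ Dv^2 * ∑ q ∈ (Icc R (2*R)) ×ˢ (Icc R (2*R)), G q.1 q.2 := by
  set Ps := ((Icc 1 (2*R)) ×ˢ (Icc 1 (2*R))).filter (fun p => R ≤ p.1*p.2 ∧ p.1*p.2 ≤ 2*R) with hPs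
  have hmem : ∀ r s : ℕ, R ≤ r*s → r*s ≤ 2*R → (r,s) ∈ Ps := by
    intro r s h1 h2
    have hr : 0 < r := by
      rcases Nat.eq_zero_or_pos r with h0 | h0
      · rw [h0] at h1; omega
      · exact h0
    have hs : 0 < s := by
      rcases Nat.eq_zero_or_pos s with h0 | h0
      · rw [h0] at h1; omega
      · exact h0
    rw [hPs, mem_filter, mem_product, mem_Icc, mem_Icc]
    have h3 : r ≤ r*s := Nat.le_mul_of_pos_right _ hs
    have h4 : s ≤ r*s := Nat.le_mul_of_pos_left _ hr
    simp only
    refine ⟨⟨⟨?_, ?_⟩, ?_, ?_⟩, h1, h2⟩ <;> omega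
  refine le_trans ?_ (fib_sum R hR Dv hD Ps (by intro p hp; rw [hPs, mem_filter] at hp; exact hp.2) G hG)
  rw [Finset.card_eq_sum_card_fiberwise (f := fun p : ((ℕ×ℕ×ℕ)×(ℕ×ℕ×ℕ)) => ((p.1.1,p.1.2.1),(p.2.1,p.2.2.1))) (t := Ps ×ˢ Ps)]
  · push_cast
    apply Finset.sum_le_sum
    rintro ⟨⟨r,s⟩,⟨r',s'⟩⟩ hp
    rw [mem_product, hPs, mem_filter, mem_filter] at hp
    simp only at hp ⊢
    set F := W.filter (fun p : ((ℕ×ℕ×ℕ)×(ℕ×ℕ×ℕ)) => ((p.1.1,p.1.2.1),(p.2.1,p.2.2.1)) = ((r,s),(r',s'))) with hF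
    have hFm : ∀ p ∈ F, p ∈ W ∧ p = ((r,s,p.1.2.2),(r',s',p.2.2.2)) := by
      rintro ⟨⟨a,b,n⟩,⟨a',b',n'⟩⟩ hp
      rw [hF, mem_filter] at hp
      simp only [Prod.mk.injEq] at hp ⊢
      exact ⟨hp.1, ⟨hp.2.1.1, hp.2.1.2, trivial⟩, hp.2.2.1, hp.2.2.2, trivial⟩
    have e1 : F.card = (F.image (fun p => (p.1.2.2, p.2.2.2))).card := by
      rw [Finset.card_image_of_injOn]
      intro p hp q hq hh
      simp only [Prod.mk.injEq] at hh
      rw [(hFm p hp).2, (hFm q hq).2, hh.1, hh.2]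
    rw [e1]
    apply hf r s r' s' hp.1.2.1 hp.1.2.2 hp.2.2.1 hp.2.2.2
    intro q hq
    rw [mem_image] at hq
    obtain ⟨p, hp, rfl⟩ := hq
    simp only
    rw [← (hFm p hp).2]; exact (hFm p hp).1
  · intro p hp
    have := hW p hp
    simp only [coe_product, Set.mem_prod, mem_coe]
    exact ⟨hmem _ _ this.1.1 this.1.2, hmem _ _ this.2.1 this.2.2⟩

lemma gexp_nonneg (N θ T1 ε : ℝ) (T2 : ℕ → ℝ) (K I J : ℕ) (hN : 1 ≤ N) : 0 ≤ 1 + 7*(2*N)/2^I + ∑ i ∈ range I, (65 * ((hset K i θ (T2 i)).card : ℝ) + 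
        64 * ((2*N)/2^i) * ∑ j ∈ range J, (1/2:ℝ)^j * ((hset K i θ (4*2^j*ε)).card : ℝ)) := by
  positivity

set_option maxHeartbeats 1600000 in
lemma right_count (c : ℝ) (hc : 2 < c) (hc3 : c < 3) : ∃ C ≥ (1:ℝ), ∀ (N w P Dv : ℝ) (R : ℕ) (W : Finset ((ℕ×ℕ×ℕ)×(ℕ×ℕ×ℕ))), 
    1 ≤ w → C * w ≤ N → 0 < R → (R:ℝ) ≤ N → 0 < P → 
    (∀ A : ℕ, 0 < A → A ≤ 2*R → (A.divisors.card : ℝ) ≤ Dv) → 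
    (∀ p ∈ W, ((R ≤ p.1.1*p.1.2.1 ∧ p.1.1*p.1.2.1 ≤ 2*R) ∧ (R ≤ p.2.1*p.2.2.1 ∧ p.2.1*p.2.2.1 ≤ 2*R)) ∧
       ((p.1.1:ℝ) ≤ w ∧ (p.1.2.1:ℝ) ≤ w ∧ (p.2.1:ℝ) ≤ w ∧ (p.2.2.1:ℝ) ≤ w) ∧
       ((N ≤ (p.1.2.2:ℝ) ∧ (p.1.2.2:ℝ) ≤ 2*N) ∧ (N ≤ (p.2.2.2:ℝ) ∧ (p.2.2.2:ℝ) ≤ 2*N)) ∧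
       |ss c p.1.2.2 p.1.1 p.1.2.1 - ss c p.2.2.2 p.2.1 p.2.2.1| ≤ R * N^(c-2)/P) →
    (W.card : ℝ) ≤ C * Dv^2 * (1+Real.log N)^4 * (R*N + R^2*w^((2:ℝ)/3) + R^2*(N^2/P) + R^2*(w^4/N^2)) := by
  obtain ⟨C1, hC1, h1⟩ := right_core c hc hc3
  set α := 1/(c-2) with hαd
  have hα : 0 < α := by apply one_div_pos.2; linarith
  set Bt := (2:ℝ)^α with hBt
  have hBt1 : 1 ≤ Bt := Real.one_le_rpow (by norm_num) hα.le
  set K := ⌈Bt⌉₊ + 1 with hK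
  have hKB : Bt + 1 ≤ K := by rw [hK]; push_cast; linarith [Nat.le_ceil Bt]
  obtain ⟨C2, hC2, h2⟩ := hsum_total α hα K (by omega)
  set C := C1*(C2*(1+Bt)) + C1*(100*Bt) + 2*Bt + C1 with hC
  have hCa : 0 ≤ C1*(C2*(1+Bt)) := by positivity
  have hCb : 0 ≤ C1*(100*Bt) := by positivity
  have hCc : C1*1 ≤ C1*(100*Bt) := by gcongr; linarith
  refine ⟨C, by linarith, ?_⟩
  intro N w P Dv R W hw hCw hR hRN hP hD hW
  have hR' : (1:ℝ) ≤ R := by exact_mod_cast hR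
  have hN : 1 ≤ N := hR'.trans hRN
  have hC1w : C1*w ≤ N := le_trans (by gcongr; linarith) hCw
  have hBw : 2*Bt*w ≤ N := le_trans (by gcongr; linarith) hCw
  have h2w : 2*w ≤ N := le_trans (by gcongr; linarith) hBw
  set v := w^((2:ℝ)/3) with hv
  have hv1 : 1 ≤ v := Real.one_le_rpow hw (by norm_num)
  set L := 1 + Real.log N with hL
  have hL1 : 1 ≤ L := by have := Real.log_nonneg hN; linarith
  have hL4 : 1 ≤ L^4 := one_le_pow₀ hL1
  set Z := R*N + R^2*v + R^2*(N^2/P) + R^2*(w^4/N^2) with hZ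
  have z1 : 0 ≤ R*N := by positivity
  have z2 : 0 ≤ R^2*v := by positivity
  have z3 : 0 ≤ R^2*(N^2/P) := by positivity
  have z4 : 0 ≤ R^2*(w^4/N^2) := by positivity
  have hZ0 : 0 ≤ Z := by linarith
  have hcard : ∀ g : ℝ, 0 ≤ g → ∑ q ∈ (Icc R (2*R)) ×ˢ (Icc R (2*R)), g ≤ 4*R^2*g := by
    intro g hg
    rw [Finset.sum_const, card_product, Nat.card_Icc, nsmul_eq_mul]
    have e1 : ((2*R+1-R : ℕ):ℝ) = R + 1 := by
      have : 2*R+1-R = R+1 := by omega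
      rw [this]; push_cast; ring
    push_cast
    rw [e1]
    calc ((R:ℝ)+1)*(R+1)*g ≤ (R+R)*(R+R)*g := by gcongr
      _ = _ := by ring
  have hDv : 0 ≤ Dv^2 := sq_nonneg _
  by_cases hP2 : P < 2
  · have := right_split R hR Dv hD W (fun p hp => (hW p hp).1) (fun _ _ => 4*N^2) (fun _ _ => by positivity) (by
      intro r s r' s' _ _ _ _ T hT
      apply perp_triv N hN T
      intro q hq
      exact (hW _ (hT q hq)).2.2.1)
    refine this.trans ?_
    have e1 : N^2 ≤ 2*(N^2/P) := by
      rw [mul_div_assoc', le_div_iff₀ hP]; have := mul_le_mul_of_nonneg_left hP2.le (sq_nonneg N); linarith only [this]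
    have hC32 : 32 ≤ C := by have := one_le_mul_of_one_le_of_one_le hC1 hBt1; linarith
    calc Dv^2 * ∑ q ∈ (Icc R (2*R)) ×ˢ (Icc R (2*R)), (4*N^2) ≤ Dv^2*(4*R^2*(4*N^2)) := by
          gcongr; exact hcard _ (by positivity)
      _ ≤ Dv^2*(4*R^2*(4*(2*(N^2/P)))) := by gcongr
      _ = 32*Dv^2*1*(R^2*(N^2/P)) := by ring
      _ ≤ C*Dv^2*L^4*Z := by gcongr; linarith
  push Not at hP2
  set ε := C1*(N/P + w^4/N^3) with hε
  have hε0 : 0 < ε := by positivity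
  have hNε : N*ε = C1*(N^2/P + w^4/N^2) := by rw [hε]; field_simp
  set κ : ℕ → ℕ → ℕ → ℕ → ℝ := fun r s r' s' => (c-3)/6*((((r*s:ℕ):ℝ)/((r'*s':ℕ):ℝ))^α*((r:ℝ)^2+(s:ℝ)^2) - ((r':ℝ)^2+(s':ℝ)^2)/(((r*s:ℕ):ℝ)/((r'*s':ℕ):ℝ))^α) with hκ
  have hT : ∀ r s r' s' : ℕ, R ≤ r*s → r*s ≤ 2*R → R ≤ r'*s' → r'*s' ≤ 2*R → ∀ T : Finset (ℕ×ℕ), (∀ q ∈ T, ((r,s,q.1),(r',s',q.2)) ∈ W) → 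
      ∀ q ∈ T, N ≤ (q.1:ℝ) ∧ (q.1:ℝ) ≤ 2*N ∧ |(2*(q.2:ℝ)+(r'+s':ℕ)) - (((r*s:ℕ):ℝ)/((r'*s':ℕ):ℝ))^α*(2*q.1+(r+s:ℕ)) - κ r s r' s'/(2*q.1+(r+s:ℕ))| ≤ ε := by
    intro r s r' s' g1 g2 g3 g4 T hT q hq
    obtain ⟨_, ⟨w1, w2, w3, w4⟩, ⟨⟨n1, n2⟩, n3, n4⟩, h5⟩ := hW _ (hT q hq)
    simp only at w1 w2 w3 w4 n1 n2 n3 n4 h5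
    refine ⟨n1, n2, ?_⟩
    have hrs : 0 < r*s := by omega
    have hrs' : 0 < r'*s' := by omega
    have := h1 N w R P q.1 r s q.2 r' s' (by linarith) hC1w (by positivity) hP2 n1 n2 n3 n4 
      (Nat.cast_pos.2 (Nat.pos_of_mul_pos_right hrs)) (Nat.cast_pos.2 (Nat.pos_of_mul_pos_left hrs)) (Nat.cast_pos.2 (Nat.pos_of_mul_pos_right hrs')) (Nat.cast_pos.2 (Nat.pos_of_mul_pos_left hrs'))
      w1 w2 w3 w4 (by exact_mod_cast g1) (by exact_mod_cast g2) (by exact_mod_cast g3) (by exact_mod_cast g4) h5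
    rw [hκ]
    push_cast
    rw [← add_assoc, ← add_assoc]
    exact this
  by_cases hε2 : 8*Bt*ε ≤ 1
  · have hNv : 1 ≤ N/v := by
      rw [one_le_div (by positivity)]
      have : v ≤ w^(1:ℝ) := Real.rpow_le_rpow_of_exponent_le hw (by norm_num)
      rw [Real.rpow_one] at this
      linarith
    set I := Nat.log 2 ⌊N/v⌋₊ with hI
    have hfl : 1 ≤ ⌊N/v⌋₊ := by rwa [Nat.one_le_floor_iff]
    have hI1 : (2:ℝ)^I*v ≤ N := by
      rw [← le_div_iff₀ (by positivity)]
      have := Nat.pow_log_le_self 2 (by omega : ⌊N/v⌋₊ ≠ 0)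
      have h3 : (2:ℝ)^I ≤ ⌊N/v⌋₊ := by exact_mod_cast this
      exact h3.trans (Nat.floor_le (by linarith))
    have hI2 : N ≤ 2*2^I*v := by
      rw [← div_le_iff₀ (by positivity)]
      have := Nat.lt_pow_succ_log_self (by norm_num : 1 < 2) ⌊N/v⌋₊
      have h3 : (⌊N/v⌋₊:ℝ) + 1 ≤ 2^(I+1) := by exact_mod_cast this
      have h4 := Nat.lt_floor_add_one (N/v)
      rw [pow_succ] at h3
      linarith
    set J := Nat.log 2 ⌊N⌋₊ + 2 with hJ
    have hflN : 1 ≤ ⌊N⌋₊ := by rwa [Nat.one_le_floor_iff]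
    have hJ1 : 2*N ≤ 2^J := by
      have := Nat.lt_pow_succ_log_self (by norm_num : 1 < 2) ⌊N⌋₊
      have h3 : (⌊N⌋₊:ℝ) + 1 ≤ 2^(Nat.log 2 ⌊N⌋₊+1) := by exact_mod_cast this
      have h4 := Nat.lt_floor_add_one N
      rw [hJ]
      rw [pow_succ] at h3 ⊢
      rw [pow_succ]
      linarith
    have hJ2 : (J:ℝ) ≤ 4*L := by
      have := Nat.pow_log_le_self 2 (by omega : ⌊N⌋₊ ≠ 0)
      have h3 : (2:ℝ)^(Nat.log 2 ⌊N⌋₊) ≤ ⌊N⌋₊ := by exact_mod_cast this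
      have h4 := log_two_pow _ N (h3.trans (Nat.floor_le (by linarith)))
      rw [hJ]; push_cast
      linarith
    have := right_split R hR Dv hD W (fun p hp => (hW p hp).1) (fun a b => 1 + 7*(2*N)/2^I + ∑ i ∈ range I, (65 * ((hset K i (((a:ℝ)/b)^α) (2*ε + Bt*w^2*2^(i+1)/(2*N)^2)).card : ℝ) + 
        64 * ((2*N)/2^i) * ∑ j ∈ range J, (1/2:ℝ)^j * ((hset K i (((a:ℝ)/b)^α) (4*2^j*ε)).card : ℝ))) (fun a b => gexp_nonneg N (((a:ℝ)/b)^α) 0 ε (fun i => 2*ε + Bt*w^2*2^(i+1)/(2*N)^2) K I J hN) (by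
      intro r s r' s' g1 g2 g3 g4 T hTT
      rcases T.eq_empty_or_nonempty with h0 | ⟨q0, hq0⟩
      · rw [h0]; simp only [card_empty, Nat.cast_zero]; exact gexp_nonneg N _ 0 ε (fun i => 2*ε + Bt*w^2*2^(i+1)/(2*N)^2) K I J hN
      obtain ⟨_, ⟨w1, w2, w3, w4⟩, _, _⟩ := hW _ (hTT q0 hq0)
      simp only at w1 w2 w3 w4
      have g1' : (R:ℝ) ≤ (r*s:ℕ) := by exact_mod_cast g1
      have g2' : ((r*s:ℕ):ℝ) ≤ 2*R := by exact_mod_cast g2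
      have g3' : (R:ℝ) ≤ (r'*s':ℕ) := by exact_mod_cast g3
      have g4' : ((r'*s':ℕ):ℝ) ≤ 2*R := by exact_mod_cast g4
      have hb0 : (0:ℝ) < (r'*s':ℕ) := by linarith
      have ha0 : (0:ℝ) < (r*s:ℕ) := by linarith
      set θ := (((r*s:ℕ):ℝ)/((r'*s':ℕ):ℝ))^α with hθ
      have hθ1 : θ ≤ Bt := by
        apply Real.rpow_le_rpow (by positivity) _ hα.le
        rw [div_le_iff₀ hb0]; linarith
      have hθ2 : 1 ≤ Bt*θ := by
        rw [hBt, hθ, ← Real.mul_rpow (by norm_num) (by positivity)]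
        apply Real.one_le_rpow _ hα.le
        rw [mul_div_assoc', one_le_div hb0]; linarith
      have hθ0 : 0 < θ := by positivity
      have hθi : 1/θ ≤ Bt := by rw [div_le_iff₀ hθ0]; exact hθ2
      have hr : (r:ℝ)^2 ≤ w^2 := by gcongr
      have hs : (s:ℝ)^2 ≤ w^2 := by gcongr
      have hr' : (r':ℝ)^2 ≤ w^2 := by gcongr
      have hs' : (s':ℝ)^2 ≤ w^2 := by gcongr
      have hκb : |κ r s r' s'| ≤ Bt*w^2 := by
        have q1 : 0 ≤ θ*((r:ℝ)^2+(s:ℝ)^2) ∧ θ*((r:ℝ)^2+(s:ℝ)^2) ≤ 2*(Bt*w^2) := by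
          refine ⟨by positivity, ?_⟩
          calc θ*((r:ℝ)^2+(s:ℝ)^2) ≤ Bt*(w^2+w^2) := by gcongr
            _ = _ := by ring
        have q2 : 0 ≤ ((r':ℝ)^2+(s':ℝ)^2)/θ ∧ ((r':ℝ)^2+(s':ℝ)^2)/θ ≤ 2*(Bt*w^2) := by
          refine ⟨by positivity, ?_⟩
          calc ((r':ℝ)^2+(s':ℝ)^2)/θ = (1/θ)*((r':ℝ)^2+(s':ℝ)^2) := by ring
            _ ≤ Bt*(w^2+w^2) := by gcongr
            _ = _ := by ring
        have q3 : |θ*((r:ℝ)^2+(s:ℝ)^2) - ((r':ℝ)^2+(s':ℝ)^2)/θ| ≤ 2*(Bt*w^2) := by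
          rw [abs_le]; constructor <;> linarith [q1.1, q1.2, q2.1, q2.2]
        have q4 : |(c-3)/6| ≤ 1/6 := by rw [abs_le]; constructor <;> linarith
        have q5 : 0 ≤ Bt*w^2 := by positivity
        rw [hκ]
        simp only
        rw [abs_mul]
        calc _ ≤ 1/6*(2*(Bt*w^2)) := by gcongr
          _ ≤ _ := by linarith
      have hadd : ((r+s:ℕ):ℝ) ≤ N := by push_cast; linarith
      have hBw2 : 8*Bt*(Bt*w^2) ≤ (2*N)^2 := by
        calc 8*Bt*(Bt*w^2) = 2*(2*Bt*w)^2 := by ring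
          _ ≤ 2*N^2 := by gcongr
          _ ≤ _ := by have := sq_nonneg N; have e : (2*N)^2 = 4*N^2 := by ring
                      linarith
      exact perp_fine N θ (κ r s r' s') ε Bt (r+s) (r'+s') K I J hN hadd hε0 hJ1 hBt1 hKB hθ2 hθ1 hε2 (Bt*w^2) hκb hBw2 T (hT r s r' s' g1 g2 g3 g4 T hTT))
    refine this.trans ?_
    have h3 := h2 R I J ε Bt w N hR hRN hε0 hw (by linarith) hI1 hI2 hJ2
    calc _ ≤ Dv^2 * ((C2*(1+Bt)) * L^4 * (R*N + R^2*v + R^2*(N*ε))) := by gcongr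
      _ ≤ Dv^2 * ((C2*(1+Bt)) * L^4 * (C1*Z)) := by
          gcongr
          rw [hNε, hZ]
          have : R*N ≤ C1*(R*N) := le_mul_of_one_le_left z1 hC1
          have : R^2*v ≤ C1*(R^2*v) := le_mul_of_one_le_left z2 hC1
          linarith
      _ = (C1*(C2*(1+Bt)))*Dv^2*L^4*Z := by ring
      _ ≤ _ := by gcongr; linarith
  · push Not at hε2
    have := right_split R hR Dv hD W (fun p hp => (hW p hp).1) (fun _ _ => 2*N*(1+ε)) (fun _ _ => by positivity) (by
      intro r s r' s' g1 g2 g3 g4 T hTT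
      exact perp_crude N _ _ ε (r+s) (r'+s') hN hε0 T (hT r s r' s' g1 g2 g3 g4 T hTT))
    refine this.trans ?_
    calc Dv^2 * ∑ q ∈ (Icc R (2*R)) ×ˢ (Icc R (2*R)), (2*N*(1+ε)) ≤ Dv^2*(4*R^2*(2*N*(1+ε))) := by
          gcongr; exact hcard _ (by positivity)
      _ ≤ Dv^2*(4*R^2*(2*N*(9*Bt*ε))) := by
          gcongr
          have : 1*ε ≤ Bt*ε := by gcongr
          linarith
      _ = (72*Bt)*Dv^2*1*(R^2*(N*ε)) := by ring
      _ = (C1*(72*Bt))*Dv^2*1*(R^2*(N^2/P) + R^2*(w^4/N^2)) := by rw [hNε]; ring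
      _ ≤ C*Dv^2*L^4*Z := by
          have : C1*(72*Bt) ≤ C := by
            have : C1*(72*Bt) ≤ C1*(100*Bt) := by gcongr; norm_num
            linarith
          gcongr
          linarith

lemma ioc_card_le (a b : ℕ) (Y : ℝ) (hY : (b:ℝ) - a ≤ Y) (hY0 : 0 ≤ Y) : ((Ioc a b).card : ℝ) ≤ Y := by
  rw [Nat.card_Ioc]
  rcases le_total a b with h | h
  · rw [Nat.cast_sub h]; exact hY
  · rw [Nat.sub_eq_zero_of_le h]; simpa using hY0

lemma weyl_e (φ : ℕ → ℝ) (a b : ℕ) (Y : ℝ) (hY : (b:ℝ) - a ≤ Y) (hY0 : 0 ≤ Y) (H : ℕ) (hH : 0 < H) :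
    (H:ℝ) * ‖∑ n ∈ Ioc a b, e (φ n)‖^2 ≤ (Y + H) * (Y + 2 * (∑ d ∈ Ico 1 H, (((1 - (d:ℝ)/H : ℝ)):ℂ) *
        (∑ n ∈ Ioc a (b - d), e (φ (n+d) - φ n))).re) := by
  have hH' : (0:ℝ) < H := by exact_mod_cast hH
  rcases le_or_gt a b with hab | hab
  · have hab' : (a:ℝ) ≤ b := by exact_mod_cast hab
    have := weylN (fun n => e (φ n)) a b hab H hH
    have e1 : (∑ d ∈ Ico 1 H, (((1 - (d:ℝ)/H : ℝ)):ℂ) * (∑ n ∈ Ioc a (b - d), e (φ (n+d) - φ n))).re = 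
       ∑ d ∈ Ico 1 H, (1 - (d:ℝ)/H) * (∑ n ∈ Ioc a (b - d), e (φ (n + d)) * (starRingEnd ℂ) (e (φ n))).re := by
      rw [Complex.re_sum]
      apply Finset.sum_congr rfl
      intro d _
      rw [Complex.re_ofReal_mul]
      congr 2
      apply Finset.sum_congr rfl
      intro n _
      rw [e_conj, ← e_add, sub_eq_add_neg]
    rw [e1]
    simp only [e_norm] at this
    set F := ∑ d ∈ Ico 1 H, (1 - (d:ℝ)/H) * (∑ n ∈ Ioc a (b - d), e (φ (n + d)) * (starRingEnd ℂ) (e (φ n))).re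
    have e2 : ∑ n ∈ Ioc a b, (1:ℝ)^2 = b - a := by simp [Nat.cast_sub hab]
    rw [e2] at this
    have h0 : 0 ≤ ((b:ℝ) - a + H) * ((b:ℝ) - a + 2*F) := le_trans (by positivity) this
    have h1 : 0 ≤ (b:ℝ) - a + 2*F := by
      by_contra hc; push Not at hc
      have : ((b:ℝ) - a + H) * ((b:ℝ) - a + 2*F) < 0 := mul_neg_of_pos_of_neg (by linarith) hc
      linarith
    refine this.trans ?_
    gcongr
  · have h1 : ∀ d, Ioc a (b-d) = ∅ := fun d => Finset.Ioc_eq_empty (by omega)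
    rw [Finset.Ioc_eq_empty (by omega)]
    simp only [h1, sum_empty]
    simp
    positivity

lemma weyl_e_abs (φ : ℕ → ℝ) (a b : ℕ) (Y : ℝ) (hY : (b:ℝ) - a ≤ Y) (hY0 : 0 ≤ Y) (H : ℕ) (hH : 0 < H) :
    (H:ℝ) * ‖∑ n ∈ Ioc a b, e (φ n)‖^2 ≤ (Y + H) * (Y + 2 * ∑ d ∈ Ico 1 H, 
        ‖∑ n ∈ Ioc a (b - d), e (φ (n+d) - φ n)‖) := by
  have hH' : (0:ℝ) < H := by exact_mod_cast hH
  refine (weyl_e φ a b Y hY hY0 H hH).trans ?_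
  gcongr
  rw [Complex.re_sum]
  apply Finset.sum_le_sum
  intro d hd
  rw [mem_Ico] at hd
  have hd2 : (d:ℝ) ≤ H := by exact_mod_cast hd.2.le
  have h1 : (d:ℝ)/H ≤ 1 := by rw [div_le_one hH']; exact hd2
  have h0 : 0 ≤ (d:ℝ)/H := by positivity
  refine (Complex.re_le_norm _).trans ?_
  rw [norm_mul, Complex.norm_real, Real.norm_eq_abs, abs_of_nonneg (by linarith)]
  exact mul_le_of_le_one_left (norm_nonneg _) (by linarith)

lemma sum_norm_sq {ι : Type*} (I : Finset ι) (f : ι → ℝ) : (∑ i ∈ I, f i)^2 ≤ I.card * ∑ i ∈ I, (f i)^2 := sq_sum_le_card_mul_sum_sq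

noncomputable def IL (M : ℝ) (Q : ℕ) : Finset (ℕ×ℕ) := Ico 1 Q ×ˢ Ioc ⌊M⌋₊ ⌊2*M⌋₊

noncomputable def T1 (c x M N : ℝ) (Q : ℕ) : ℝ := ∑ i ∈ IL M Q, ‖∑ n ∈ Ioc ⌊N⌋₊ ⌊2*N⌋₊, e (x * tt c i.2 i.1 * (n:ℝ)^c)‖
noncomputable def T2 (c x M N : ℝ) (Q R₁ : ℕ) : ℝ := ∑ i ∈ IL M Q, ∑ r ∈ Ico 1 R₁, ‖∑ n ∈ Ioc ⌊N⌋₊ (⌊2*N⌋₊ - r), e (x * tt c i.2 i.1 * tt c n r)‖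
noncomputable def T3 (c x M N : ℝ) (Q R₁ R₂ : ℕ) : ℝ := ‖∑ i ∈ IL M Q, ∑ r ∈ Ico 1 R₁, ∑ s ∈ Ico 1 R₂, (((1 - (s:ℝ)/R₂ : ℝ)):ℂ) * 
   ∑ n ∈ Ioc ⌊N⌋₊ (⌊2*N⌋₊ - r - s), e (x * tt c i.2 i.1 * ss c n r s)‖

lemma floor_len (M : ℝ) (hM : 1 ≤ M) : ((⌊2*M⌋₊:ℕ):ℝ) - (⌊M⌋₊:ℕ) ≤ 2*M := by
  have h1 := Nat.floor_le (by linarith : 0 ≤ 2*M)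
  have h2 : (0:ℝ) ≤ (⌊M⌋₊:ℕ) := by positivity
  linarith

lemma floor_mono2 (M : ℝ) (hM : 1 ≤ M) : ⌊M⌋₊ ≤ ⌊2*M⌋₊ := Nat.floor_le_floor (by linarith)

lemma IL_card (M : ℝ) (hM : 1 ≤ M) (Q : ℕ) : ((IL M Q).card : ℝ) ≤ 2*Q*M := by
  rw [IL, card_product]
  push_cast
  have h1 : ((Ico 1 Q).card : ℝ) ≤ Q := by rw [Nat.card_Ico]; exact_mod_cast Nat.sub_le _ _
  have h2 := ioc_card_le ⌊M⌋₊ ⌊2*M⌋₊ (2*M) (floor_len M hM) (by linarith)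
  calc _ ≤ (Q:ℝ)*(2*M) := by gcongr
    _ = _ := by ring

lemma step3 (c x M N : ℝ) (Q R₁ R₂ : ℕ) (hM : 1 ≤ M) (hN : 1 ≤ N) (hR₂ : 0 < R₂) (hRN : (R₂:ℝ) ≤ N) :
    R₂ * (T2 c x M N Q R₁)^2 ≤ (2*Q*M*R₁)*(3*N*(2*N*(2*Q*M*R₁) + 2*T3 c x M N Q R₁ R₂)) := by
  have hT2 : T2 c x M N Q R₁ = ∑ j ∈ IL M Q ×ˢ Ico 1 R₁, ‖∑ n ∈ Ioc ⌊N⌋₊ (⌊2*N⌋₊ - j.2), e (x * tt c j.1.2 j.1.1 * tt c n j.2)‖ := by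
    rw [T2, Finset.sum_product]
  have hcard : (((IL M Q ×ˢ Ico 1 R₁).card : ℕ):ℝ) ≤ 2*Q*M*R₁ := by
    rw [card_product]; push_cast
    have h1 : ((Ico 1 R₁).card : ℝ) ≤ R₁ := by rw [Nat.card_Ico]; exact_mod_cast Nat.sub_le _ _
    have := IL_card M hM Q
    gcongr
  set A : ℝ := 2*Q*M*R₁ with hA
  have hA0 : 0 ≤ A := by positivity
  set Jx := IL M Q ×ˢ Ico 1 R₁ with hJ
  set G : (ℕ×ℕ)×ℕ → ℂ := fun j => ∑ s ∈ Ico 1 R₂, (((1 - (s:ℝ)/R₂ : ℝ)):ℂ) * ∑ n ∈ Ioc ⌊N⌋₊ (⌊2*N⌋₊ - j.2 - s), e (x * tt c j.1.2 j.1.1 * ss c n j.2 s) with hG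
  have hT3 : ‖∑ j ∈ Jx, G j‖ = T3 c x M N Q R₁ R₂ := by
    rw [T3, hJ, Finset.sum_product]
  have hj : ∀ j ∈ Jx, (R₂:ℝ) * ‖∑ n ∈ Ioc ⌊N⌋₊ (⌊2*N⌋₊ - j.2), e (x * tt c j.1.2 j.1.1 * tt c n j.2)‖^2 ≤ 3*N*(2*N + 2*(G j).re) := by
    intro j _
    have h := weyl_e (fun n => x * tt c j.1.2 j.1.1 * tt c n j.2) ⌊N⌋₊ (⌊2*N⌋₊ - j.2) (2*N) (by
      have h1 := floor_len N hN
      have h2 : ((⌊2*N⌋₊ - j.2 : ℕ):ℝ) ≤ (⌊2*N⌋₊:ℕ) := by exact_mod_cast Nat.sub_le _ _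
      linarith) (by linarith) R₂ hR₂
    have e1 : (∑ d ∈ Ico 1 R₂, (((1 - (d:ℝ)/R₂ : ℝ)):ℂ) * (∑ n ∈ Ioc ⌊N⌋₊ (⌊2*N⌋₊ - j.2 - d), e (x * tt c j.1.2 j.1.1 * tt c ((n+d:ℕ):ℝ) j.2 - x * tt c j.1.2 j.1.1 * tt c n j.2))) = G j := by
      rw [hG]
      apply Finset.sum_congr rfl
      intro d _
      congr 1
      apply Finset.sum_congr rfl
      intro n _
      congr 1
      rw [← mul_sub]
      congr 1
      unfold tt ss
      push_cast
      have : (n:ℝ)+d+j.2 = n+j.2+d := by ring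
      rw [this]; ring
    rw [e1] at h
    have h0 : 0 ≤ 2*N + 2*(G j).re := by
      by_contra hc; push Not at hc
      have h3 : (2*N+(R₂:ℝ)) * (2*N + 2*(G j).re) < 0 := mul_neg_of_pos_of_neg (by positivity) hc
      have h4 : 0 ≤ (R₂:ℝ) * ‖∑ n ∈ Ioc ⌊N⌋₊ (⌊2*N⌋₊ - j.2), e (x * tt c j.1.2 j.1.1 * tt c n j.2)‖^2 := by positivity
      linarith
    refine h.trans ?_
    gcongr
    linarith
  have hs := Finset.sum_le_sum hj
  rw [← Finset.mul_sum, ← Finset.mul_sum, Finset.sum_add_distrib, Finset.sum_const, nsmul_eq_mul, ← Finset.mul_sum, ← Complex.re_sum] at hs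
  have hre := (Complex.re_le_norm (∑ j ∈ Jx, G j))
  rw [hT3] at hre
  have hT30 : 0 ≤ T3 c x M N Q R₁ R₂ := norm_nonneg _
  rw [hT2]
  have hcs := sum_norm_sq Jx (fun j => ‖∑ n ∈ Ioc ⌊N⌋₊ (⌊2*N⌋₊ - j.2), e (x * tt c j.1.2 j.1.1 * tt c n j.2)‖)
  set S2 := ∑ j ∈ Jx, ‖∑ n ∈ Ioc ⌊N⌋₊ (⌊2*N⌋₊ - j.2), e (x * tt c j.1.2 j.1.1 * tt c n j.2)‖^2
  have hS2 : 0 ≤ S2 := Finset.sum_nonneg (fun _ _ => by positivity)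
  calc _ ≤ (R₂:ℝ) * (Jx.card * S2) := by gcongr
    _ = Jx.card * (R₂*S2) := by ring
    _ ≤ Jx.card * (3*N*(Jx.card*(2*N) + 2*(∑ j ∈ Jx, G j).re)) := by gcongr
    _ ≤ Jx.card * (3*N*(2*N*A + 2*T3 c x M N Q R₁ R₂)) := by
        have : (Jx.card:ℝ)*(2*N) ≤ 2*N*A := by rw [mul_comm]; gcongr
        gcongr
    _ ≤ _ := by gcongr

lemma step2 (c x M N : ℝ) (Q R₁ : ℕ) (hM : 1 ≤ M) (hN : 1 ≤ N) (hR₁ : 0 < R₁) (hRN : (R₁:ℝ) ≤ N) :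
    R₁ * (T1 c x M N Q)^2 ≤ (2*Q*M)*(3*N*(2*N*(2*Q*M) + 2*T2 c x M N Q R₁)) := by
  have hcard := IL_card M hM Q
  set A : ℝ := 2*Q*M with hA
  have hA0 : 0 ≤ A := by positivity
  set Jx := IL M Q with hJ
  have hj : ∀ i ∈ Jx, (R₁:ℝ) * ‖∑ n ∈ Ioc ⌊N⌋₊ ⌊2*N⌋₊, e (x * tt c i.2 i.1 * (n:ℝ)^c)‖^2 ≤ 3*N*(2*N + 2*∑ r ∈ Ico 1 R₁, ‖∑ n ∈ Ioc ⌊N⌋₊ (⌊2*N⌋₊ - r), e (x * tt c i.2 i.1 * tt c n r)‖) := by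
    intro i _
    have h := weyl_e_abs (fun n => x * tt c i.2 i.1 * (n:ℝ)^c) ⌊N⌋₊ ⌊2*N⌋₊ (2*N) (floor_len N hN) (by linarith) R₁ hR₁
    have e1 : ∀ (r n : ℕ), x * tt c i.2 i.1 * ((n+r:ℕ):ℝ)^c - x * tt c i.2 i.1 * (n:ℝ)^c = x * tt c i.2 i.1 * tt c n r := by
      intro r n
      have : tt c (n:ℝ) r = ((n:ℝ)+r)^c - (n:ℝ)^c := rfl
      rw [this]; push_cast; ring
    simp only [e1] at h
    refine h.trans ?_
    gcongr
    linarith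
  have hs := Finset.sum_le_sum hj
  rw [← Finset.mul_sum, ← Finset.mul_sum, Finset.sum_add_distrib, Finset.sum_const, nsmul_eq_mul, ← Finset.mul_sum] at hs
  have hT20 : 0 ≤ T2 c x M N Q R₁ := Finset.sum_nonneg (fun _ _ => Finset.sum_nonneg (fun _ _ => norm_nonneg _))
  have hcs := sum_norm_sq Jx (fun i => ‖∑ n ∈ Ioc ⌊N⌋₊ ⌊2*N⌋₊, e (x * tt c i.2 i.1 * (n:ℝ)^c)‖)
  change R₁ * (∑ i ∈ Jx, ‖∑ n ∈ Ioc ⌊N⌋₊ ⌊2*N⌋₊, e (x * tt c i.2 i.1 * (n:ℝ)^c)‖)^2 ≤ _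
  set S2 := ∑ i ∈ Jx, ‖∑ n ∈ Ioc ⌊N⌋₊ ⌊2*N⌋₊, e (x * tt c i.2 i.1 * (n:ℝ)^c)‖^2
  have hS2 : 0 ≤ S2 := Finset.sum_nonneg (fun _ _ => by positivity)
  calc _ ≤ (R₁:ℝ) * (Jx.card * S2) := by gcongr
    _ = Jx.card * (R₁*S2) := by ring
    _ ≤ Jx.card * (3*N*(Jx.card*(2*N) + 2*T2 c x M N Q R₁)) := by
        exact mul_le_mul_of_nonneg_left hs (by positivity)
    _ ≤ Jx.card * (3*N*(2*N*A + 2*T2 c x M N Q R₁)) := by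
        have : (Jx.card:ℝ)*(2*N) ≤ 2*N*A := by rw [mul_comm]; gcongr
        gcongr
    _ ≤ _ := by gcongr

lemma step1 (c x M N : ℝ) (Q : ℕ) (a b : ℕ → ℂ) (ha : ∀ m, ‖a m‖ ≤ 1) (hb : ∀ n, ‖b n‖ ≤ 1) (hM : 1 ≤ M) (hN : 1 ≤ N) (hQ : 0 < Q) (hQM : (Q:ℝ) ≤ M) :
    Q * ‖∑ m ∈ Ioc ⌊M⌋₊ ⌊2*M⌋₊, ∑ n ∈ Ioc ⌊N⌋₊ ⌊2*N⌋₊, a m * b n * e (x * (m:ℝ)^c * (n:ℝ)^c)‖^2 ≤ (2*N)*(3*M*((2*N)*(2*M) + 2*T1 c x M N Q)) := by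
  set IN := Ioc ⌊N⌋₊ ⌊2*N⌋₊ with hIN
  set IM := Ioc ⌊M⌋₊ ⌊2*M⌋₊ with hIM
  have hcN : ((IN.card:ℕ):ℝ) ≤ 2*N := ioc_card_le _ _ _ (floor_len N hN) (by linarith)
  have hcM : ((IM.card:ℕ):ℝ) ≤ 2*M := ioc_card_le _ _ _ (floor_len M hM) (by linarith)
  set z : ℕ → ℕ → ℂ := fun n m => a m * e (x * (m:ℝ)^c * (n:ℝ)^c) with hz
  have hz1 : ∀ n m, ‖z n m‖ ≤ 1 := by intro n m; rw [hz]; simp only [norm_mul, e_norm, mul_one]; exact ha m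
  have hS : ‖∑ m ∈ IM, ∑ n ∈ IN, a m * b n * e (x * (m:ℝ)^c * (n:ℝ)^c)‖ ≤ ∑ n ∈ IN, ‖∑ m ∈ IM, z n m‖ := by
    rw [Finset.sum_comm]
    refine (norm_sum_le _ _).trans ?_
    apply Finset.sum_le_sum
    intro n _
    have : ∑ m ∈ IM, a m * b n * e (x * (m:ℝ)^c * (n:ℝ)^c) = b n * ∑ m ∈ IM, z n m := by
      rw [Finset.mul_sum]; apply Finset.sum_congr rfl; intro m _; rw [hz]; ring
    rw [this, norm_mul]
    exact mul_le_of_le_one_left (norm_nonneg _) (hb n)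
  have hQ' : (0:ℝ) < Q := by exact_mod_cast hQ
  set W : ℕ → ℕ → ℂ := fun n q => ∑ m ∈ Ioc ⌊M⌋₊ (⌊2*M⌋₊ - q), z n (m+q) * (starRingEnd ℂ) (z n m) with hW
  have hn : ∀ n ∈ IN, (Q:ℝ) * ‖∑ m ∈ IM, z n m‖^2 ≤ 3*M*(2*M + 2*∑ q ∈ Ico 1 Q, (1-(q:ℝ)/Q)*(W n q).re) := by
    intro n _
    have h := weylN (z n) ⌊M⌋₊ ⌊2*M⌋₊ (floor_mono2 M hM) Q hQ
    have h1 := floor_len M hM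
    have h2 : ((⌊M⌋₊:ℕ):ℝ) ≤ (⌊2*M⌋₊:ℕ) := by exact_mod_cast floor_mono2 M hM
    have h3 : ∑ m ∈ IM, ‖z n m‖^2 ≤ 2*M := by
      calc ∑ m ∈ IM, ‖z n m‖^2 ≤ ∑ m ∈ IM, 1 := by
            apply Finset.sum_le_sum; intro m _
            exact pow_le_one₀ (norm_nonneg _) (hz1 n m)
        _ = IM.card := by simp
        _ ≤ _ := hcM
    set F := ∑ q ∈ Ico 1 Q, (1-(q:ℝ)/Q)*(W n q).re
    have h5 : 0 ≤ (∑ m ∈ IM, ‖z n m‖^2) + 2*F := by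
      by_contra hc; push Not at hc
      have h6 : (((⌊2*M⌋₊:ℕ):ℝ) - (⌊M⌋₊:ℕ) + Q) * ((∑ m ∈ IM, ‖z n m‖^2) + 2*F) < 0 := mul_neg_of_pos_of_neg (by linarith) hc
      have h4 : 0 ≤ (Q:ℝ) * ‖∑ m ∈ IM, z n m‖^2 := by positivity
      linarith
    refine h.trans ?_
    change (((⌊2*M⌋₊:ℕ):ℝ) - (⌊M⌋₊:ℕ) + Q) * ((∑ m ∈ IM, ‖z n m‖^2) + 2*F) ≤ _
    gcongr
    linarith
  have hs := Finset.sum_le_sum hn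
  rw [← Finset.mul_sum, ← Finset.mul_sum, Finset.sum_add_distrib, Finset.sum_const, nsmul_eq_mul, ← Finset.mul_sum, Finset.sum_comm] at hs
  have hT1 : ∑ q ∈ Ico 1 Q, ∑ n ∈ IN, (1-(q:ℝ)/Q)*(W n q).re ≤ T1 c x M N Q := by
    rw [T1, IL, Finset.sum_product]
    apply Finset.sum_le_sum
    intro q hq
    rw [mem_Ico] at hq
    have hd2 : (q:ℝ) ≤ Q := by exact_mod_cast hq.2.le
    have h1 : (q:ℝ)/Q ≤ 1 := by rw [div_le_one hQ']; exact hd2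
    have h0 : 0 ≤ (q:ℝ)/Q := by positivity
    rw [← Finset.mul_sum, ← Complex.re_sum]
    have h2 : ‖∑ n ∈ IN, W n q‖ ≤ ∑ m ∈ IM, ‖∑ n ∈ IN, e (x * tt c m q * (n:ℝ)^c)‖ := by
      have e1 : ∑ n ∈ IN, W n q = ∑ m ∈ Ioc ⌊M⌋₊ (⌊2*M⌋₊ - q), (a (m+q) * (starRingEnd ℂ) (a m)) * ∑ n ∈ IN, e (x * tt c m q * (n:ℝ)^c) := by
        rw [hW, Finset.sum_comm]
        apply Finset.sum_congr rfl
        intro m _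
        rw [Finset.mul_sum]
        apply Finset.sum_congr rfl
        intro n _
        simp only [hz]
        rw [map_mul, e_conj]
        have : e (x * tt c m q * (n:ℝ)^c) = e (x * ((m+q:ℕ):ℝ)^c * (n:ℝ)^c) * e (-(x * (m:ℝ)^c * (n:ℝ)^c)) := by
          rw [← e_add]; congr 1; unfold tt; push_cast; ring
        rw [this]; ring
      rw [e1]
      refine (norm_sum_le _ _).trans ?_
      calc _ ≤ ∑ m ∈ Ioc ⌊M⌋₊ (⌊2*M⌋₊ - q), ‖∑ n ∈ IN, e (x * tt c m q * (n:ℝ)^c)‖ := by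
            apply Finset.sum_le_sum
            intro m _
            rw [norm_mul, norm_mul, RCLike.norm_conj]
            apply mul_le_of_le_one_left (norm_nonneg _)
            exact mul_le_one₀ (ha _) (norm_nonneg _) (ha _)
        _ ≤ _ := by
            apply Finset.sum_le_sum_of_subset_of_nonneg
            · exact Finset.Ioc_subset_Ioc_right (Nat.sub_le _ _)
            · intro _ _ _; exact norm_nonneg _
    refine le_trans ?_ h2
    refine le_trans ?_ (mul_le_of_le_one_left (norm_nonneg _) (by linarith : 1-(q:ℝ)/Q ≤ 1))
    exact mul_le_mul_of_nonneg_left (Complex.re_le_norm _) (by linarith)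
  have hcs := sum_norm_sq IN (fun n => ‖∑ m ∈ IM, z n m‖)
  have hT10 : 0 ≤ T1 c x M N Q := Finset.sum_nonneg (fun _ _ => norm_nonneg _)
  set S2 := ∑ n ∈ IN, ‖∑ m ∈ IM, z n m‖^2
  have hS2 : 0 ≤ S2 := Finset.sum_nonneg (fun _ _ => by positivity)
  calc _ ≤ (Q:ℝ) * (∑ n ∈ IN, ‖∑ m ∈ IM, z n m‖)^2 := by gcongr
    _ ≤ (Q:ℝ) * (IN.card * S2) := by gcongr
    _ = IN.card * (Q*S2) := by ring
    _ ≤ IN.card * (3*M*(IN.card*(2*M) + 2*T1 c x M N Q)) := by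
        exact mul_le_mul_of_nonneg_left (hs.trans (by gcongr)) (by positivity)
    _ ≤ _ := by gcongr

lemma chain (c x M N Y : ℝ) (Q R₁ R₂ : ℕ) (a b : ℕ → ℂ) (ha : ∀ m, ‖a m‖ ≤ 1) (hb : ∀ n, ‖b n‖ ≤ 1) (hM : 1 ≤ M) (hN : 1 ≤ N)
   (hQ : 0 < Q) (hQM : (Q:ℝ) ≤ M) (hR₁ : 0 < R₁) (hR₁N : (R₁:ℝ) ≤ N) (hR₂ : 0 < R₂) (hR₂N : (R₂:ℝ) ≤ N) (hY : 0 < Y)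
   (hQY : 1 ≤ Q*Y^2) (hR₁Y : 1 ≤ R₁*Y^4) (hR₂Y : 1 ≤ R₂*Y^8)
   (h : T1 c x M N Q ≤ Q*M*N*Y^2 ∨ T2 c x M N Q R₁ ≤ Q*M*N*R₁*Y^4 ∨ T3 c x M N Q R₁ R₂ ≤ Q*M*N*R₁*R₂*Y^8) :
    ‖∑ m ∈ Ioc ⌊M⌋₊ ⌊2*M⌋₊, ∑ n ∈ Ioc ⌊N⌋₊ ⌊2*N⌋₊, a m * b n * e (x * (m:ℝ)^c * (n:ℝ)^c)‖ ≤ 12*M*N*Y := by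
  have hQ' : (0:ℝ) < Q := by exact_mod_cast hQ
  have hR₁' : (0:ℝ) < R₁ := by exact_mod_cast hR₁
  have hR₂' : (0:ℝ) < R₂ := by exact_mod_cast hR₂
  have p0 : 0 < Q*M*N*R₁ := by positivity
  have s3 : T3 c x M N Q R₁ R₂ ≤ Q*M*N*R₁*R₂*Y^8 → T2 c x M N Q R₁ ≤ 6*(Q*M*N*R₁*Y^4) := by
    intro h
    have h1 := step3 c x M N Q R₁ R₂ hM hN hR₂ hR₂N
    apply le_of_sq_le_sq _ (by positivity)
    apply le_of_mul_le_mul_left _ hR₂'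
    refine h1.trans ?_
    have e1 : 2*N*(2*Q*M*R₁) ≤ 4*(Q*M*N*R₁)*(R₂*Y^8) := by
      have := mul_le_mul_of_nonneg_left hR₂Y p0.le
      linarith
    calc _ ≤ (2*Q*M*R₁)*(3*N*(4*(Q*M*N*R₁)*(R₂*Y^8) + 2*(Q*M*N*R₁*R₂*Y^8))) := by gcongr
      _ = R₂*(6*(Q*M*N*R₁*Y^4))^2 := by ring
  have s2 : T2 c x M N Q R₁ ≤ 6*(Q*M*N*R₁*Y^4) → T1 c x M N Q ≤ 10*(Q*M*N*Y^2) := by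
    intro h
    have h1 := step2 c x M N Q R₁ hM hN hR₁ hR₁N
    apply le_of_sq_le_sq _ (by positivity)
    apply le_of_mul_le_mul_left _ hR₁'
    refine h1.trans ?_
    have e1 : 2*N*(2*Q*M) ≤ 4*(Q*M*N)*(R₁*Y^4) := by
      have := mul_le_mul_of_nonneg_left hR₁Y (by positivity : 0 ≤ Q*M*N)
      linarith
    have e2 : 0 ≤ (Q*M*N)^2*(R₁*Y^4) := by positivity
    calc _ ≤ (2*Q*M)*(3*N*(4*(Q*M*N)*(R₁*Y^4) + 2*(6*(Q*M*N*R₁*Y^4)))) := by gcongr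
      _ = 96*((Q*M*N)^2*(R₁*Y^4)) := by ring
      _ ≤ 100*((Q*M*N)^2*(R₁*Y^4)) := by linarith
      _ = R₁*(10*(Q*M*N*Y^2))^2 := by ring
  have s1 : T1 c x M N Q ≤ 10*(Q*M*N*Y^2) := by
    rcases h with h | h | h
    · have : 0 ≤ Q*M*N*Y^2 := by positivity
      linarith
    · apply s2
      have : 0 ≤ Q*M*N*R₁*Y^4 := by positivity
      linarith
    · exact s2 (s3 h)
  have h1 := step1 c x M N Q a b ha hb hM hN hQ hQM
  apply le_of_sq_le_sq _ (by positivity)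
  apply le_of_mul_le_mul_left _ hQ'
  refine h1.trans ?_
  have e1 : (2*N)*(2*M) ≤ 4*(M*N)*(Q*Y^2) := by
    have := mul_le_mul_of_nonneg_left hQY (by positivity : 0 ≤ M*N)
    linarith
  calc _ ≤ (2*N)*(3*M*(4*(M*N)*(Q*Y^2) + 2*(10*(Q*M*N*Y^2)))) := by gcongr
    _ = Q*(12*M*N*Y)^2 := by ring

lemma e_sum_neg (s : Finset ℕ) (f : ℕ → ℝ) : ‖∑ n ∈ s, e (-(f n))‖ = ‖∑ n ∈ s, e (f n)‖ := by
  have : ∑ n ∈ s, e (-(f n)) = (starRingEnd ℂ) (∑ n ∈ s, e (f n)) := by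
    rw [map_sum]; exact Finset.sum_congr rfl (fun n _ => (e_conj _).symm)
  rw [this, RCLike.norm_conj]

lemma rpow_box (p N ξ : ℝ) (hN : 0 < N) (h1 : N ≤ ξ) (h2 : ξ ≤ 4 * N) :
    (4:ℝ)^(-|p|) * N^p ≤ ξ^p ∧ ξ^p ≤ 4^|p| * N^p := by
  have hξ : ξ = (ξ/N) * N := by field_simp
  have h3 : 1 ≤ ξ/N := by rw [le_div_iff₀ hN]; linarith
  have h4 : ξ/N ≤ 4 := by rw [div_le_iff₀ hN]; linarith
  have h0 : 0 < ξ/N := by linarith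
  have hp : 0 < N^p := Real.rpow_pos_of_pos hN p
  rw [hξ, Real.mul_rpow h0.le hN.le]
  have key : (ξ/N)^p ≤ 4^|p| := by
    calc (ξ/N)^p ≤ (ξ/N)^|p| := Real.rpow_le_rpow_of_exponent_le h3 (le_abs_self p)
      _ ≤ 4^|p| := Real.rpow_le_rpow h0.le h4 (abs_nonneg p)
  have key2 : (4:ℝ)^(-|p|) ≤ (ξ/N)^p := by
    calc (4:ℝ)^(-|p|) ≤ (ξ/N)^(-|p|) := Real.rpow_le_rpow_of_nonpos h0 h4 (by linarith [abs_nonneg p])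
      _ ≤ (ξ/N)^p := Real.rpow_le_rpow_of_exponent_le h3 (neg_abs_le p)
  exact ⟨mul_le_mul_of_nonneg_right key2 hp.le, mul_le_mul_of_nonneg_right key hp.le⟩

lemma vdc_fin (N l A d S : ℝ) (hN : 1 ≤ N) (hl : 0 < l) (hA : 1 ≤ A) (hd : 0 < d) (L : ℝ) (hL : 0 ≤ L) (hLN : L ≤ 4 * N)
   (hS1 : S ≤ L) (hS : d * l ≤ 1 → S ≤ 16 * A * (L * Real.sqrt (d*l) + 1/Real.sqrt (d*l))) :
   S ≤ (64 * A * (Real.sqrt d + 1/Real.sqrt d)) * (N * Real.sqrt l + 1 / Real.sqrt l) := by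
  have hsd : 0 < Real.sqrt d := Real.sqrt_pos.mpr hd
  have hsl : 0 < Real.sqrt l := Real.sqrt_pos.mpr hl
  have hm : Real.sqrt (d*l) = Real.sqrt d * Real.sqrt l := Real.sqrt_mul hd.le l
  rcases le_or_gt (d*l) 1 with h | h
  · have := hS h
    rw [hm] at this
    have e1 : L * (Real.sqrt d * Real.sqrt l) ≤ 4 * Real.sqrt d * (N * Real.sqrt l) := by
      calc L * (Real.sqrt d * Real.sqrt l) ≤ (4*N) * (Real.sqrt d * Real.sqrt l) := by gcongr
        _ = _ := by ring
    have e2 : 1 / (Real.sqrt d * Real.sqrt l) = (1/Real.sqrt d) * (1/Real.sqrt l) := by field_simp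
    have p1 : 0 < N * Real.sqrt l := by positivity
    have p2 : 0 < 1 / Real.sqrt l := by positivity
    have p3 : 0 < 1 / Real.sqrt d := by positivity
    set u := N * Real.sqrt l
    set v := 1 / Real.sqrt l
    set a := Real.sqrt d
    set b := 1 / Real.sqrt d
    calc S ≤ 16 * A * (4 * a * u + b * v) := by
            refine this.trans ?_
            rw [e2]; gcongr
      _ ≤ 16 * A * (4 * a * u + b * v + (4 * a * v + 4 * b * u + 3 * b * v)) := by
            have : 0 ≤ (4 * a * v + 4 * b * u + 3 * b * v) := by positivity
            refine mul_le_mul_of_nonneg_left ?_ (by positivity); linarith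
      _ = _ := by ring
  · have h1 : 1 ≤ Real.sqrt d * Real.sqrt l := by
      rw [← hm]; exact Real.one_le_sqrt.mpr h.le
    have p2 : 0 < 1 / Real.sqrt l := by positivity
    have p3 : 0 < 1 / Real.sqrt d := by positivity
    calc S ≤ 4 * 1 * N * 1 := by linarith
      _ ≤ 64 * A * N * (Real.sqrt d * Real.sqrt l) := by gcongr; norm_num
      _ = 64 * A * (Real.sqrt d) * (N * Real.sqrt l) := by ring
      _ ≤ _ := by
        have p4 : 0 ≤ Real.sqrt l := hsl.le
        gcongr
        · linarith
        · linarith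

lemma vdcg (c : ℝ) (k : ℕ) (hk : dpo c (k+2) ≠ 0) : ∃ C ≥ (1:ℝ), ∀ (t : List ℝ) (N u : ℝ) (a b : ℕ), t.length = k → (∀ h ∈ t, 0 < h) →
    1 ≤ N → 0 < u → N ≤ a + 1 → (a < b → (b:ℝ) + t.sum + 1 ≤ 4 * N) →
    ‖∑ n ∈ Ioc a b, e (u * dif t (fun y => y^c) n)‖ ≤ C * (N * Real.sqrt (u * t.prod * N^(c-k-2)) + 1 / Real.sqrt (u * t.prod * N^(c-k-2))) := by
  set p := c - k - 2 with hp
  set d0 := |dpo c (k+2)| with hd0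
  have hd0' : 0 < d0 := abs_pos.mpr hk
  set d := d0 * 4^(-|p|) with hd
  have h4 : (0:ℝ) < 4^(-|p|) := by positivity
  have hdp : 0 < d := by positivity
  set A := (16:ℝ)^|p| with hA
  have hA1 : 1 ≤ A := Real.one_le_rpow (by norm_num) (abs_nonneg p)
  have hA4 : A * 4^(-|p|) = 4^|p| := by
    rw [hA, Real.rpow_neg (by norm_num), show (16:ℝ) = 4*4 by norm_num, Real.mul_rpow (by norm_num) (by norm_num)]
    field_simp
  refine ⟨max 1 (64 * A * (Real.sqrt d + 1/Real.sqrt d)), le_max_left _ _, ?_⟩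
  intro t N u a b hlen ht hN hu ha hb
  have htp : 0 < t.prod := by
    apply List.prod_pos; exact ht
  have hN0 : 0 < N := by linarith
  set l := u * t.prod * N^p with hl
  have hl0 : 0 < l := by positivity
  have hpos : 0 ≤ N * Real.sqrt l + 1 / Real.sqrt l := by positivity
  refine le_trans ?_ (mul_le_mul_of_nonneg_right (le_max_right _ _) hpos)
  rcases le_or_gt b a with hba | hab
  · rw [Finset.Ioc_eq_empty (by omega)]; simp only [sum_empty, norm_zero]; positivity
  have hb := hb hab
  have hts : 0 ≤ t.sum := List.sum_nonneg (fun h hh => (ht h hh).le)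
  have hab' : (a:ℝ) ≤ b := by exact_mod_cast hab.le
  have ha0 : (0:ℝ) ≤ a := by positivity
  refine vdc_fin N l A d _ hN hl0 hA1 hdp ((b:ℝ)-a) (by linarith) (by linarith) ?_ ?_
  · refine (norm_sum_le _ _).trans ?_
    simp only [e_norm]
    simp [Nat.cast_sub hab.le]
  · intro hdl
    -- sign
    obtain ⟨σ, hσ, hσd⟩ : ∃ σ : ℝ, (σ = 1 ∨ σ = -1) ∧ σ * dpo c (k+2) = d0 := by
      rcases le_total 0 (dpo c (k+2)) with h | h
      · exact ⟨1, Or.inl rfl, by rw [hd0, abs_of_nonneg h]; ring⟩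
      · exact ⟨-1, Or.inr rfl, by rw [hd0, abs_of_nonpos h]; ring⟩
    have hnorm : ‖∑ n ∈ Ioc a b, e (u * dif t (fun y => y^c) n)‖ = ‖∑ n ∈ Ioc a b, e (σ * (u * dif t (fun y => y^c) n))‖ := by
      rcases hσ with h | h
      · simp [h]
      · rw [h, ← e_sum_neg]; simp
    rw [hnorm]
    refine vdc2 (fun n : ℕ => σ * (u * dif t (fun y => y^c) n)) a b hab.le A (d*l) hA1 (by positivity) hdl ?_
    intro n h1 h2
    have h1' : (a:ℝ) + 1 ≤ n := by exact_mod_cast h1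
    have h2' : (n:ℝ) + 1 ≤ b := by exact_mod_cast h2
    obtain ⟨ξ, hξ1, hξ2, hξ⟩ := dif_rpow (1::1::t) (by intro h hh; simp only [List.mem_cons] at hh; rcases hh with h' | h' | h' <;> first | linarith | exact ht h h') c n (by linarith)
    have hD : dif (1::1::t) (fun y => y^c) n = dif t (fun y => y^c) ((n:ℝ)+2) - 2 * dif t (fun y => y^c) ((n:ℝ)+1) + dif t (fun y => y^c) n := by
      simp only [dif]
      rw [show (n:ℝ) + 1 + 1 = n + 2 by ring]; ring
    have hE : σ * (u * dif t (fun y => y^c) ((n+2:ℕ):ℝ)) - 2 * (σ * (u * dif t (fun y => y^c) ((n+1:ℕ):ℝ))) + σ * (u * dif t (fun y => y^c) n)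
       = u * t.prod * d0 * ξ^p := by
      push_cast
      have : σ * (u * dif t (fun y => y^c) ((n:ℝ)+2)) - 2 * (σ * (u * dif t (fun y => y^c) ((n:ℝ)+1))) + σ * (u * dif t (fun y => y^c) n)
        = σ * u * dif (1::1::t) (fun y => y^c) n := by rw [hD]; ring
      rw [this, hξ, ← hσd]
      simp only [List.prod_cons, List.length_cons, hlen]
      have : c - ((k + 1 + 1 : ℕ):ℝ) = p := by rw [hp]; push_cast; ring
      rw [this]; ring
    simp only [List.sum_cons] at hξ2
    obtain ⟨b1, b2⟩ := rpow_box p N ξ hN0 (by linarith) (by linarith)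
    have hut : 0 < u * t.prod * d0 := by positivity
    constructor
    · calc d * l = u * t.prod * d0 * (4^(-|p|) * N^p) := by rw [hd, hl]; ring
        _ ≤ u * t.prod * d0 * ξ^p := by gcongr
        _ = _ := hE.symm
    · calc _ = u * t.prod * d0 * ξ^p := hE
        _ ≤ u * t.prod * d0 * (4^|p| * N^p) := by gcongr
        _ = _ := by rw [← hA4, hd, hl]; ring

lemma tt_dif (c m q : ℝ) : tt c m q = dif [q] (fun y => y^c) m := by simp [tt, dif]
lemma ss_dif (c n r s : ℝ) : ss c n r s = dif [r, s] (fun y => y^c) n := by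
  simp [ss, dif]; ring

lemma tt_ub (c : ℝ) (hc : 2 < c) : ∃ C ≥ (1:ℝ), ∀ m q M : ℝ, 0 < M → M ≤ m → m ≤ 2 * M → 0 < q → q ≤ M → tt c m q ≤ C * (q * M^(c-1)) := by
  refine ⟨max 1 (c * 4^|c-1|), le_max_left _ _, ?_⟩
  intro m q M hM h1 h2 hq hqM
  have h0 : 0 < q * M^(c-1) := by positivity
  refine le_trans ?_ (mul_le_mul_of_nonneg_right (le_max_right _ _) h0.le)
  obtain ⟨ξ, a1, a2, a3⟩ := dif_rpow [q] (by simpa using hq) c m (by linarith)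
  simp only [List.sum_cons, List.sum_nil] at a2
  rw [tt_dif, a3]
  simp only [List.prod_cons, List.prod_nil, List.length_cons, List.length_nil, dpo]
  have := (rpow_box (c-1) M ξ hM (by linarith) (by linarith)).2
  norm_num
  calc q * c * ξ^(c-1) ≤ q * c * (4^|c-1| * M^(c-1)) := by gcongr
    _ = _ := by ring

lemma ss_ub (c : ℝ) (hc : 2 < c) : ∃ C ≥ (1:ℝ), ∀ n r s N : ℝ, 0 < N → N ≤ n → n + r + s ≤ 4 * N → 0 < r → 0 < s → ss c n r s ≤ C * (r * s * N^(c-2)) := by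
  refine ⟨max 1 (c * (c-1) * 4^|c-2|), le_max_left _ _, ?_⟩
  intro n r s N hN h1 h2 hr hs
  have h0 : 0 < r * s * N^(c-2) := by positivity
  refine le_trans ?_ (mul_le_mul_of_nonneg_right (le_max_right _ _) h0.le)
  obtain ⟨ξ, a1, a2, a3⟩ := dif_rpow [r, s] (by intro h hh; simp at hh; rcases hh with h | h <;> linarith) c n (by linarith)
  simp only [List.sum_cons, List.sum_nil] at a2
  rw [ss_dif, a3]
  simp only [List.prod_cons, List.prod_nil, List.length_cons, List.length_nil, dpo]
  have := (rpow_box (c-2) N ξ hN (by linarith) (by linarith)).2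
  norm_num
  have : 0 < c - 1 := by linarith
  calc r * s * (c * (c-1)) * ξ^(c-2) ≤ r * s * (c * (c-1)) * (4^|c-2| * N^(c-2)) := by gcongr
    _ = _ := by ring

lemma box_sqrt (N lo y K : ℝ) (hN : 0 ≤ N) (hlo : 0 < lo) (hK : 1 ≤ K) (h1 : lo ≤ y) (h2 : y ≤ K * lo) :
    N * Real.sqrt y + 1 / Real.sqrt y ≤ K * (N * Real.sqrt lo + 1 / Real.sqrt lo) := by
  have hs : 0 < Real.sqrt lo := Real.sqrt_pos.mpr hlo
  have a1 : Real.sqrt y ≤ K * Real.sqrt lo := by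
    rw [← Real.sqrt_sq (by linarith : 0 ≤ K), ← Real.sqrt_mul (sq_nonneg K)]
    apply Real.sqrt_le_sqrt
    refine h2.trans ?_
    have : K ≤ K^2 := by nlinarith
    exact mul_le_mul_of_nonneg_right this hlo.le
  have a2 : 1 / Real.sqrt y ≤ K * (1 / Real.sqrt lo) := by
    calc 1 / Real.sqrt y ≤ 1 / Real.sqrt lo := by gcongr
      _ ≤ K * (1 / Real.sqrt lo) := le_mul_of_one_le_left (by positivity) hK
  calc _ ≤ N * (K * Real.sqrt lo) + K * (1 / Real.sqrt lo) := by gcongr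
    _ = _ := by ring

lemma inv_sqrt_sum0 (n : ℕ) : ∑ q ∈ range n, 1 / Real.sqrt ((1 + q : ℕ):ℝ) ≤ 2 * Real.sqrt n := by
  induction n with
  | zero => simp
  | succ n ih =>
    rw [Finset.sum_range_succ]
    push_cast at ih ⊢
    rw [show (1:ℝ) + n = n + 1 by ring]
    have hn : (0:ℝ) ≤ n := by positivity
    have hs : 0 ≤ Real.sqrt n := Real.sqrt_nonneg _
    have ht : 0 < Real.sqrt ((n:ℝ)+1) := Real.sqrt_pos.mpr (by linarith)
    have hs2 : Real.sqrt n ^ 2 = n := Real.sq_sqrt hn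
    have ht2 : Real.sqrt ((n:ℝ)+1) ^ 2 = n+1 := Real.sq_sqrt (by linarith)
    set a := Real.sqrt n
    set b := Real.sqrt ((n:ℝ)+1)
    have : 1 / b ≤ 2 * b - 2 * a := by
      rw [div_le_iff₀ ht]; nlinarith [sq_nonneg (a-b)]
    linarith

lemma inv_sqrt_sum (Q : ℕ) : ∑ q ∈ Ico 1 Q, 1 / Real.sqrt q ≤ 2 * Real.sqrt Q := by
  rw [Finset.sum_Ico_eq_sum_range]
  refine (inv_sqrt_sum0 (Q-1)).trans ?_
  have : ((Q-1:ℕ):ℝ) ≤ Q := by exact_mod_cast Nat.sub_le Q 1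
  gcongr

lemma vsum (Q : ℕ) (α β γ : ℝ) (hα : 0 ≤ α) (hβ : 0 < β) (hγ : 0 ≤ γ) :
    ∑ q ∈ Ico 1 Q, (α * Real.sqrt (β * q) + γ * (1 / Real.sqrt (β * q))) ≤ Q * (α * Real.sqrt (β * Q) + 2 * γ * (1 / Real.sqrt (β * Q))) := by
  rcases Nat.eq_zero_or_pos Q with h | h
  · subst h; simp
  have hQ : (0:ℝ) < Q := by exact_mod_cast h
  have hb : 0 < Real.sqrt β := Real.sqrt_pos.mpr hβ
  have hq : 0 < Real.sqrt Q := Real.sqrt_pos.mpr hQ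
  rw [Finset.sum_add_distrib, mul_add]
  apply add_le_add
  · calc ∑ q ∈ Ico 1 Q, α * Real.sqrt (β * q) ≤ ∑ q ∈ Ico 1 Q, α * Real.sqrt (β * Q) := by
          apply Finset.sum_le_sum; intro q hq
          rw [mem_Ico] at hq
          have : (q:ℝ) ≤ Q := by exact_mod_cast hq.2.le
          gcongr
      _ = ((Q - 1 : ℕ):ℝ) * (α * Real.sqrt (β * Q)) := by simp
      _ ≤ _ := by
          apply mul_le_mul_of_nonneg_right _ (by positivity)
          exact_mod_cast Nat.sub_le Q 1
  · have e1 : ∀ q : ℕ, γ * (1 / Real.sqrt (β * q)) = γ * (1 / Real.sqrt β) * (1 / Real.sqrt q) := by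
      intro q; rw [Real.sqrt_mul hβ.le]
      rw [one_div, mul_inv, one_div, one_div]; ring
    simp only [e1]
    rw [← Finset.mul_sum]
    calc γ * (1 / Real.sqrt β) * ∑ q ∈ Ico 1 Q, 1 / Real.sqrt q ≤ γ * (1 / Real.sqrt β) * (2 * Real.sqrt Q) := by
          gcongr; exact inv_sqrt_sum Q
      _ = _ := by
          rw [Real.sqrt_mul hβ.le]
          have : (Q:ℝ) = Real.sqrt Q * Real.sqrt Q := (Real.mul_self_sqrt hQ.le).symm
          field_simp
          rw [Real.sq_sqrt hQ.le]

lemma dpo_ne (c : ℝ) (hc : 2 < c) (hc3 : c < 3) : dpo c 2 ≠ 0 ∧ dpo c 3 ≠ 0 ∧ dpo c 4 ≠ 0 := by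
  simp only [dpo]
  refine ⟨?_, ?_, ?_⟩ <;> simp <;> (repeat' constructor) <;> (intro h; linarith)

lemma Tbase (c : ℝ) (hc : 2 < c) (k : ℕ) (hk : dpo c (k+2) ≠ 0) : ∃ C ≥ (1:ℝ), ∀ (t : List ℝ) (x M N m q : ℝ) (b : ℕ), t.length = k → (∀ h ∈ t, 0 < h) →
    0 < x → 1 ≤ M → 1 ≤ N → M ≤ m → m ≤ 2 * M → 0 < q → q ≤ M → (⌊N⌋₊ < b → (b:ℝ) + t.sum ≤ 2 * N) →
    ‖∑ n ∈ Ioc ⌊N⌋₊ b, e (x * tt c m q * dif t (fun y => y^c) n)‖ ≤ C * (N * Real.sqrt (x * M^(c-1) * N^(c-k-2) * t.prod * q) + 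
      1 / Real.sqrt (x * M^(c-1) * N^(c-k-2) * t.prod * q)) := by
  obtain ⟨C1, hC1, H1⟩ := vdcg c k hk
  obtain ⟨C2, hC2, H2⟩ := tt_ub c hc
  refine ⟨C1 * C2, by nlinarith, ?_⟩
  intro t x M N m q b hl ht hx hM hN hm1 hm2 hq hqM hb
  have hM0 : 0 < M := by linarith
  have hN0 : 0 < N := by linarith
  have l1 := tt_bd c (by linarith) m q M hM0 hm1 hq
  have l2 := H2 m q M hM0 hm1 hm2 hq hqM
  have hp : 0 < q * M^(c-1) := by positivity
  have htt : 0 < tt c m q := by linarith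
  have htp : 0 < t.prod := List.prod_pos ht
  have key := H1 t N (x * tt c m q) ⌊N⌋₊ b hl ht hN (by positivity) (Nat.lt_floor_add_one N).le (fun h => by linarith [hb h])
  have hxp : 0 < x * t.prod * N^(c-k-2) := by positivity
  have key2 := box_sqrt N (x * M^(c-1) * N^(c-k-2) * t.prod * q) (x * tt c m q * t.prod * N^(c-k-2)) C2 hN0.le (by positivity) hC2
    (by calc _ = x * t.prod * N^(c-k-2) * (q * M^(c-1)) := by ring
          _ ≤ x * t.prod * N^(c-k-2) * tt c m q := by gcongr
          _ = _ := by ring)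
    (by calc _ = x * t.prod * N^(c-k-2) * tt c m q := by ring
          _ ≤ x * t.prod * N^(c-k-2) * (C2 * (q * M^(c-1))) := by gcongr
          _ = _ := by ring)
  refine key.trans ?_
  rw [mul_assoc C1]
  exact mul_le_mul_of_nonneg_left key2 (by linarith)

lemma IL_sum (M : ℝ) (hM : 1 ≤ M) (Q : ℕ) (g : ℕ × ℕ → ℝ) (h : ℕ → ℝ) (h0 : ∀ q, 0 ≤ h q)
    (H : ∀ q m : ℕ, 1 ≤ q → q < Q → M ≤ m → (m:ℝ) ≤ 2 * M → g (q, m) ≤ h q) : ∑ i ∈ IL M Q, g i ≤ 2 * M * ∑ q ∈ Ico 1 Q, h q := by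
  rw [IL, Finset.sum_product, Finset.mul_sum]
  apply Finset.sum_le_sum
  intro q hq
  rw [mem_Ico] at hq
  calc ∑ m ∈ Ioc ⌊M⌋₊ ⌊2*M⌋₊, g (q, m) ≤ ∑ m ∈ Ioc ⌊M⌋₊ ⌊2*M⌋₊, h q := by
        apply Finset.sum_le_sum
        intro m hm
        rw [mem_Ioc] at hm
        exact H q m hq.1 hq.2 (Nat.lt_of_floor_lt hm.1).le ((Nat.le_floor_iff (by linarith)).mp hm.2)
    _ = ((Ioc ⌊M⌋₊ ⌊2*M⌋₊).card : ℝ) * h q := by simp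
    _ ≤ _ := by
        apply mul_le_mul_of_nonneg_right _ (h0 q)
        exact ioc_card_le ⌊M⌋₊ ⌊2*M⌋₊ (2*M) (floor_len M hM) (by linarith)

lemma T1_bd (c : ℝ) (hc : 2 < c) (hc3 : c < 3) : ∃ C ≥ (1:ℝ), ∀ (x M N : ℝ) (Q : ℕ), 0 < x → 1 ≤ M → 1 ≤ N → (Q:ℝ) ≤ M →
    T1 c x M N Q ≤ C * (Q * M) * (N * Real.sqrt (x * M^(c-1) * N^(c-2) * Q) + 1 / Real.sqrt (x * M^(c-1) * N^(c-2) * Q)) := by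
  obtain ⟨C, hC, H⟩ := Tbase c hc 0 (dpo_ne c hc hc3).1
  refine ⟨4 * C, by linarith, ?_⟩
  intro x M N Q hx hM hN hQM
  have hM0 : 0 < M := by linarith
  have hN0 : 0 < N := by linarith
  set β := x * M^(c-1) * N^(c-2) with hβ
  have hβ0 : 0 < β := by positivity
  have step := IL_sum M hM Q (fun i => ‖∑ n ∈ Ioc ⌊N⌋₊ ⌊2*N⌋₊, e (x * tt c i.2 i.1 * (n:ℝ)^c)‖)
    (fun q => C * (N * Real.sqrt (β * q) + 1 * (1 / Real.sqrt (β * q)))) (fun q => by positivity) (by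
      intro q m hq1 hq2 hm1 hm2
      have hq2' : (q:ℝ) ≤ Q := by exact_mod_cast hq2.le
      have := H [] x M N m q ⌊2*N⌋₊ rfl (by simp) hx hM hN hm1 hm2 (by exact_mod_cast hq1) (by linarith)
        (fun _ => by simpa using Nat.floor_le (by linarith : 0 ≤ 2 * N))
      simpa [dif, hβ] using this)
  rw [T1]
  refine step.trans ?_
  rw [← Finset.mul_sum]
  have hv := vsum Q N β 1 hN0.le hβ0 (by norm_num)
  calc _ ≤ 2 * M * (C * (Q * (N * Real.sqrt (β * Q) + 2 * 1 * (1 / Real.sqrt (β * Q))))) := by gcongr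
    _ ≤ 2 * M * (C * (Q * (2 * N * Real.sqrt (β * Q) + 2 * 1 * (1 / Real.sqrt (β * Q))))) := by gcongr; linarith
    _ = _ := by ring

lemma T2_bd (c : ℝ) (hc : 2 < c) (hc3 : c < 3) : ∃ C ≥ (1:ℝ), ∀ (x M N : ℝ) (Q R₁ : ℕ), 0 < x → 1 ≤ M → 1 ≤ N → (Q:ℝ) ≤ M → 0 < R₁ →
    T2 c x M N Q R₁ ≤ C * (Q * M * R₁) * (N * Real.sqrt (x * M^(c-1) * N^(c-3) * R₁ * Q) + 1 / Real.sqrt (x * M^(c-1) * N^(c-3) * R₁ * Q)) := by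
  obtain ⟨C, hC, H⟩ := Tbase c hc 1 (dpo_ne c hc hc3).2.1
  refine ⟨8 * C, by linarith, ?_⟩
  intro x M N Q R₁ hx hM hN hQM hR
  have hR' : (0:ℝ) < R₁ := by exact_mod_cast hR
  have hM0 : 0 < M := by linarith
  have hN0 : 0 < N := by linarith
  set β := x * M^(c-1) * N^(c-3) with hβ
  have hβ0 : 0 < β := by positivity
  have step := IL_sum M hM Q (fun i => ∑ r ∈ Ico 1 R₁, ‖∑ n ∈ Ioc ⌊N⌋₊ (⌊2*N⌋₊ - r), e (x * tt c i.2 i.1 * tt c n r)‖)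
    (fun q => C * (R₁ * (N * Real.sqrt (β * R₁ * q) + 2 * (1 / Real.sqrt (β * R₁ * q))))) (fun q => by positivity) (by
      intro q m hq1 hq2 hm1 hm2
      have hq2' : (q:ℝ) ≤ Q := by exact_mod_cast hq2.le
      have hq0 : (0:ℝ) < q := by exact_mod_cast hq1
      have hv := vsum R₁ N (β * q) 1 hN0.le (by positivity) (by norm_num)
      rw [show β * R₁ * (q:ℝ) = β * q * R₁ by ring]
      calc _ ≤ ∑ r ∈ Ico 1 R₁, C * (N * Real.sqrt (β * q * r) + 1 * (1 / Real.sqrt (β * q * r))) := by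
            apply Finset.sum_le_sum
            intro r hr
            rw [mem_Ico] at hr
            have hr0 : (0:ℝ) < r := by exact_mod_cast hr.1
            have := H [(r:ℝ)] x M N m q (⌊2*N⌋₊ - r) rfl (by simpa using hr0) hx hM hN hm1 hm2 hq0 (by linarith)
              (fun h => by
                have h1 := Nat.floor_le (by linarith : 0 ≤ 2 * N)
                rw [Nat.cast_sub (by omega)]; simp; linarith)
            simp only [List.prod_cons, List.prod_nil, Nat.cast_one, ← tt_dif] at this
            rw [show c - 1 - 2 = c - 3 by ring, show x * M^(c-1) * N^(c-3) * ((r:ℝ) * 1) * q = β * q * r by rw [hβ]; ring] at this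
            simpa using this
        _ ≤ C * (R₁ * (N * Real.sqrt (β * q * R₁) + 2 * 1 * (1 / Real.sqrt (β * q * R₁)))) := by
            rw [← Finset.mul_sum]; gcongr
        _ = _ := by ring)
  rw [T2]
  refine step.trans ?_
  rw [← Finset.mul_sum, ← Finset.mul_sum]
  have hv := vsum Q N (β * R₁) 2 hN0.le (by positivity) (by norm_num)
  calc _ ≤ 2 * M * (C * (R₁ * (Q * (N * Real.sqrt (β * R₁ * Q) + 2 * 2 * (1 / Real.sqrt (β * R₁ * Q)))))) := by gcongr
    _ ≤ 2 * M * (C * (R₁ * (Q * (4 * N * Real.sqrt (β * R₁ * Q) + 2 * 2 * (1 / Real.sqrt (β * R₁ * Q)))))) := by gcongr; linarith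
    _ = _ := by ring

lemma T3_bd (c : ℝ) (hc : 2 < c) (hc3 : c < 3) : ∃ C ≥ (1:ℝ), ∀ (x M N : ℝ) (Q R₁ R₂ : ℕ), 0 < x → 1 ≤ M → 1 ≤ N → (Q:ℝ) ≤ M → 0 < R₁ → 0 < R₂ →
    T3 c x M N Q R₁ R₂ ≤ C * (Q * M * R₁ * R₂) * (N * Real.sqrt (x * M^(c-1) * N^(c-4) * R₂ * R₁ * Q) + 1 / Real.sqrt (x * M^(c-1) * N^(c-4) * R₂ * R₁ * Q)) := by
  obtain ⟨C, hC, H⟩ := Tbase c hc 2 (dpo_ne c hc hc3).2.2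
  refine ⟨16 * C, by linarith, ?_⟩
  intro x M N Q R₁ R₂ hx hM hN hQM hR1 hR2
  have hR' : (0:ℝ) < R₁ := by exact_mod_cast hR1
  have hR2' : (0:ℝ) < R₂ := by exact_mod_cast hR2
  have hM0 : 0 < M := by linarith
  have hN0 : 0 < N := by linarith
  set β := x * M^(c-1) * N^(c-4) with hβ
  have hβ0 : 0 < β := by positivity
  have step := IL_sum M hM Q (fun i => ∑ r ∈ Ico 1 R₁, ∑ s ∈ Ico 1 R₂, ‖∑ n ∈ Ioc ⌊N⌋₊ (⌊2*N⌋₊ - r - s), e (x * tt c i.2 i.1 * ss c n r s)‖)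
    (fun q => C * (R₂ * (R₁ * (N * Real.sqrt (β * R₂ * R₁ * q) + 4 * (1 / Real.sqrt (β * R₂ * R₁ * q)))))) (fun q => by positivity) (by
      intro q m hq1 hq2 hm1 hm2
      have hq2' : (q:ℝ) ≤ Q := by exact_mod_cast hq2.le
      have hq0 : (0:ℝ) < q := by exact_mod_cast hq1
      have hv := vsum R₁ N (β * q * R₂) 2 hN0.le (by positivity) (by norm_num)
      rw [show β * R₂ * R₁ * (q:ℝ) = β * q * R₂ * R₁ by ring]
      calc _ ≤ ∑ r ∈ Ico 1 R₁, C * (R₂ * (N * Real.sqrt (β * q * R₂ * r) + 2 * (1 / Real.sqrt (β * q * R₂ * r)))) := by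
            apply Finset.sum_le_sum
            intro r hr
            rw [mem_Ico] at hr
            have hr0 : (0:ℝ) < r := by exact_mod_cast hr.1
            have hv := vsum R₂ N (β * q * r) 1 hN0.le (by positivity) (by norm_num)
            rw [show β * q * R₂ * (r:ℝ) = β * q * r * R₂ by ring]
            calc _ ≤ ∑ s ∈ Ico 1 R₂, C * (N * Real.sqrt (β * q * r * s) + 1 * (1 / Real.sqrt (β * q * r * s))) := by
                  apply Finset.sum_le_sum
                  intro s hs
                  rw [mem_Ico] at hs
                  have hs0 : (0:ℝ) < s := by exact_mod_cast hs.1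
                  have := H [(r:ℝ), (s:ℝ)] x M N m q (⌊2*N⌋₊ - r - s) rfl (by simp [hr0, hs0]) hx hM hN hm1 hm2 hq0 (by linarith)
                    (fun h => by
                      have h1 := Nat.floor_le (by linarith : 0 ≤ 2 * N)
                      rw [Nat.cast_sub (by omega), Nat.cast_sub (by omega)]; simp; linarith)
                  simp only [List.prod_cons, List.prod_nil, ← ss_dif] at this
                  rw [show c - (2:ℕ) - 2 = c - 4 by push_cast; ring, show x * M^(c-1) * N^(c-4) * ((r:ℝ) * (s * 1)) * q = β * q * r * s by rw [hβ]; ring] at this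
                  simpa using this
              _ ≤ C * (R₂ * (N * Real.sqrt (β * q * r * R₂) + 2 * 1 * (1 / Real.sqrt (β * q * r * R₂)))) := by
                  rw [← Finset.mul_sum]; gcongr
              _ = _ := by ring
        _ ≤ C * (R₂ * (R₁ * (N * Real.sqrt (β * q * R₂ * R₁) + 2 * 2 * (1 / Real.sqrt (β * q * R₂ * R₁))))) := by
            rw [← Finset.mul_sum, ← Finset.mul_sum]; gcongr
        _ = _ := by ring)
  have h3 : T3 c x M N Q R₁ R₂ ≤ ∑ i ∈ IL M Q, ∑ r ∈ Ico 1 R₁, ∑ s ∈ Ico 1 R₂, ‖∑ n ∈ Ioc ⌊N⌋₊ (⌊2*N⌋₊ - r - s), e (x * tt c i.2 i.1 * ss c n r s)‖ := by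
    rw [T3]
    refine (norm_sum_le _ _).trans (Finset.sum_le_sum fun i _ => ?_)
    refine (norm_sum_le _ _).trans (Finset.sum_le_sum fun r _ => ?_)
    refine (norm_sum_le _ _).trans (Finset.sum_le_sum fun s hs => ?_)
    rw [mem_Ico] at hs
    have hs2 : (s:ℝ) ≤ R₂ := by exact_mod_cast hs.2.le
    have h1 : (s:ℝ)/R₂ ≤ 1 := by rw [div_le_one hR2']; exact hs2
    have h0 : 0 ≤ (s:ℝ)/R₂ := by positivity
    rw [norm_mul, Complex.norm_real, Real.norm_eq_abs, abs_of_nonneg (by linarith)]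
    exact mul_le_of_le_one_left (norm_nonneg _) (by linarith)
  refine h3.trans (step.trans ?_)
  rw [← Finset.mul_sum, ← Finset.mul_sum, ← Finset.mul_sum]
  have hv := vsum Q N (β * R₂ * R₁) 4 hN0.le (by positivity) (by norm_num)
  calc _ ≤ 2 * M * (C * (R₂ * (R₁ * (Q * (N * Real.sqrt (β * R₂ * R₁ * Q) + 2 * 4 * (1 / Real.sqrt (β * R₂ * R₁ * Q))))))) := by gcongr
    _ ≤ 2 * M * (C * (R₂ * (R₁ * (Q * (8 * N * Real.sqrt (β * R₂ * R₁ * Q) + 2 * 4 * (1 / Real.sqrt (β * R₂ * R₁ * Q))))))) := by gcongr; linarith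
    _ = _ := by ring

noncomputable def BB (Q M R N w G L : ℝ) : ℝ := (G * (Q*M+Q^4) + (Q*M)^2) * (R*N + R^2*w^((2:ℝ)/3) + R^2*(w^4/N^2) + R^2*N^2/L)

lemma BB_mono (q Q M r R N w l : ℝ) (hq : 0 < q) (hqQ : q ≤ Q) (hM : 0 < M) (hr : 0 < r) (hrR : r ≤ R) (hN : 0 < N) (hw : 0 < w)
    (hl : 0 < l) (hL : 1 ≤ l * (Q * R)) : BB q M r N w (max (l * (q * r)) 1) (l * (q * r)) ≤ BB Q M R N w (l * (Q*R)) (l * (Q*R)) := by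
  have hQ : 0 < Q := by linarith
  have hR : 0 < R := by linarith
  set L := l * (Q*R) with hLd
  set L0 := l * (q*r) with hL0d
  have hL0 : 0 < L0 := by positivity
  have hLL : L0 ≤ L := by rw [hLd, hL0d]; gcongr
  set G := max L0 1 with hG
  have hGL : G ≤ L := max_le hLL hL
  have hG0 : 0 < G := by positivity
  have hLp : 0 < L := by linarith
  set A := q*M+q^4 with hA
  set A' := Q*M+Q^4 with hA'
  have hAp : 0 < A := by positivity
  have hAA : A ≤ A' := by rw [hA, hA']; gcongr
  set B := (q*M)^2 with hB
  set B' := (Q*M)^2 with hB'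
  have hBp : 0 < B := by positivity
  have hBB : B ≤ B' := by rw [hB, hB']; gcongr
  set D := r*N + r^2*w^((2:ℝ)/3) + r^2*(w^4/N^2) with hD
  set D' := R*N + R^2*w^((2:ℝ)/3) + R^2*(w^4/N^2) with hD'
  have hDp : 0 < D := by positivity
  have hDD : D ≤ D' := by rw [hD, hD']; gcongr
  have t1 : G * A * D ≤ L * A' * D' := by gcongr
  have t2 : B * D ≤ B' * D' := by gcongr
  have t4 : B * (r^2*N^2/L0) ≤ B' * (R^2*N^2/L) := by
    have e1 : B * (r^2*N^2/L0) = q * r * (M^2*N^2/l) := by rw [hB, hL0d]; field_simp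
    have e2 : B' * (R^2*N^2/L) = Q * R * (M^2*N^2/l) := by rw [hB', hLd]; field_simp
    rw [e1, e2]; gcongr
  have t3 : G * A * (r^2*N^2/L0) ≤ L * A' * (R^2*N^2/L) := by
    have e2 : L * A' * (R^2*N^2/L) = A' * (R^2*N^2) := by field_simp
    rw [e2]
    rcases le_total 1 L0 with h | h
    · have : G = L0 := max_eq_left h
      rw [this]
      calc _ = A * (r^2*N^2) := by field_simp
        _ ≤ _ := by gcongr
    · have : G = 1 := max_eq_right h
      rw [this]
      calc _ = (M + q^3) * r * (N^2/l) := by rw [hA, hL0d]; field_simp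
        _ ≤ (M + Q^3) * R * (N^2/l) := by gcongr
        _ = (A' * (R^2*N^2)) / L := by rw [hA', hLd]; field_simp
        _ ≤ _ := div_le_self (by positivity) hL
  rw [BB, BB]
  calc _ = G * A * D + B * D + G * A * (r^2*N^2/L0) + B * (r^2*N^2/L0) := by ring
    _ ≤ L * A' * D' + B' * D' + L * A' * (R^2*N^2/L) + B' * (R^2*N^2/L) := by linarith
    _ = _ := by ring

lemma piece_alg (P Ct Cs CL CR G L q M r N w Dv lm ln UV l t PR : ℝ) (hG : 1 ≤ G) (hL : 0 < L) (hq : 0 < q) (hM : 0 < M) (hr : 0 < r) (hN : 0 < N) (hw : 0 < w)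
   (hCt : 1 ≤ Ct) (hCs : 1 ≤ Cs) (hCL : 1 ≤ CL) (hCR : 1 ≤ CR) (hP1 : G ≤ P) (hP2 : P ≤ Cs * G) (hUV : UV = Ct * P) (hPR : PR = Ct * L) (hlm : 0 ≤ lm) (hln : 0 ≤ ln)
   (hl0 : 0 ≤ l) (ht0 : 0 ≤ t)
   (hl : l ≤ CL * (q*M + (q*M)^2*(1/P + q^2/M^2)) * lm^2)
   (ht : t ≤ CR * Dv^2 * ln^4 * (r*N + r^2*w^((2:ℝ)/3) + r^2*(N^2/PR) + r^2*(w^4/N^2))) (K : ℝ) (hK : 0 ≤ K) :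
   K * UV * l * t ≤ K * Ct * Cs * CL * CR * (Dv^2 * lm^2 * ln^4) * BB q M r N w G L := by
  have h1 : l ≤ CL * (q*M + (q*M)^2*(1/G + q^2/M^2)) * lm^2 := by
    refine hl.trans ?_
    gcongr
  have h2 : t ≤ CR * Dv^2 * ln^4 * (r*N + r^2*w^((2:ℝ)/3) + r^2*(N^2/L) + r^2*(w^4/N^2)) := by
    refine ht.trans ?_
    have : L ≤ PR := by rw [hPR]; nlinarith
    gcongr
  have h3 : UV ≤ Ct * (Cs * G) := by rw [hUV]; gcongr
  have hG0 : 0 < G := by linarith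
  calc K * UV * l * t ≤ K * (Ct * (Cs * G)) * (CL * (q*M + (q*M)^2*(1/G + q^2/M^2)) * lm^2) * (CR * Dv^2 * ln^4 * (r*N + r^2*w^((2:ℝ)/3) + r^2*(N^2/L) + r^2*(w^4/N^2))) := by gcongr
    _ = _ := by rw [BB]; field_simp; ring

set_option maxHeartbeats 1000000 in
open scoped Classical in
lemma piece (c : ℝ) (hc : 2 < c) (hc3 : c < 3) : ∃ C ≥ (1:ℝ), ∀ (x M N w Dv : ℝ) (Q R : ℕ) (s : Finset (ℕ×ℕ)) (t : Finset (ℕ×ℕ×ℕ)) (β : ℕ×ℕ×ℕ → ℂ),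
    0 < x → 1 ≤ M → 1 ≤ N → 0 < Q → C * Q ≤ M → 1 ≤ w → C * w ≤ N → 0 < R → (R:ℝ) ≤ N → (∀A:ℕ,0<A→A≤2*R→(A.divisors.card:ℝ)≤Dv) →
    (∀ i ∈ s, (Q ≤ i.1 ∧ i.1 ≤ 2*Q) ∧ (M ≤ (i.2:ℝ) ∧ (i.2:ℝ) ≤ 2*M)) →
    (∀ j ∈ t, (R ≤ j.1*j.2.1 ∧ j.1*j.2.1 ≤ 2*R) ∧ ((j.1:ℝ) ≤ w ∧ (j.2.1:ℝ) ≤ w) ∧ (N ≤ (j.2.2:ℝ) ∧ (j.2.2:ℝ) ≤ 2*N)) →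
    (∀ j ∈ t, ‖β j‖ ≤ 1) →
    ‖∑ i ∈ s, ∑ j ∈ t, 1 * β j * e ((x * tt c i.2 i.1) * ss c j.2.2 j.1 j.2.1)‖^2 ≤ C * (Dv^2 * (1 + Real.log M)^2 * (1 + Real.log N)^4) *
      BB Q M R N w (max (x * M^(c-1) * N^(c-2) * (Q * R)) 1) (x * M^(c-1) * N^(c-2) * (Q * R)) := by
  obtain ⟨CL, hCL, HL⟩ := left_count c (by linarith)
  obtain ⟨CR, hCR, HR⟩ := right_count c hc hc3
  obtain ⟨Ct, hCt, Ht⟩ := tt_ub c hc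
  obtain ⟨Cs, hCs, Hs⟩ := ss_ub c hc
  set K := 17 * (Real.exp (2 * Real.pi))^4 with hK
  have hK1 : 1 ≤ K := by
    have : 1 ≤ Real.exp (2 * Real.pi) := Real.one_le_exp (by positivity)
    have := one_le_pow₀ this (n := 4)
    linarith
  have a0 : 0 < CL := by linarith
  have a1 : 0 < CR := by linarith
  have a2 : 0 < Ct := by linarith
  have a3 : 0 < Cs := by linarith
  have a4 : 0 < K := by linarith
  refine ⟨max (K * (2*Ct) * (2*Cs) * CL * CR) (2 * CL + CR), by have := le_max_right (K * (2*Ct) * (2*Cs) * CL * CR) (2 * CL + CR); linarith, ?_⟩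
  set CC := max (K * (2*Ct) * (2*Cs) * CL * CR) (2 * CL + CR) with hCC
  have hCC2 : 2 * CL + CR ≤ CC := le_max_right _ _
  have hCC1 : K * (2*Ct) * (2*Cs) * CL * CR ≤ CC := le_max_left _ _
  intro x M N w Dv Q R s t β hx hM hN hQ hQM hw hwN hR hRN hDv hs ht hβ
  have hM0 : 0 < M := by linarith
  have hN0 : 0 < N := by linarith
  have hw0 : 0 < w := by linarith
  have hQ' : (0:ℝ) < Q := by exact_mod_cast hQ
  have hR' : (0:ℝ) < R := by exact_mod_cast hR
  have hQM1 : 2 * CL * (Q:ℝ) ≤ M := le_trans (mul_le_mul_of_nonneg_right (by linarith) hQ'.le) hQM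
  have hwN1 : CR * w ≤ N := le_trans (mul_le_mul_of_nonneg_right (by linarith) hw0.le) hwN
  have hQM2 : CL * (Q:ℝ) ≤ M := by have : 0 < CL * (Q:ℝ) := by positivity
                                   linarith
  have hQM3 : 2 * (Q:ℝ) ≤ M := le_trans (mul_le_mul_of_nonneg_right (by linarith) hQ'.le) hQM1
  have hwN2 : w ≤ N := (le_mul_of_one_le_left hw0.le hCR).trans hwN1
  have hlm : 0 ≤ 1 + Real.log M := by have := Real.log_nonneg hM; linarith
  have hln : 0 ≤ 1 + Real.log N := by have := Real.log_nonneg hN; linarith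
  set u0 := x * (Q * M^(c-1)) with hu0
  set v0 := R * N^(c-2) with hv0
  have hu0p : 0 < u0 := by positivity
  have hv0p : 0 < v0 := by positivity
  set L := x * M^(c-1) * N^(c-2) * (Q * R) with hL
  have hLuv : L = u0 * v0 := by rw [hL, hu0, hv0]; ring
  have hL0 : 0 < L := by positivity
  set U := 2 * Ct * u0 with hU
  set V := max (2 * Cs * v0) (1/u0) with hV
  have hU0 : 0 < U := by positivity
  have hV0 : 0 < V := lt_of_lt_of_le (by positivity) (le_max_left _ _)
  set P := u0 * V with hP
  have hPe : P = max (2 * Cs * L) 1 := by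
    rw [hP, hV, mul_max_of_nonneg _ _ hu0p.le, hLuv]
    congr 1
    · ring
    · field_simp
  have hP1 : 1 ≤ P := by rw [hPe]; exact le_max_right _ _
  have hUV : U * V = 2 * Ct * P := by rw [hU, hP]; ring
  have hpos : ∀ j ∈ t, (0:ℝ) < j.1 ∧ (0:ℝ) < j.2.1 := by
    intro j hj
    have h1 := (ht j hj).1.1
    have h2 : 0 < j.1 * j.2.1 := by omega
    exact ⟨by exact_mod_cast Nat.pos_of_mul_pos_right h2, by exact_mod_cast Nat.pos_of_mul_pos_left h2⟩
  have D := dls s t (fun i => x * tt c i.2 i.1) (fun j => ss c j.2.2 j.1 j.2.1) U V hU0 hV0 (by rw [hUV]; exact one_le_mul_of_one_le_of_one_le (by linarith) hP1) ?_ ?_ (fun _ => 1) β (by simp) hβ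
  · refine D.trans ?_
    have Lc := HL M Q P ((s ×ˢ s).filter (fun q => |x * tt c q.1.2 q.1.1 - x * tt c q.2.2 q.2.1| ≤ 1/V)) hM hQ hQM2 hP1 (by
      intro p hp
      rw [mem_filter, mem_product] at hp
      obtain ⟨⟨h1, h2⟩, h3⟩ := hp
      refine ⟨⟨(hs _ h1).1.1, (hs _ h1).1.2, (hs _ h1).2⟩, ⟨(hs _ h2).1.1, (hs _ h2).1.2, (hs _ h2).2⟩, ?_⟩
      rw [← mul_sub, abs_mul, abs_of_pos hx] at h3
      have : Q * M^(c-1) / P = (1/V)/x := by rw [hP, hu0]; field_simp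
      rw [this, le_div_iff₀ hx]; linarith)
    have Rc := HR N w (2 * Ct * L) Dv R ((t ×ˢ t).filter (fun q => |ss c q.1.2.2 q.1.1 q.1.2.1 - ss c q.2.2.2 q.2.1 q.2.2.1| ≤ 1/U)) hw hwN1 hR hRN (by positivity) hDv (by
      intro p hp
      rw [mem_filter, mem_product] at hp
      obtain ⟨⟨h1, h2⟩, h3⟩ := hp
      obtain ⟨b1, b2, b3⟩ := ht _ h1
      obtain ⟨d1, d2, d3⟩ := ht _ h2
      refine ⟨⟨b1, d1⟩, ⟨b2.1, b2.2, d2.1, d2.2⟩, ⟨b3, d3⟩, ?_⟩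
      refine h3.trans (le_of_eq ?_)
      rw [hU, hLuv, ← hv0]; field_simp)
    have := piece_alg P (2*Ct) (2*Cs) CL CR (max L 1) L Q M R N w Dv (1 + Real.log M) (1 + Real.log N) (U*V) _ _ (2 * Ct * L) (le_max_right _ _) hL0 hQ' hM0 hR' hN0 hw0
      (by linarith) (by linarith) hCL hCR (by rw [hPe]; exact max_le_max_right _ (le_mul_of_one_le_left hL0.le (by linarith)))
      (by rw [hPe]; apply max_le
          · exact mul_le_mul_of_nonneg_left (le_max_left _ _) (by linarith)
          · exact one_le_mul_of_one_le_of_one_le (by linarith) (le_max_right L 1)) hUV rfl hlm hln (Nat.cast_nonneg _) (Nat.cast_nonneg _) Lc Rc K a4.le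
    refine this.trans ?_
    have hBB : 0 ≤ BB Q M R N w (max L 1) L := by
      have : 0 < max L 1 := by positivity
      rw [BB]; positivity
    refine mul_le_mul_of_nonneg_right ?_ hBB
    exact mul_le_mul_of_nonneg_right hCC1 (by positivity)
  · intro i hi
    obtain ⟨⟨h1, h2⟩, h3, h4⟩ := hs i hi
    have h1' : (Q:ℝ) ≤ i.1 := by exact_mod_cast h1
    have h2' : (i.1:ℝ) ≤ 2 * Q := by exact_mod_cast h2
    have l1 := tt_bd c (by linarith) i.2 i.1 M hM0 h3 (by linarith)
    have l2 := Ht i.2 i.1 M hM0 h3 h4 (by linarith) (by linarith)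
    have l3 : 0 < (i.1:ℝ) * M^(c-1) := mul_pos (by linarith) (by positivity)
    refine ⟨mul_nonneg hx.le (by linarith), ?_⟩
    calc x * tt c i.2 i.1 ≤ x * (Ct * (i.1 * M^(c-1))) := by gcongr
      _ ≤ x * (Ct * ((2 * Q) * M^(c-1))) := by gcongr
      _ = U := by rw [hU, hu0]; ring
  · intro j hj
    obtain ⟨⟨h1, h2⟩, ⟨h3, h4⟩, h5, h6⟩ := ht j hj
    obtain ⟨p1, p2⟩ := hpos j hj
    have h2' : (j.1:ℝ) * j.2.1 ≤ 2 * R := by exact_mod_cast h2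
    have l1 := ss_bd c hc j.2.2 j.1 j.2.1 N hN0 h5 p1 p2
    have l2 := Hs j.2.2 j.1 j.2.1 N hN0 h5 (by linarith) p1 p2
    have l3 : 0 < (j.1:ℝ) * j.2.1 * N^(c-2) := mul_pos (mul_pos p1 p2) (by positivity)
    refine ⟨by linarith, ?_⟩
    refine le_trans ?_ (le_max_left _ _)
    calc ss c j.2.2 j.1 j.2.1 ≤ Cs * (j.1 * j.2.1 * N^(c-2)) := l2
      _ ≤ Cs * ((2 * R) * N^(c-2)) := by gcongr
      _ = _ := by rw [hv0]; ring

lemma natlog_bd (Q : ℕ) (Y : ℝ) (hQ : 0 < Q) (hY : (Q:ℝ) ≤ Y) : ((Nat.log 2 Q + 1 : ℕ):ℝ) ≤ 2 * (1 + Real.log Y) := by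
  have h1 : (2:ℝ)^(Nat.log 2 Q) ≤ Y := by
    have : 2^(Nat.log 2 Q) ≤ Q := Nat.pow_log_le_self 2 (by omega)
    exact le_trans (by exact_mod_cast this) hY
  have h2 := Real.log_le_log (by positivity) h1
  rw [Real.log_pow] at h2
  have := Real.log_two_gt_d9
  push_cast
  have h3 : (0:ℝ) ≤ Nat.log 2 Q := by positivity
  nlinarith

lemma dyadic_split {ι κ : Type*} (s : Finset ι) (t : Finset κ) (f : ι → ℕ) (g : κ → ℕ) (F : ι → κ → ℂ) (Q R : ℕ)
    (hf : ∀ i ∈ s, f i ≤ Q) (hg : ∀ j ∈ t, g j ≤ R) (B : ℝ)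
    (H : ∀ k l : ℕ, 2^k ≤ Q → 2^l ≤ R → ‖∑ i ∈ s.filter (fun i => Nat.log 2 (f i) = k), ∑ j ∈ t.filter (fun j => Nat.log 2 (g j) = l), F i j‖ ≤ B)
    (hQ : 0 < Q) (hR : 0 < R) :
    ‖∑ i ∈ s, ∑ j ∈ t, F i j‖ ≤ ((Nat.log 2 Q + 1 : ℕ):ℝ) * ((Nat.log 2 R + 1 : ℕ):ℝ) * B := by
  have e1 : ∑ i ∈ s, ∑ j ∈ t, F i j = ∑ k ∈ range (Nat.log 2 Q + 1), ∑ l ∈ range (Nat.log 2 R + 1),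
      ∑ i ∈ s.filter (fun i => Nat.log 2 (f i) = k), ∑ j ∈ t.filter (fun j => Nat.log 2 (g j) = l), F i j := by
    rw [← Finset.sum_fiberwise_of_maps_to (s := s) (t := range (Nat.log 2 Q + 1)) (g := fun i => Nat.log 2 (f i))
      (fun i hi => by rw [mem_range]; have := Nat.log_mono_right (b := 2) (hf i hi); omega)]
    apply Finset.sum_congr rfl
    intro k _
    symm
    rw [Finset.sum_comm]
    apply Finset.sum_congr rfl
    intro i _
    rw [Finset.sum_fiberwise_of_maps_to (fun j hj => by rw [mem_range]; have := Nat.log_mono_right (b := 2) (hg j hj); omega)]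
  rw [e1]
  calc _ ≤ ∑ k ∈ range (Nat.log 2 Q + 1), ∑ l ∈ range (Nat.log 2 R + 1), B := by
        refine (norm_sum_le _ _).trans (Finset.sum_le_sum fun k hk => ?_)
        refine (norm_sum_le _ _).trans (Finset.sum_le_sum fun l hl => ?_)
        rw [mem_range] at hk hl
        exact H k l (Nat.pow_le_of_le_log (by omega) (by omega)) (Nat.pow_le_of_le_log (by omega) (by omega))
    _ = _ := by simp; ring

noncomputable def JR (N : ℝ) (R₁ R₂ : ℕ) : Finset (ℕ×ℕ×ℕ) :=
  (Ico 1 R₁ ×ˢ (Ico 1 R₂ ×ˢ Ioc ⌊N⌋₊ ⌊2*N⌋₊)).filter (fun j => j.2.2 ≤ ⌊2*N⌋₊ - j.1 - j.2.1)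

lemma JR_sum (N : ℝ) (R₁ R₂ : ℕ) (F : ℕ → ℕ → ℕ → ℂ) (w : ℕ → ℂ) :
    ∑ r ∈ Ico 1 R₁, ∑ s ∈ Ico 1 R₂, w s * ∑ n ∈ Ioc ⌊N⌋₊ (⌊2*N⌋₊ - r - s), F r s n = ∑ j ∈ JR N R₁ R₂, w j.2.1 * F j.1 j.2.1 j.2.2 := by
  rw [JR, Finset.sum_filter, Finset.sum_product]
  apply Finset.sum_congr rfl
  intro r _
  rw [Finset.sum_product]
  apply Finset.sum_congr rfl
  intro s _
  simp only
  rw [Finset.mul_sum, ← Finset.sum_filter]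
  apply Finset.sum_congr _ (fun _ _ => rfl)
  ext n
  simp only [mem_Ioc, mem_filter]
  omega

lemma T3_dls (c : ℝ) (hc : 2 < c) (hc3 : c < 3) : ∃ C ≥ (1:ℝ), ∀ (x M N Dv : ℝ) (Q R₁ R₂ : ℕ), 0 < x → 1 ≤ M → 1 ≤ N → 0 < Q → C * Q ≤ M →
    0 < R₁ → R₁ ≤ R₂ → C * R₂ ≤ N → (R₁:ℝ) * R₂ ≤ N → (∀A:ℕ,0<A→A≤2*(R₁*R₂)→(A.divisors.card:ℝ)≤Dv) →
    1 ≤ x * M^(c-1) * N^(c-2) * (Q * (R₁ * R₂)) →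
    T3 c x M N Q R₁ R₂ ^ 2 ≤ C * (Dv^2 * (1 + Real.log M)^4 * (1 + Real.log N)^6) *
      BB Q M (R₁*R₂) N R₂ (x * M^(c-1) * N^(c-2) * (Q * (R₁ * R₂))) (x * M^(c-1) * N^(c-2) * (Q * (R₁ * R₂))) := by
  obtain ⟨C, hC, H⟩ := piece c hc hc3
  refine ⟨16 * C, by linarith, ?_⟩
  intro x M N Dv Q R₁ R₂ hx hM hN hQ hQM hR1 hR12 hR2N hRN hDv hL
  have hM0 : 0 < M := by linarith
  have hN0 : 0 < N := by linarith
  have hQ' : (0:ℝ) < Q := by exact_mod_cast hQ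
  have hR1' : (0:ℝ) < R₁ := by exact_mod_cast hR1
  have hR2' : (1:ℝ) ≤ R₂ := by exact_mod_cast le_trans hR1 hR12
  have hR2p : 0 < R₂ := lt_of_lt_of_le hR1 hR12
  have hR12' : (R₁:ℝ) ≤ R₂ := by exact_mod_cast hR12
  have hQM2 : (Q:ℝ) ≤ M := by nlinarith
  have hCQ : C * (Q:ℝ) ≤ M := by nlinarith
  have hCR : C * (R₂:ℝ) ≤ N := by nlinarith
  have hlm : 0 ≤ 1 + Real.log M := by have := Real.log_nonneg hM; linarith
  have hln : 0 ≤ 1 + Real.log N := by have := Real.log_nonneg hN; linarith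
  have hl : 0 < x * M^(c-1) * N^(c-2) := by positivity
  set l := x * M^(c-1) * N^(c-2) with hld
  set L := l * (Q * (R₁ * R₂)) with hLd
  set lm := 1 + Real.log M with hlmd
  set ln := 1 + Real.log N with hlnd
  set W := C * (Dv^2 * lm^2 * ln^4) * BB Q M (R₁*R₂) N R₂ L L with hW
  have e1 : T3 c x M N Q R₁ R₂ = ‖∑ i ∈ IL M Q, ∑ j ∈ JR N R₁ R₂, 1 * (((1 - (j.2.1:ℝ)/R₂ : ℝ)):ℂ) * e ((x * tt c i.2 i.1) * ss c j.2.2 j.1 j.2.1)‖ := by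
    rw [T3]
    congr 1
    apply Finset.sum_congr rfl
    intro i _
    rw [JR_sum N R₁ R₂ (fun r s n => e (x * tt c i.2 i.1 * ss c n r s)) (fun s => (((1 - (s:ℝ)/R₂ : ℝ)):ℂ))]
    simp only [one_mul]
  have hJ : ∀ j ∈ JR N R₁ R₂, 1 ≤ j.1 ∧ j.1 < R₁ ∧ 1 ≤ j.2.1 ∧ j.2.1 < R₂ ∧ N ≤ (j.2.2:ℝ) ∧ (j.2.2:ℝ) ≤ 2*N := by
    intro j hj
    rw [JR, mem_filter, mem_product, mem_product, mem_Ico, mem_Ico, mem_Ioc] at hj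
    obtain ⟨⟨h1, h2, h3⟩, -⟩ := hj
    exact ⟨h1.1, h1.2, h2.1, h2.2, (Nat.lt_of_floor_lt h3.1).le, (Nat.le_floor_iff (by linarith)).mp h3.2⟩
  have hI : ∀ i ∈ IL M Q, 1 ≤ i.1 ∧ i.1 < Q ∧ M ≤ (i.2:ℝ) ∧ (i.2:ℝ) ≤ 2*M := by
    intro i hi
    rw [IL, mem_product, mem_Ico, mem_Ioc] at hi
    exact ⟨hi.1.1, hi.1.2, (Nat.lt_of_floor_lt hi.2.1).le, (Nat.le_floor_iff (by linarith)).mp hi.2.2⟩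
  have key := dyadic_split (IL M Q) (JR N R₁ R₂) (fun i => i.1) (fun j => j.1 * j.2.1)
    (fun i j => 1 * (((1 - (j.2.1:ℝ)/R₂ : ℝ)):ℂ) * e ((x * tt c i.2 i.1) * ss c j.2.2 j.1 j.2.1)) Q (R₁ * R₂)
    (fun i hi => (hI i hi).2.1.le) (fun j hj => Nat.mul_le_mul (hJ j hj).2.1.le (hJ j hj).2.2.2.1.le) (Real.sqrt W) (by
      intro k m hk hm
      have hk' : ((2^k:ℕ):ℝ) ≤ Q := by exact_mod_cast hk
      have hm' : ((2^m:ℕ):ℝ) ≤ R₁ * R₂ := by exact_mod_cast hm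
      have hk0 : (0:ℝ) < ((2^k:ℕ):ℝ) := by positivity
      have hm0 : (0:ℝ) < ((2^m:ℕ):ℝ) := by positivity
      apply Real.le_sqrt_of_sq_le
      have := H x M N R₂ Dv (2^k) (2^m) ((IL M Q).filter (fun i => Nat.log 2 i.1 = k)) ((JR N R₁ R₂).filter (fun j => Nat.log 2 (j.1 * j.2.1) = m))
        (fun j => (((1 - (j.2.1:ℝ)/R₂ : ℝ)):ℂ)) hx hM hN (by positivity) (le_trans (mul_le_mul_of_nonneg_left hk' (by linarith)) hCQ) hR2' hCR (by positivity)
        (hm'.trans hRN) (fun A hA hA2 => hDv A hA (by omega)) (by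
          intro i hi
          rw [mem_filter] at hi
          obtain ⟨h1, h2, h3, h4⟩ := hI i hi.1
          refine ⟨⟨?_, ?_⟩, h3, h4⟩
          · rw [← hi.2]; exact Nat.pow_log_le_self 2 (by omega)
          · rw [← hi.2]; have := Nat.lt_pow_succ_log_self (b := 2) (by norm_num) i.1
            rw [pow_succ] at this; omega) (by
          intro j hj
          rw [mem_filter] at hj
          obtain ⟨h1, h2, h3, h4, h5, h6⟩ := hJ j hj.1
          have hp : 0 < j.1 * j.2.1 := Nat.mul_pos h1 h3
          refine ⟨⟨?_, ?_⟩, ⟨?_, ?_⟩, h5, h6⟩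
          · rw [← hj.2]; exact Nat.pow_log_le_self 2 (by omega)
          · rw [← hj.2]; have := Nat.lt_pow_succ_log_self (b := 2) (by norm_num) (j.1 * j.2.1)
            rw [pow_succ] at this; omega
          · exact_mod_cast (h2.le.trans hR12)
          · exact_mod_cast h4.le) (by
          intro j hj
          rw [mem_filter] at hj
          obtain ⟨h1, h2, h3, h4, h5, h6⟩ := hJ j hj.1
          have hs2 : (j.2.1:ℝ) ≤ R₂ := by exact_mod_cast h4.le
          have hh1 : (j.2.1:ℝ)/R₂ ≤ 1 := by rw [div_le_one (by linarith)]; exact hs2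
          have hh0 : 0 ≤ (j.2.1:ℝ)/R₂ := by positivity
          rw [Complex.norm_real, Real.norm_eq_abs, abs_of_nonneg (by linarith)]
          linarith)
      refine this.trans ?_
      rw [hW]
      have mono := BB_mono ((2^k:ℕ):ℝ) Q M ((2^m:ℕ):ℝ) (R₁*R₂) N R₂ l hk0 hk' hM0 hm0 hm' hN0 (by linarith) hl hL
      exact mul_le_mul_of_nonneg_left mono (by positivity)) hQ (Nat.mul_pos hR1 hR2p)
  have hW0 : 0 ≤ W := by
    have : 0 < L := by linarith
    rw [hW, BB]; positivity
  rw [← e1] at key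
  have hT0 : 0 ≤ T3 c x M N Q R₁ R₂ := by rw [T3]; positivity
  have k1 := natlog_bd Q M hQ hQM2
  have k2 := natlog_bd (R₁*R₂) N (Nat.mul_pos hR1 hR2p) (by push_cast; exact hRN)
  calc T3 c x M N Q R₁ R₂ ^ 2 ≤ (2 * lm * (2 * ln) * Real.sqrt W)^2 := by
        refine pow_le_pow_left₀ hT0 (key.trans ?_) 2
        gcongr
    _ = 16 * lm^2 * ln^2 * W := by rw [mul_pow, Real.sq_sqrt hW0]; ring
    _ = _ := by rw [hW]; ring

lemma vdcfin (T C W N L y κ lN lL : ℝ) (hN : N = Real.exp lN) (hL : L = Real.exp lL) (hW : 0 ≤ W) (hC : 2 * C ≤ Real.exp κ) (hC0 : 0 ≤ C)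
   (hT : T ≤ C * W * (N * Real.sqrt L + 1 / Real.sqrt L)) (h1 : lL ≤ -2*y-2*κ) (h2 : -lL - 2*lN ≤ -2*y-2*κ) : T ≤ W * N * Real.exp (-y) := by
  have hs : Real.sqrt L = Real.exp (lL/2) := by rw [hL, Real.exp_half]
  refine hT.trans ?_
  have a1 : N * Real.sqrt L ≤ N * Real.exp (-y) * Real.exp (-κ) := by
    rw [hs, mul_assoc, ← Real.exp_add]
    have : 0 ≤ N := by rw [hN]; positivity
    gcongr; linarith
  have a2 : 1 / Real.sqrt L ≤ N * Real.exp (-y) * Real.exp (-κ) := by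
    rw [hs, hN, one_div, ← Real.exp_neg, ← Real.exp_add, ← Real.exp_add]
    apply Real.exp_le_exp.mpr; linarith
  have hp : 0 ≤ W * N * Real.exp (-y) * Real.exp (-κ) := by rw [hN]; positivity
  calc C * W * (N * Real.sqrt L + 1 / Real.sqrt L) ≤ C * W * (N * Real.exp (-y) * Real.exp (-κ) + N * Real.exp (-y) * Real.exp (-κ)) := by gcongr
    _ = 2 * C * (W * N * Real.exp (-y) * Real.exp (-κ)) := by ring
    _ ≤ Real.exp κ * (W * N * Real.exp (-y) * Real.exp (-κ)) := by gcongr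
    _ = W * N * Real.exp (-y) * (Real.exp κ * Real.exp (-κ)) := by ring
    _ = _ := by rw [← Real.exp_add]; simp

lemma BBfin (lQ lM lR lN lw lL z : ℝ)
   (h1 : lL - lQ - lM - lR - lN ≤ -z) (h2 : lL - lQ - lM + 2/3*lw - 2*lN ≤ -z) (h3 : lL - lQ - lM + 4*lw - 4*lN ≤ -z) (h4 : -lQ-lM ≤ -z)
   (h5 : lL + 2*lQ - 2*lM - lR - lN ≤ -z) (h6 : lL + 2*lQ - 2*lM + 2/3*lw - 2*lN ≤ -z) (h7 : lL + 2*lQ - 2*lM + 4*lw - 4*lN ≤ -z) (h8 : 2*lQ-2*lM ≤ -z)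
   (h9 : -lR-lN ≤ -z) (h10 : 2/3*lw - 2*lN ≤ -z) (h11 : 4*lw-4*lN ≤ -z) (h12 : -lL ≤ -z) :
   BB (Real.exp lQ) (Real.exp lM) (Real.exp lR) (Real.exp lN) (Real.exp lw) (Real.exp lL) (Real.exp lL) ≤ 
     12 * (Real.exp lQ * Real.exp lM * Real.exp lR * Real.exp lN)^2 * Real.exp (-z) := by
  have hw : Real.exp lw ^ ((2:ℝ)/3) = Real.exp (2/3*lw) := by rw [← Real.exp_mul]; ring_nf
  have e : BB (Real.exp lQ) (Real.exp lM) (Real.exp lR) (Real.exp lN) (Real.exp lw) (Real.exp lL) (Real.exp lL) = 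
     (Real.exp lQ * Real.exp lM * Real.exp lR * Real.exp lN)^2 * ((Real.exp (lL-lQ-lM) + Real.exp (lL+2*lQ-2*lM) + 1) *
       (Real.exp (-lR-lN) + Real.exp (2/3*lw-2*lN) + Real.exp (4*lw-4*lN) + Real.exp (-lL))) := by
    rw [BB, hw]
    have t1 : Real.exp (lL-lQ-lM) = Real.exp lL / (Real.exp lQ * Real.exp lM) := by
      rw [← Real.exp_add, ← Real.exp_sub]; ring_nf
    have t2 : Real.exp (lL+2*lQ-2*lM) = Real.exp lL * Real.exp lQ^2 / (Real.exp lM)^2 := by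
      rw [← Real.exp_nat_mul, ← Real.exp_nat_mul, ← Real.exp_add, ← Real.exp_sub]; push_cast; ring_nf
    have t3 : Real.exp (-lR-lN) = 1 / (Real.exp lR * Real.exp lN) := by
      rw [← Real.exp_add, one_div, ← Real.exp_neg]; ring_nf
    have t4 : Real.exp (2/3*lw-2*lN) = Real.exp (2/3*lw) / (Real.exp lN)^2 := by
      rw [← Real.exp_nat_mul, ← Real.exp_sub]; push_cast; ring_nf
    have t5 : Real.exp (4*lw-4*lN) = Real.exp lw^4 / (Real.exp lN)^4 := by
      rw [← Real.exp_nat_mul, ← Real.exp_nat_mul, ← Real.exp_sub]; push_cast; ring_nf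
    have t6 : Real.exp (-lL) = 1 / Real.exp lL := by rw [one_div, ← Real.exp_neg]
    rw [t1, t2, t3, t4, t5, t6]
    have p1 := Real.exp_pos lQ
    have p2 := Real.exp_pos lM
    have p3 := Real.exp_pos lR
    have p4 := Real.exp_pos lN
    have p6 := Real.exp_pos lL
    generalize Real.exp lQ = Q at *
    generalize Real.exp lM = M at *
    generalize Real.exp lR = R at *
    generalize Real.exp lN = N at *
    generalize Real.exp lL = L at *
    field_simp
  rw [e]
  have b : ∀ u v : ℝ, u + v ≤ -z → Real.exp u * Real.exp v ≤ Real.exp (-z) := by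
    intro u v h; rw [← Real.exp_add]; exact Real.exp_le_exp.mpr h
  have b' : ∀ v : ℝ, v ≤ -z → Real.exp v ≤ Real.exp (-z) := fun v h => Real.exp_le_exp.mpr h
  have k1 := b (lL-lQ-lM) (-lR-lN) (by linarith)
  have k2 := b (lL-lQ-lM) (2/3*lw-2*lN) (by linarith)
  have k3 := b (lL-lQ-lM) (4*lw-4*lN) (by linarith)
  have k4 := b (lL-lQ-lM) (-lL) (by linarith)
  have k5 := b (lL+2*lQ-2*lM) (-lR-lN) (by linarith)
  have k6 := b (lL+2*lQ-2*lM) (2/3*lw-2*lN) (by linarith)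
  have k7 := b (lL+2*lQ-2*lM) (4*lw-4*lN) (by linarith)
  have k8 := b (lL+2*lQ-2*lM) (-lL) (by linarith)
  have k9 := b' (-lR-lN) (by linarith)
  have k10 := b' (2/3*lw-2*lN) (by linarith)
  have k11 := b' (4*lw-4*lN) (by linarith)
  have k12 := b' (-lL) (by linarith)
  have : (Real.exp (lL-lQ-lM) + Real.exp (lL+2*lQ-2*lM) + 1) *
       (Real.exp (-lR-lN) + Real.exp (2/3*lw-2*lN) + Real.exp (4*lw-4*lN) + Real.exp (-lL)) ≤ 12 * Real.exp (-z) := by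
    have e1 : (Real.exp (lL-lQ-lM) + Real.exp (lL+2*lQ-2*lM) + 1) *
       (Real.exp (-lR-lN) + Real.exp (2/3*lw-2*lN) + Real.exp (4*lw-4*lN) + Real.exp (-lL)) = 
       Real.exp (lL-lQ-lM) * Real.exp (-lR-lN) + Real.exp (lL-lQ-lM) * Real.exp (2/3*lw-2*lN) + Real.exp (lL-lQ-lM) * Real.exp (4*lw-4*lN) + Real.exp (lL-lQ-lM) * Real.exp (-lL)
       + (Real.exp (lL+2*lQ-2*lM) * Real.exp (-lR-lN) + Real.exp (lL+2*lQ-2*lM) * Real.exp (2/3*lw-2*lN) + Real.exp (lL+2*lQ-2*lM) * Real.exp (4*lw-4*lN) + Real.exp (lL+2*lQ-2*lM) * Real.exp (-lL))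
       + (Real.exp (-lR-lN) + Real.exp (2/3*lw-2*lN) + Real.exp (4*lw-4*lN) + Real.exp (-lL)) := by ring
    rw [e1]; linarith
  calc _ ≤ (Real.exp lQ * Real.exp lM * Real.exp lR * Real.exp lN)^2 * (12 * Real.exp (-z)) := mul_le_mul_of_nonneg_left this (by positivity)
    _ = _ := by ring

lemma core_bound (c : ℝ) (hc : 2 < c) (hc3 : c < 3) : ∃ C ≥ (1:ℝ), ∀ (x M N l d h E Dv lx lM lN lQ l1 l2 : ℝ) (Q R₁ R₂ : ℕ),
    x = Real.exp lx → M = Real.exp lM → N = Real.exp lN → (Q:ℝ) = Real.exp lQ → (R₁:ℝ) = Real.exp l1 → (R₂:ℝ) = Real.exp l2 →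
    1 ≤ M → 1 ≤ N → R₁ ≤ R₂ → 0 < d → 0 < h → h ≤ d → 0 < E → 1000 * E ≤ d → 1000 * E ≤ l/2 - 18*d →
    72/7*d - E ≤ lM → lM ≤ l/2 + E → l - E ≤ lM + lN → lM + lN ≤ l + E →
    15/4*d ≤ lQ → lQ ≤ 15/4*d + E → 4*d ≤ l1 → l1 ≤ 4*d+E → 8*d ≤ l2 → l2 ≤ 8*d+E →
    l - h - 4*E ≤ lx + c*lM + c*lN → lx + c*lM + c*lN ≤ 2*l + 2*d - 2*h + 4*E →
    C ≤ Real.exp E → 12 ≤ Real.exp E → 0 ≤ Dv → Dv ≤ Real.exp E → 1 + Real.log M ≤ Real.exp E → 1 + Real.log N ≤ Real.exp E →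
    (∀A:ℕ,0<A→A≤2*(R₁*R₂)→(A.divisors.card:ℝ)≤Dv) →
    T1 c x M N Q ≤ Q*M*N*Real.exp (-(2*d)) ∨ T2 c x M N Q R₁ ≤ Q*M*N*R₁*Real.exp (-(4*d)) ∨ T3 c x M N Q R₁ R₂ ≤ Q*M*N*R₁*R₂*Real.exp (-(8*d)) := by
  obtain ⟨C1, hC1, H1⟩ := T1_bd c hc hc3
  obtain ⟨C2, hC2, H2⟩ := T2_bd c hc hc3
  obtain ⟨C3, hC3, H3⟩ := T3_bd c hc hc3
  obtain ⟨C4, hC4, H4⟩ := T3_dls c hc hc3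
  refine ⟨C1+C2+C3+C4, by linarith, ?_⟩
  intro x M N l d h E Dv lx lM lN lQ l1 l2 Q R₁ R₂ hx hM hN hQ hR1 hR2 hM1 hN1 hR12 hd hh hhd hE hE1 hE2 b1 b2 b3 b4 b5 b6 b7 b8 b9 b10 b11 b12 hC h12 hDv0 hDv hlm hln hdiv
  have hx0 : 0 < x := by rw [hx]; exact Real.exp_pos _
  have hQ0' : (0:ℝ) < Q := by rw [hQ]; exact Real.exp_pos _
  have hR10' : (0:ℝ) < R₁ := by rw [hR1]; exact Real.exp_pos _
  have hR20' : (0:ℝ) < R₂ := by rw [hR2]; exact Real.exp_pos _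
  have hQ0 : 0 < Q := by exact_mod_cast hQ0'
  have hR10 : 0 < R₁ := by exact_mod_cast hR10'
  have hR20 : 0 < R₂ := by exact_mod_cast hR20'
  have hM0 : 0 < M := by linarith
  have hN0 : 0 < N := by linarith
  have hQM : (Q:ℝ) ≤ M := by rw [hQ, hM]; apply Real.exp_le_exp.mpr; linarith
  have hMp : ∀ p : ℝ, M^p = Real.exp (lM * p) := by intro p; rw [hM, ← Real.exp_mul]
  have hNp : ∀ p : ℝ, N^p = Real.exp (lN * p) := by intro p; rw [hN, ← Real.exp_mul]
  have hee : Real.exp (2*E) = Real.exp E * Real.exp E := by rw [← Real.exp_add]; ring_nf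
  have h2C : ∀ C' : ℝ, C' ≤ C1+C2+C3+C4 → 2 * C' ≤ Real.exp (2*E) := by
    intro C' h'; rw [hee]
    have : C' ≤ Real.exp E := by linarith
    have hp := Real.exp_pos E
    calc 2 * C' ≤ 2 * Real.exp E := by linarith
      _ ≤ Real.exp E * Real.exp E := by gcongr; linarith
  by_cases c1 : lx + c*lM + c*lN ≤ l + 9*d
  · left
    have := vdcfin _ C1 (Q*M) N (x * M^(c-1) * N^(c-2) * Q) (2*d) (2*E) lN (lx + lM*(c-1) + lN*(c-2) + lQ) hN
      (by rw [hMp, hNp, hx, hQ]; simp only [← Real.exp_add]) (by positivity) (h2C C1 (by linarith)) (by linarith) (H1 x M N Q hx0 hM1 hN1 hQM) (by linarith) (by linarith)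
    refine this.trans (le_of_eq ?_); ring
  push Not at c1
  by_cases c2 : lx + c*lM + c*lN ≤ l + d + lN
  · right; left
    have := vdcfin _ C2 (Q*M*R₁) N (x * M^(c-1) * N^(c-3) * R₁ * Q) (4*d) (2*E) lN (lx + lM*(c-1) + lN*(c-3) + l1 + lQ) hN
      (by rw [hMp, hNp, hx, hQ, hR1]; simp only [← Real.exp_add]) (by positivity) (h2C C2 (by linarith)) (by linarith) (H2 x M N Q R₁ hx0 hM1 hN1 hQM hR10) (by linarith) (by linarith)
    refine this.trans (le_of_eq ?_); ring
  push Not at c2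
  right; right
  by_cases c3 : lM ≤ 25/2*d
  · have := vdcfin _ C3 (Q*M*R₁*R₂) N (x * M^(c-1) * N^(c-4) * R₂ * R₁ * Q) (8*d) (2*E) lN (lx + lM*(c-1) + lN*(c-4) + l2 + l1 + lQ) hN
      (by rw [hMp, hNp, hx, hQ, hR1, hR2]; simp only [← Real.exp_add]) (by positivity) (h2C C3 (by linarith)) (by linarith) (H3 x M N Q R₁ R₂ hx0 hM1 hN1 hQM hR10 hR20) (by linarith) (by linarith)
    refine this.trans (le_of_eq ?_); ring
  push Not at c3
  set lL := lx + lM*(c-1) + lN*(c-2) + (lQ + (l1 + l2)) with hlL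
  have hL : x * M^(c-1) * N^(c-2) * (Q * (R₁ * R₂)) = Real.exp lL := by rw [hMp, hNp, hx, hQ, hR1, hR2]; simp only [← Real.exp_add]; rw [hlL]
  have hC4 : C4 ≤ Real.exp E := by linarith
  have key := H4 x M N Dv Q R₁ R₂ hx0 hM1 hN1 hQ0
    (by calc C4 * Q ≤ Real.exp E * Real.exp lQ := by rw [← hQ]; gcongr
          _ ≤ M := by rw [← Real.exp_add, hM]; apply Real.exp_le_exp.mpr; linarith) hR10 hR12
    (by calc C4 * R₂ ≤ Real.exp E * Real.exp l2 := by rw [← hR2]; gcongr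
          _ ≤ N := by rw [← Real.exp_add, hN]; apply Real.exp_le_exp.mpr; linarith)
    (by rw [hR1, hR2, hN, ← Real.exp_add]; apply Real.exp_le_exp.mpr; linarith) hdiv
    (by rw [hL]; apply Real.one_le_exp; linarith)
  rw [hL] at key
  have hbb := BBfin lQ lM (l1+l2) lN l2 lL (16*d+14*E) (by linarith) (by linarith) (by linarith) (by linarith) (by linarith) (by linarith) (by linarith) (by linarith) (by linarith) (by linarith) (by linarith) (by linarith)
  rw [← hQ, ← hM, ← hN, Real.exp_add l1 l2, ← hR1, ← hR2] at hbb
  have hlm0 : 0 ≤ 1 + Real.log M := by have := Real.log_nonneg hM1; linarith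
  have hln0 : 0 ≤ 1 + Real.log N := by have := Real.log_nonneg hN1; linarith
  have hpw : C4 * (Dv^2 * (1 + Real.log M)^4 * (1 + Real.log N)^6) * 12 ≤ Real.exp (14*E) := by
    have : Real.exp (14*E) = Real.exp E * (Real.exp E^2 * Real.exp E^4 * Real.exp E^6) * Real.exp E := by
      rw [show 14*E = (14:ℕ)*E by norm_num, Real.exp_nat_mul]; ring
    rw [this]
    gcongr
  have fin : T3 c x M N Q R₁ R₂^2 ≤ (Q*M*N*R₁*R₂*Real.exp (-(8*d)))^2 := by
    refine key.trans ?_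
    have hW : 0 ≤ (Q*M*(R₁*R₂)*N)^2 * Real.exp (-(16*d+14*E)) := by positivity
    calc _ ≤ C4 * (Dv^2 * (1 + Real.log M)^4 * (1 + Real.log N)^6) * (12 * (Q*M*(R₁*R₂)*N)^2 * Real.exp (-(16*d+14*E))) := by gcongr
      _ = (C4 * (Dv^2 * (1 + Real.log M)^4 * (1 + Real.log N)^6) * 12) * ((Q*M*(R₁*R₂)*N)^2 * Real.exp (-(16*d+14*E))) := by ring
      _ ≤ Real.exp (14*E) * ((Q*M*(R₁*R₂)*N)^2 * Real.exp (-(16*d+14*E))) := by gcongr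
      _ = (Q*M*(R₁*R₂)*N)^2 * (Real.exp (14*E) * Real.exp (-(16*d+14*E))) := by ring
      _ = (Q*M*(R₁*R₂)*N)^2 * (Real.exp (-(8*d)))^2 := by rw [← Real.exp_add, ← Real.exp_nat_mul]; push_cast; ring_nf
      _ = _ := by ring
  exact le_of_sq_le_sq fin (by positivity)

lemma ceil_log (s E : ℝ) (hs : 0 ≤ s) (hE : 2 ≤ Real.exp E) : ∃ t : ℝ, ((⌈Real.exp s⌉₊:ℕ):ℝ) = Real.exp t ∧ s ≤ t ∧ t ≤ s + E := by
  have h1 := Nat.le_ceil (Real.exp s)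
  have h2 := (Nat.ceil_lt_add_one (Real.exp_pos s).le).le
  have h0 : 0 < ((⌈Real.exp s⌉₊:ℕ):ℝ) := lt_of_lt_of_le (Real.exp_pos s) h1
  refine ⟨Real.log ((⌈Real.exp s⌉₊:ℕ):ℝ), (Real.exp_log h0).symm, ?_, ?_⟩
  · rw [Real.le_log_iff_exp_le h0]; exact h1
  · rw [Real.log_le_iff_le_exp h0, Real.exp_add]
    have := Real.one_le_exp hs
    nlinarith [Real.exp_pos s]

lemma pos_case (c η δ D₁ D₂ D₃ D₄ : ℝ) (hc1 : 2 < c) (hc2 : c < 37/18) (hη : 0 < η) (hη2 : η < 37/36 - c/2) (hδ : δ = c/2 - 1 + η)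
    (hD1 : 0 < D₁) (hD2 : 0 < D₂) (hD3 : 0 < D₃) (hD4 : 0 < D₄) : ∃ X₀ : ℝ, ∀ X ≥ X₀, 1 < X ∧ ∀ x M N : ℝ, X^(1-c-η) ≤ x → x ≤ (Real.log X)^5 → 
      1 ≤ M → 1 ≤ N → D₁ * X ≤ M * N → M * N ≤ D₂ * X → D₃ * X ^ (72 * δ / 7) ≤ M → M ≤ D₄ * X ^ ((1 : ℝ) / 2) →
    ∀ a b : ℕ → ℂ, (∀ m, ‖a m‖ ≤ 1) → (∀ n, ‖b n‖ ≤ 1) →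
      ‖∑ m ∈ Ioc ⌊M⌋₊ ⌊2 * M⌋₊, ∑ n ∈ Ioc ⌊N⌋₊ ⌊2 * N⌋₊, a m * b n * e (x * (m : ℝ) ^ c * (n : ℝ) ^ c)‖ ≤ 12 * M * N * X^(-δ) := by
  have hδ0 : 0 < δ := by linarith
  have hδ1 : 18 * δ < 1/2 := by linarith
  obtain ⟨C, hC, H⟩ := core_bound c hc1 (by linarith)
  obtain ⟨ε, hε0, hε1, hε2⟩ : ∃ ε : ℝ, 0 < ε ∧ 1000 * ε ≤ δ ∧ 1000 * ε ≤ 1/2 - 18 * δ := by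
    refine ⟨min δ (1/2 - 18*δ) / 1000, div_pos (lt_min hδ0 (by linarith)) (by norm_num), ?_, ?_⟩
    · have := min_le_left δ (1/2 - 18*δ); linarith
    · have := min_le_right δ (1/2 - 18*δ); linarith
  obtain ⟨Cd, hCd, Hd⟩ := divisor_bd (ε/2) (by linarith)
  set s := ε/10 with hs
  have hs0 : 0 < s := by linarith
  obtain ⟨K, hK⟩ : ∃ K : ℝ, K = C + 12 + Cd + 1/D₁ + D₂ + 1/D₃ + D₄ + (1/s)^5 + (1 + 2 * (1/s)) := ⟨_, rfl⟩
  have q1 : 0 < 1/D₁ := by positivity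
  have q3 : 0 < 1/D₃ := by positivity
  have qs : 0 < 1/s := by positivity
  have qs5 : 0 < (1/s)^5 := by positivity
  have hev := (tendsto_rpow_atTop (by linarith : 0 < ε/2)).eventually_ge_atTop K
  obtain ⟨X1, hX1⟩ := (hev.and (Filter.eventually_gt_atTop (1:ℝ))).exists_forall_of_atTop
  refine ⟨X1, ?_⟩
  intro X hX
  obtain ⟨hKX, hX1'⟩ := hX1 X hX
  refine ⟨hX1', ?_⟩
  intro x M N hx1 hx2 hM hN hMN1 hMN2 hM1 hM2 a b ha hb
  have hX0 : 0 < X := by linarith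
  obtain ⟨l, hl⟩ : ∃ l, l = Real.log X := ⟨_, rfl⟩
  have hl0 : 0 < l := by rw [hl]; exact Real.log_pos hX1'
  have hXe : X = Real.exp l := by rw [hl, Real.exp_log hX0]
  have hXp : ∀ p : ℝ, X^p = Real.exp (l * p) := by intro p; rw [hXe, ← Real.exp_mul]
  obtain ⟨E, hE⟩ : ∃ E, E = ε * l := ⟨_, rfl⟩
  obtain ⟨d, hd⟩ : ∃ d, d = δ * l := ⟨_, rfl⟩
  obtain ⟨h, hh⟩ : ∃ h, h = η * l := ⟨_, rfl⟩
  have hE0 : 0 < E := by rw [hE]; positivity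
  have hd0 : 0 < d := by rw [hd]; positivity
  have hh0 : 0 < h := by rw [hh]; positivity
  have hhd : h ≤ d := by rw [hh, hd]; exact mul_le_mul_of_nonneg_right (by linarith) hl0.le
  have hE1 : 1000 * E ≤ d := by rw [hE, hd, ← mul_assoc]; exact mul_le_mul_of_nonneg_right hε1 hl0.le
  have hE2 : 1000 * E ≤ l/2 - 18*d := by
    have := mul_le_mul_of_nonneg_right hε2 hl0.le
    rw [hE, hd]; linarith
  have hcl : c * l = 2 * l + 2 * d - 2 * h := by rw [hd, hh, hδ]; ring
  have hKE : K ≤ Real.exp (E/2) := by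
    rw [hXp] at hKX; rw [hE]; refine hKX.trans (le_of_eq ?_); congr 1; ring
  have hEE : Real.exp (E/2) ≤ Real.exp E := Real.exp_le_exp.mpr (by linarith)
  have hKE2 : K ≤ Real.exp E := hKE.trans hEE
  have hdbl : Real.exp (E/2) * Real.exp (E/2) = Real.exp E := by rw [← Real.exp_add]; ring_nf
  have hlog : l ≤ Real.exp (E/10) * (1/s) := by
    have := Real.log_le_rpow_div hX0.le hs0
    rw [← hl, hXp, div_eq_mul_one_div] at this
    refine this.trans (le_of_eq ?_)
    congr 2; rw [hE, hs]; ring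
  have hlog5 : l^5 ≤ Real.exp E := by
    calc l^5 ≤ (Real.exp (E/10) * (1/s))^5 := by gcongr
      _ = Real.exp (E/2) * (1/s)^5 := by rw [mul_pow, ← Real.exp_nat_mul]; push_cast; ring_nf
      _ ≤ Real.exp (E/2) * Real.exp (E/2) := by gcongr; linarith
      _ = _ := hdbl
  have hlog1 : 1 + 2 * l ≤ Real.exp E := by
    have h1 : Real.exp (E/10) ≤ Real.exp (E/2) := Real.exp_le_exp.mpr (by linarith)
    have h2 : 1 ≤ Real.exp (E/2) := Real.one_le_exp (by linarith)
    calc 1 + 2 * l ≤ Real.exp (E/2) + 2 * (Real.exp (E/2) * (1/s)) := by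
          have := mul_le_mul_of_nonneg_right h1 qs.le
          linarith
      _ = Real.exp (E/2) * (1 + 2 * (1/s)) := by ring
      _ ≤ Real.exp (E/2) * Real.exp (E/2) := by gcongr; linarith
      _ = _ := hdbl
  have hx0 : 0 < x := lt_of_lt_of_le (by positivity) hx1
  have hM0 : 0 < M := by linarith
  have hN0 : 0 < N := by linarith
  obtain ⟨lx, hlx⟩ : ∃ t, t = Real.log x := ⟨_, rfl⟩
  obtain ⟨lM, hlM⟩ : ∃ t, t = Real.log M := ⟨_, rfl⟩
  obtain ⟨lN, hlN⟩ : ∃ t, t = Real.log N := ⟨_, rfl⟩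
  have ex : x = Real.exp lx := by rw [hlx, Real.exp_log hx0]
  have eM : M = Real.exp lM := by rw [hlM, Real.exp_log hM0]
  have eN : N = Real.exp lN := by rw [hlN, Real.exp_log hN0]
  have lM0 : 0 ≤ lM := by rw [hlM]; exact Real.log_nonneg hM
  have lN0 : 0 ≤ lN := by rw [hlN]; exact Real.log_nonneg hN
  have hD1' : Real.exp (-E) ≤ D₁ := by
    rw [Real.exp_neg, inv_le_comm₀ (Real.exp_pos E) hD1, ← one_div]; linarith
  have hD3' : Real.exp (-E) ≤ D₃ := by
    rw [Real.exp_neg, inv_le_comm₀ (Real.exp_pos E) hD3, ← one_div]; linarith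
  have m1 : l - E ≤ lM + lN := by
    apply Real.exp_le_exp.mp
    calc Real.exp (l - E) = Real.exp (-E) * Real.exp l := by rw [← Real.exp_add]; ring_nf
      _ ≤ D₁ * X := by rw [← hXe]; gcongr
      _ ≤ M * N := hMN1
      _ = _ := by rw [Real.exp_add, ← eM, ← eN]
  have m2 : lM + lN ≤ l + E := by
    apply Real.exp_le_exp.mp
    calc Real.exp (lM + lN) = M * N := by rw [Real.exp_add, ← eM, ← eN]
      _ ≤ D₂ * X := hMN2
      _ ≤ Real.exp E * Real.exp l := by rw [← hXe]; gcongr; linarith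
      _ = _ := by rw [← Real.exp_add]; ring_nf
  have m3 : 72/7*d - E ≤ lM := by
    apply Real.exp_le_exp.mp
    calc Real.exp (72/7*d - E) = Real.exp (-E) * X^(72*δ/7) := by rw [hXp, ← Real.exp_add, hd]; ring_nf
      _ ≤ D₃ * X^(72*δ/7) := by gcongr
      _ ≤ M := hM1
      _ = _ := eM
  have m4 : lM ≤ l/2 + E := by
    apply Real.exp_le_exp.mp
    calc Real.exp lM = M := eM.symm
      _ ≤ D₄ * X^((1:ℝ)/2) := hM2
      _ ≤ Real.exp E * X^((1:ℝ)/2) := by gcongr; linarith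
      _ = _ := by rw [hXp, ← Real.exp_add]; ring_nf
  have x1 : (1-c-η) * l ≤ lx := by
    apply Real.exp_le_exp.mp
    rw [← ex]; refine le_trans (le_of_eq ?_) hx1
    rw [hXp]; ring_nf
  have x2 : lx ≤ E := by
    apply Real.exp_le_exp.mp
    rw [← ex]; refine hx2.trans ?_
    rw [← hl]; exact hlog5
  have c0 : 0 < c := by linarith
  have f1 : c * (l - E) ≤ c * (lM + lN) := mul_le_mul_of_nonneg_left m1 c0.le
  have f2 : c * (lM + lN) ≤ c * (l + E) := mul_le_mul_of_nonneg_left m2 c0.le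
  have cE : c * E ≤ 3 * E := mul_le_mul_of_nonneg_right (by linarith) hE0.le
  have two : 2 ≤ Real.exp E := by linarith
  obtain ⟨lQ, eQ, Q1, Q2⟩ := ceil_log (15/4*d) E (by linarith) two
  obtain ⟨l1, e1, R1, R1'⟩ := ceil_log (4*d) E (by linarith) two
  obtain ⟨l2, e2, R2, R2'⟩ := ceil_log (8*d) E (by linarith) two
  have hR12 : ⌈Real.exp (4*d)⌉₊ ≤ ⌈Real.exp (8*d)⌉₊ := Nat.ceil_mono (Real.exp_le_exp.mpr (by linarith))
  generalize ⌈Real.exp (15/4*d)⌉₊ = Q at *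
  generalize ⌈Real.exp (4*d)⌉₊ = R₁ at *
  generalize ⌈Real.exp (8*d)⌉₊ = R₂ at *
  have hxl : (1-c-η) * l = l - (2 * l + 2 * d - 2 * h) - h := by rw [← hcl, hh]; ring
  have key := H x M N l d h E (Real.exp E) lx lM lN lQ l1 l2 Q R₁ R₂ ex eM eN eQ e1 e2 hM hN hR12 hd0 hh0 hhd hE0 hE1 hE2 m3 m4 m1 m2 Q1 Q2 R1 R1' R2 R2'
    (by linarith) (by linarith) (by linarith) (by linarith) (Real.exp_pos E).le le_rfl (by rw [← hlM]; linarith) (by rw [← hlN]; linarith) (by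
      intro A hA hA2
      have hA2' : (A:ℝ) ≤ 2 * (R₁ * R₂) := by exact_mod_cast hA2
      have hA3 : (A:ℝ) ≤ Real.exp l := by
        calc (A:ℝ) ≤ 2 * (R₁ * R₂) := hA2'
          _ ≤ Real.exp E * (Real.exp l1 * Real.exp l2) := by rw [e1, e2]; gcongr
          _ = Real.exp (E + (l1 + l2)) := by rw [Real.exp_add, Real.exp_add]
          _ ≤ _ := Real.exp_le_exp.mpr (by linarith)
      calc (A.divisors.card:ℝ) ≤ Cd * (A:ℝ)^(ε/2) := Hd A hA
        _ ≤ Cd * (Real.exp l)^(ε/2) := by gcongr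
        _ = Cd * Real.exp (E/2) := by rw [← Real.exp_mul, hE]; ring_nf
        _ ≤ Real.exp (E/2) * Real.exp (E/2) := by gcongr; linarith
        _ = _ := hdbl)
  have hY : X^(-δ) = Real.exp (-d) := by rw [hXp, hd]; ring_nf
  have pw : ∀ k : ℕ, Real.exp (-d)^k = Real.exp (-(k*d)) := by intro k; rw [← Real.exp_nat_mul]; ring_nf
  have hQ0' : (0:ℝ) < Q := by rw [eQ]; exact Real.exp_pos _
  have hR10' : (0:ℝ) < R₁ := by rw [e1]; exact Real.exp_pos _
  have hR20' : (0:ℝ) < R₂ := by rw [e2]; exact Real.exp_pos _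
  rw [hY]
  refine chain c x M N (Real.exp (-d)) Q R₁ R₂ a b ha hb hM hN (by exact_mod_cast hQ0') ?_ (by exact_mod_cast hR10') ?_ (by exact_mod_cast hR20') ?_ (Real.exp_pos _) ?_ ?_ ?_ ?_
  · rw [eQ, eM]; exact Real.exp_le_exp.mpr (by linarith)
  · rw [e1, eN]; exact Real.exp_le_exp.mpr (by linarith)
  · rw [e2, eN]; exact Real.exp_le_exp.mpr (by linarith)
  · rw [eQ, pw, ← Real.exp_add]; apply Real.one_le_exp; push_cast; linarith
  · rw [e1, pw, ← Real.exp_add]; apply Real.one_le_exp; push_cast; linarith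
  · rw [e2, pw, ← Real.exp_add]; apply Real.one_le_exp; push_cast; linarith
  · rw [pw, pw, pw]; push_cast; exact key

lemma sum_conj_e (s t : Finset ℕ) (a b : ℕ → ℂ) (x c : ℝ) : ‖∑ m ∈ s, ∑ n ∈ t, a m * b n * e (x * (m:ℝ)^c * (n:ℝ)^c)‖ = 
    ‖∑ m ∈ s, ∑ n ∈ t, (starRingEnd ℂ) (a m) * (starRingEnd ℂ) (b n) * e ((-x) * (m:ℝ)^c * (n:ℝ)^c)‖ := by
  rw [← RCLike.norm_conj]
  congr 1
  rw [map_sum]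
  apply Finset.sum_congr rfl; intro m _
  rw [map_sum]
  apply Finset.sum_congr rfl; intro n _
  rw [map_mul, map_mul, e_conj]
  congr 2; ring

theorem stmt17 (c : ℝ) (hc1 : 2 < c) (hc2 : c < 37 / 18) :
    ∃ η₀ > 0, ∀ η : ℝ, 0 < η → η < η₀ → ∀ δ : ℝ, δ = c / 2 - 1 + η →
    ∀ D₁ D₂ D₃ D₄ D₅ : ℝ, 0 < D₁ → 0 < D₂ → 0 < D₃ → 0 < D₄ → 0 < D₅ →
    ∃ C > 0, ∃ X₀ : ℝ, ∀ X ≥ X₀, ∀ τ K : ℝ,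
      τ = X ^ (1 - c - η) → K = (Real.log X) ^ 5 →
    ∀ x : ℝ, τ ≤ |x| → |x| ≤ K →
    ∀ M N : ℝ, 1 ≤ M → 1 ≤ N → D₁ * X ≤ M * N → M * N ≤ D₂ * X →
      D₃ * X ^ (72 * δ / 7) ≤ M → M ≤ D₄ * X ^ ((1 : ℝ) / 2) →
    ∀ a b : ℕ → ℂ, (∀ m, ‖a m‖ ≤ D₅) → (∀ n, ‖b n‖ ≤ D₅) →
      ‖∑ m ∈ Finset.Ioc ⌊M⌋₊ ⌊2 * M⌋₊, ∑ n ∈ Finset.Ioc ⌊N⌋₊ ⌊2 * N⌋₊,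
          a m * b n * e (x * (m : ℝ) ^ c * (n : ℝ) ^ c)‖ ≤ C * X ^ (1 - δ) := by
  refine ⟨37/36 - c/2, by linarith, ?_⟩
  intro η hη hη2 δ hδ D₁ D₂ D₃ D₄ D₅ hD1 hD2 hD3 hD4 hD5
  obtain ⟨X₀, H⟩ := pos_case c η δ D₁ D₂ D₃ D₄ hc1 hc2 hη hη2 hδ hD1 hD2 hD3 hD4
  refine ⟨12 * D₅^2 * D₂, by positivity, X₀, ?_⟩
  intro X hX τ K hτ hK x hx1 hx2 M N hM hN hMN1 hMN2 hM1 hM2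
  obtain ⟨hX1, H⟩ := H X hX
  have hX0 : 0 < X := by linarith
  have hH := H |x| M N (by rw [← hτ]; exact hx1) (by rw [← hK]; exact hx2) hM hN hMN1 hMN2 hM1 hM2
  have red : ∀ a b : ℕ → ℂ, (∀ m, ‖a m‖ ≤ D₅) → (∀ n, ‖b n‖ ≤ D₅) →
      ‖∑ m ∈ Finset.Ioc ⌊M⌋₊ ⌊2 * M⌋₊, ∑ n ∈ Finset.Ioc ⌊N⌋₊ ⌊2 * N⌋₊,
          a m * b n * e (|x| * (m : ℝ) ^ c * (n : ℝ) ^ c)‖ ≤ 12 * D₅^2 * D₂ * X ^ (1 - δ) := by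
    intro a b ha hb
    have hD5c : (D₅:ℂ) ≠ 0 := by exact_mod_cast hD5.ne'
    have nrm : ∀ z : ℂ, ‖z‖ ≤ D₅ → ‖z / D₅‖ ≤ 1 := by
      intro z hz
      rw [norm_div, Complex.norm_real, Real.norm_eq_abs, abs_of_pos hD5, div_le_one hD5]; exact hz
    have h1 := hH (fun m => a m / D₅) (fun n => b n / D₅) (fun m => nrm _ (ha m)) (fun n => nrm _ (hb n))
    have e1 : ∑ m ∈ Finset.Ioc ⌊M⌋₊ ⌊2 * M⌋₊, ∑ n ∈ Finset.Ioc ⌊N⌋₊ ⌊2 * N⌋₊, a m * b n * e (|x| * (m : ℝ) ^ c * (n : ℝ) ^ c)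
       = (D₅:ℂ)^2 * ∑ m ∈ Finset.Ioc ⌊M⌋₊ ⌊2 * M⌋₊, ∑ n ∈ Finset.Ioc ⌊N⌋₊ ⌊2 * N⌋₊, a m / D₅ * (b n / D₅) * e (|x| * (m : ℝ) ^ c * (n : ℝ) ^ c) := by
      rw [Finset.mul_sum]; apply Finset.sum_congr rfl; intro m _
      rw [Finset.mul_sum]; apply Finset.sum_congr rfl; intro n _
      field_simp
    rw [e1, norm_mul, norm_pow, Complex.norm_real, Real.norm_eq_abs, abs_of_pos hD5]
    calc _ ≤ D₅^2 * (12 * M * N * X^(-δ)) := by gcongr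
      _ = 12 * D₅^2 * (M * N) * X^(-δ) := by ring
      _ ≤ 12 * D₅^2 * (D₂ * X) * X^(-δ) := by gcongr
      _ = 12 * D₅^2 * D₂ * (X^(1:ℝ) * X^(-δ)) := by rw [Real.rpow_one]; ring
      _ = _ := by rw [← Real.rpow_add hX0, ← sub_eq_add_neg]
  intro a b ha hb
  rcases le_total 0 x with h | h
  · have := red a b ha hb
    rwa [abs_of_nonneg h] at this
  · rw [sum_conj_e]
    have := red (fun m => (starRingEnd ℂ) (a m)) (fun n => (starRingEnd ℂ) (b n)) (fun m => by rw [RCLike.norm_conj]; exact ha m) (fun n => by rw [RCLike.norm_conj]; exact hb n)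
    rwa [abs_of_nonpos h] at this
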